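/- Fix integers k1 ≥ 2, k2 ≥ 2, set k := min{k1,k2}, and let c > c*(k1,k2). Then there is a constant C > 0 such that for every positive integer n, the number of simple digraphs on vertex set {1,…,n} with exactly m = ⌊cn⌋ edges whose (k1,k2)-core is either empty or not k-strongly connected is at most C·n^{-(k-1)} times the total number of simple digraphs on {1,…,n} with m edges. Equivalently, with probability 1 − O(n^{-min{k1,k2}+1}) the uniformly random digraph D(n, m=⌊cn⌋) has a nonempty (k1,k2)-core which is min{k1,k2}-strongly connected. -/

import Mathlib

/-- `fk k x = ∑_{j ≥ k} x^j / j!`, the tail of the exponential series. -/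
noncomputable def fk (k : ℕ) (x : ℝ) : ℝ := ∑' n : ℕ, x ^ (n + k) / (n + k).factorial

/-- `pPoi k z = P(Poisson(z) ≥ k) = e^{-z} ∑_{j ≥ k} z^j/j!`. -/
noncomputable def pPoi (k : ℕ) (z : ℝ) : ℝ := Real.exp (-z) * fk k z

/-- The threshold `c*(k1,k2)` for the birth of a giant `(k1,k2)`-core. -/
noncomputable def cstar (k1 k2 : ℕ) : ℝ :=
  sInf { c : ℝ | ∃ z1 : ℝ, 0 < z1 ∧ ∃ z2 : ℝ, 0 < z2 ∧
    c = max (z1 / (pPoi k1 z1 * pPoi (k2 - 1) z2))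
            (z2 / (pPoi (k1 - 1) z1 * pPoi k2 z2)) }

/-- A simple digraph: edges are ordered pairs of distinct vertices (no loops,
and a `Finset` of edges has no repeated edges). -/
def IsSimpleDigraph {n : ℕ} (E : Finset (Fin n × Fin n)) : Prop :=
  ∀ e ∈ E, e.1 ≠ e.2

/-- `S` is a vertex set each of whose vertices has at least `k1` in-neighbors
and at least `k2` out-neighbors inside `S`. -/
def DegProp (k1 k2 : ℕ) {n : ℕ} (E : Finset (Fin n × Fin n)) (S : Finset (Fin n)) : Prop :=
  ∀ v ∈ S, k1 ≤ (S.filter (fun u => (u, v) ∈ E)).card ∧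
    k2 ≤ (S.filter (fun u => (v, u) ∈ E)).card

/-- The vertex set of the `(k1,k2)`-core: the union of all vertex sets `S` such
that every vertex of `S` has at least `k1` in-neighbors and at least `k2`
out-neighbors inside `S`. -/
noncomputable def coreSet (k1 k2 : ℕ) {n : ℕ} (E : Finset (Fin n × Fin n)) : Finset (Fin n) :=
  @Finset.filter _ (fun v => ∃ S : Finset (Fin n), DegProp k1 k2 E S ∧ v ∈ S)
    (Classical.decPred _) Finset.univ

/-- The digraph induced on `S` is strongly connected: every ordered pair of
vertices of `S` is joined by a directed path staying inside `S`. -/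
def StronglyConnectedOn {n : ℕ} (E : Finset (Fin n × Fin n)) (S : Finset (Fin n)) : Prop :=
  ∀ u ∈ S, ∀ v ∈ S, Relation.ReflTransGen (fun a b => a ∈ S ∧ b ∈ S ∧ (a, b) ∈ E) u v

/-- The digraph induced on `S` is `k`-strongly connected: `S` has more than `k`
vertices and deleting any fewer than `k` vertices leaves it strongly connected. -/
def KStronglyConnectedOn (k : ℕ) {n : ℕ} (E : Finset (Fin n × Fin n))
    (S : Finset (Fin n)) : Prop :=
  k < S.card ∧ ∀ T : Finset (Fin n), T.card < k → StronglyConnectedOn E (S \ T)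

open Finset Filter Topology

/-- The Poisson weight `e^{-z} z^i / i!`. -/
noncomputable def poi (z : ℝ) (i : ℕ) : ℝ := Real.exp (-z) * (z ^ i / i.factorial)

lemma poi_nonneg {z : ℝ} (hz : 0 ≤ z) (i : ℕ) : 0 ≤ poi z i := by
  unfold poi; positivity

lemma summable_pow_div_factorial_shift (k : ℕ) (x : ℝ) :
    Summable (fun n : ℕ => x ^ (n + k) / (n + k).factorial) :=
  (summable_nat_add_iff (f := fun n : ℕ => x ^ n / (n.factorial : ℝ)) k).2
    (Real.summable_pow_div_factorial x)

lemma sum_add_fk (k : ℕ) (x : ℝ) :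
    ∑ i ∈ range k, x ^ i / (i.factorial : ℝ) + fk k x = Real.exp x := by
  have h := (Real.summable_pow_div_factorial x).sum_add_tsum_nat_add k
  rw [fk, h, Real.exp_eq_exp_ℝ, NormedSpace.exp_eq_tsum_div]

lemma pPoi_eq (k : ℕ) (z : ℝ) : pPoi k z = 1 - ∑ i ∈ range k, poi z i := by
  have h := sum_add_fk k z
  have h1 : ∑ i ∈ range k, poi z i = Real.exp (-z) * ∑ i ∈ range k, z ^ i / (i.factorial : ℝ) := by
    rw [mul_sum]; rfl
  have h2 : Real.exp (-z) * Real.exp z = 1 := by rw [← Real.exp_add]; simp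
  rw [h1, pPoi, ← h2, ← h]; ring

lemma pPoi_zero (z : ℝ) : pPoi 0 z = 1 := by simp [pPoi_eq]

lemma pPoi_succ (k : ℕ) (z : ℝ) : pPoi (k + 1) z = pPoi k z - poi z k := by
  rw [pPoi_eq, pPoi_eq, sum_range_succ]; ring

lemma pPoi_nonneg (k : ℕ) {z : ℝ} (hz : 0 ≤ z) : 0 ≤ pPoi k z := by
  unfold pPoi fk
  exact mul_nonneg (Real.exp_pos _).le (tsum_nonneg fun n => by positivity)

lemma fk_pos (k : ℕ) {z : ℝ} (hz : 0 < z) : 0 < fk k z := by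
  unfold fk
  exact (summable_pow_div_factorial_shift k z).tsum_pos (fun n => by positivity) 0 (by positivity)

lemma pPoi_pos (k : ℕ) {z : ℝ} (hz : 0 < z) : 0 < pPoi k z :=
  mul_pos (Real.exp_pos _) (fk_pos k hz)

lemma pPoi_le_one (k : ℕ) {z : ℝ} (hz : 0 ≤ z) : pPoi k z ≤ 1 := by
  rw [pPoi_eq]
  linarith [sum_nonneg fun i (_ : i ∈ range k) => poi_nonneg hz i]

lemma pPoi_antitone_left {z : ℝ} (hz : 0 ≤ z) : Antitone fun k => pPoi k z :=
  antitone_nat_of_succ_le fun k => by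
    rw [pPoi_succ]; linarith [poi_nonneg hz k]

lemma hasDerivAt_poi_zero (z : ℝ) : HasDerivAt (fun z => poi z 0) (-poi z 0) z := by
  have h : HasDerivAt (fun z : ℝ => Real.exp (-z)) (Real.exp (-z) * (-1)) z :=
    (hasDerivAt_neg z).exp
  simpa [poi] using h

lemma hasDerivAt_poi_succ (k : ℕ) (z : ℝ) :
    HasDerivAt (fun z => poi z (k + 1)) (poi z k - poi z (k + 1)) z := by
  have h : HasDerivAt (fun z : ℝ => Real.exp (-z)) (Real.exp (-z) * (-1)) z :=
    (hasDerivAt_neg z).exp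
  have h2 : HasDerivAt (fun z : ℝ => z ^ (k + 1) / ((k + 1).factorial : ℝ))
      (((k + 1 : ℕ) : ℝ) * z ^ k / ((k + 1).factorial : ℝ)) z := by
    simpa using (hasDerivAt_pow (k + 1) z).div_const ((k + 1).factorial : ℝ)
  refine (h.mul h2).congr_deriv ?_
  have h3 : ((k + 1 : ℕ) : ℝ) * z ^ k / ((k + 1).factorial : ℝ) = z ^ k / (k.factorial : ℝ) := by
    rw [Nat.factorial_succ]; push_cast; field_simp
  rw [h3]; unfold poi; ring

lemma hasDerivAt_pPoi_succ (k : ℕ) (z : ℝ) : HasDerivAt (pPoi (k + 1)) (poi z k) z := by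
  induction k with
  | zero =>
    have h : pPoi (0 + 1) = fun z => 1 - poi z 0 := by
      funext z; rw [pPoi_succ, pPoi_zero]
    rw [h]; simpa using (hasDerivAt_poi_zero z).const_sub 1
  | succ k ih =>
    have h : pPoi (k + 1 + 1) = fun z => pPoi (k + 1) z - poi z (k + 1) := by
      funext z; rw [pPoi_succ]
    rw [h]; exact (ih.sub (hasDerivAt_poi_succ k z)).congr_deriv (by ring)

lemma pPoi_mono (k : ℕ) {x y : ℝ} (hx : 0 ≤ x) (hxy : x ≤ y) : pPoi k x ≤ pPoi k y := by
  cases k with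
  | zero => simp [pPoi_zero]
  | succ k =>
    have hm : MonotoneOn (pPoi (k + 1)) (Set.Ici 0) := by
      apply monotoneOn_of_deriv_nonneg (convex_Ici 0)
      · exact fun z _ => (hasDerivAt_pPoi_succ k z).continuousAt.continuousWithinAt
      · exact fun z _ => (hasDerivAt_pPoi_succ k z).differentiableAt.differentiableWithinAt
      · intro z hz
        rw [interior_Ici] at hz
        rw [(hasDerivAt_pPoi_succ k z).deriv]
        exact poi_nonneg (le_of_lt hz) k
    exact hm hx (hx.trans hxy) hxy

/-- `z ↦ log P(Poisson(e^s) ≥ k)` is concave. -/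
lemma concaveOn_log_pPoi_exp (k : ℕ) :
    ConcaveOn ℝ Set.univ fun s => Real.log (pPoi (k + 1) (Real.exp s)) := by
  have hd : ∀ s, HasDerivAt (fun s => Real.log (pPoi (k + 1) (Real.exp s)))
      (poi (Real.exp s) k * Real.exp s / pPoi (k + 1) (Real.exp s)) s := fun s =>
    ((hasDerivAt_pPoi_succ k (Real.exp s)).comp s (Real.hasDerivAt_exp s)).log
      (pPoi_pos _ (Real.exp_pos s)).ne'
  apply AntitoneOn.concaveOn_of_deriv convex_univ
  · exact fun s _ => (hd s).continuousAt.continuousWithinAt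
  · exact fun s _ => (hd s).differentiableAt.differentiableWithinAt
  · rw [interior_univ]
    intro s _ u _ hsu
    rw [(hd s).deriv, (hd u).deriv]
    have key : ∀ z : ℝ, 0 < z → poi z k * z / pPoi (k + 1) z
        = 1 / (k.factorial * ∑' i : ℕ, z ^ i / ((i + (k + 1)).factorial : ℝ)) := by
      intro z hz
      have hf : fk (k + 1) z = z ^ (k + 1) * ∑' i : ℕ, z ^ i / ((i + (k + 1)).factorial : ℝ) := by
        rw [fk, ← tsum_mul_left]
        refine tsum_congr fun i => ?_
        rw [pow_add]; ring
      have hfp := fk_pos (k + 1) hz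
      rw [hf] at hfp
      have hS := pos_of_mul_pos_right hfp (by positivity : (0:ℝ) ≤ z ^ (k + 1))
      rw [pPoi, hf, poi]
      have := Real.exp_pos (-z)
      field_simp
      ring
    rw [key _ (Real.exp_pos _), key _ (Real.exp_pos _)]
    have hsum : ∀ z : ℝ, 0 < z → Summable fun i : ℕ => z ^ i / ((i + (k + 1)).factorial : ℝ) := by
      intro z hz
      have := (summable_pow_div_factorial_shift (k + 1) z).mul_left ((z ^ (k + 1))⁻¹)
      refine this.congr fun i => ?_
      rw [pow_add z i]; field_simp
    have hle : Real.exp s ≤ Real.exp u := Real.exp_le_exp.2 hsu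
    apply one_div_le_one_div_of_le
    · exact mul_pos (by positivity) ((hsum _ (Real.exp_pos s)).tsum_pos
        (fun i => by positivity) 0 (by positivity))
    · apply mul_le_mul_of_nonneg_left _ (by positivity)
      exact (hsum _ (Real.exp_pos s)).tsum_le_tsum (fun i => by gcongr) (hsum _ (Real.exp_pos u))

lemma pPoi_geom_mean_le {k : ℕ} (hk : 1 ≤ k) {x y a b : ℝ} (hx : 0 < x) (hy : 0 < y)
    (ha : 0 ≤ a) (hb : 0 ≤ b) (hab : a + b = 1) :
    pPoi k x ^ a * pPoi k y ^ b ≤ pPoi k (x ^ a * y ^ b) := by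
  obtain ⟨k, rfl⟩ : ∃ l, k = l + 1 := ⟨k - 1, by omega⟩
  have h := (concaveOn_log_pPoi_exp k).2 (Set.mem_univ (Real.log x)) (Set.mem_univ (Real.log y))
    ha hb hab
  have hxy : Real.exp (a • Real.log x + b • Real.log y) = x ^ a * y ^ b := by
    rw [Real.exp_add, Real.rpow_def_of_pos hx, Real.rpow_def_of_pos hy]
    simp [mul_comm]
  simp only [Real.exp_log hx, Real.exp_log hy] at h
  rw [hxy, smul_eq_mul, smul_eq_mul] at h
  have hp : 0 < x ^ a * y ^ b := by positivity
  have hpx := pPoi_pos (k + 1) hx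
  have hpy := pPoi_pos (k + 1) hy
  rw [← Real.log_rpow hpx, ← Real.log_rpow hpy, ← Real.log_mul (by positivity) (by positivity)] at h
  exact (Real.log_le_log_iff (by positivity) (pPoi_pos _ hp)).1 h

lemma tendsto_pPoi_atTop (c : ℝ) : Tendsto (fun D => pPoi D c) atTop (𝓝 0) := by
  have h : Tendsto (fun D => fk D c) atTop (𝓝 0) :=
    tendsto_sum_nat_add fun n : ℕ => c ^ n / (n.factorial : ℝ)
  simpa [pPoi] using h.const_mul (Real.exp (-c))

lemma sum_Ico_poi {k D : ℕ} (h : k ≤ D) (z : ℝ) :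
    ∑ i ∈ Ico k D, poi z i = pPoi k z - pPoi D z := by
  rw [sum_Ico_eq_sub _ h, pPoi_eq, pPoi_eq]; ring

lemma succ_mul_poi (z : ℝ) (i : ℕ) : ((i + 1 : ℕ) : ℝ) * poi z (i + 1) = z * poi z i := by
  unfold poi; rw [Nat.factorial_succ, pow_succ]; push_cast; field_simp

lemma sum_Ico_mul_poi {k D : ℕ} (h : k ≤ D) (z : ℝ) :
    ∑ i ∈ Ico (k + 1) (D + 1), (i : ℝ) * poi z i = z * (pPoi k z - pPoi D z) := by
  rw [← sum_Ico_poi h, mul_sum, ← sum_Ico_add' (fun i : ℕ => (i : ℝ) * poi z i) k D 1]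
  exact sum_congr rfl fun i _ => succ_mul_poi z i

/-- Weight at `i` of a Poisson(`c`) variable, truncated at `D`, thinned with probability `θ`. -/
noncomputable def thinPoi (D : ℕ) (c θ : ℝ) (i : ℕ) : ℝ :=
  ∑ d ∈ range (D + 1), poi c d * (d.choose i * θ ^ i * (1 - θ) ^ (d - i))

lemma thinPoi_eq {D i : ℕ} (h : i ≤ D) (c θ : ℝ) :
    thinPoi D c θ i = poi (c * θ) i * (1 - pPoi (D - i + 1) (c * (1 - θ))) := by
  obtain ⟨e, rfl⟩ := Nat.exists_eq_add_of_le h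
  have h1 : thinPoi (i + e) c θ i
      = ∑ l ∈ range (e + 1), poi c (i + l) * ((i + l).choose i * θ ^ i * (1 - θ) ^ l) := by
    rw [thinPoi, add_assoc, sum_range_add, sum_eq_zero, zero_add]
    · simp
    · intro d hd
      rw [Nat.choose_eq_zero_of_lt (mem_range.1 hd)]; simp
  rw [h1, pPoi_eq, sub_sub_cancel, mul_sum, Nat.add_sub_cancel_left]
  refine sum_congr rfl fun l _ => ?_
  have hc : ((i + l).choose i : ℝ) = (i + l).factorial / (i.factorial * l.factorial) := by
    rw [Nat.choose_symm_add, Nat.add_choose, Nat.cast_div (Nat.factorial_mul_factorial_dvd_factorial_add i l)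
      (by positivity)]
    push_cast; rfl
  have he : Real.exp (-c) = Real.exp (-(c * θ)) * Real.exp (-(c * (1 - θ))) := by
    rw [← Real.exp_add]; ring_nf
  unfold poi
  rw [hc, he, pow_add, mul_pow, mul_pow]
  field_simp

lemma thinPoi_le {D i : ℕ} (h : i ≤ D) {c θ : ℝ} (hc : 0 ≤ c) (h0 : 0 ≤ θ) (h1 : θ ≤ 1) :
    thinPoi D c θ i ≤ poi (c * θ) i := by
  rw [thinPoi_eq h]
  have := poi_nonneg (mul_nonneg hc h0) i
  have h2 := pPoi_nonneg (D - i + 1) (mul_nonneg hc (sub_nonneg.2 h1))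
  nlinarith

lemma thinPoi_nonneg (D i : ℕ) {c θ : ℝ} (hc : 0 ≤ c) (h0 : 0 ≤ θ) (h1 : θ ≤ 1) :
    0 ≤ thinPoi D c θ i := by
  have := sub_nonneg.2 h1
  exact sum_nonneg fun d _ => mul_nonneg (poi_nonneg hc d) (by positivity)

lemma le_thinPoi {E i : ℕ} (h : i ≤ E) {c θ : ℝ} (hc : 0 ≤ c) (h0 : 0 ≤ θ) (h1 : θ ≤ 1) :
    poi (c * θ) i * (1 - pPoi E c) ≤ thinPoi (2 * E) c θ i := by
  rw [thinPoi_eq (by omega)]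
  apply mul_le_mul_of_nonneg_left _ (poi_nonneg (mul_nonneg hc h0) i)
  have h2 : pPoi (2 * E - i + 1) (c * (1 - θ)) ≤ pPoi (2 * E - i + 1) c :=
    pPoi_mono _ (mul_nonneg hc (sub_nonneg.2 h1)) (by nlinarith)
  have h3 : pPoi (2 * E - i + 1) c ≤ pPoi E c := pPoi_antitone_left hc (by omega)
  linarith

/-- For large `D`, the truncated thinned Poisson weights have tail sums and tail means uniformly
close to those of the Poisson distribution. -/
lemma exists_thinPoi_approx {c : ℝ} (hc : 0 ≤ c) (k : ℕ) (hk : 1 ≤ k) {ε : ℝ} (hε : 0 < ε) :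
    ∃ D0 : ℕ, ∀ E, D0 ≤ E → ∀ θ : ℝ, 0 ≤ θ → θ ≤ 1 →
      (pPoi k (c * θ) - ε ≤ ∑ i ∈ Ico k (2 * E + 1), thinPoi (2 * E) c θ i ∧
        ∑ i ∈ Ico k (2 * E + 1), thinPoi (2 * E) c θ i ≤ pPoi k (c * θ)) ∧
      (c * θ * pPoi (k - 1) (c * θ) - ε ≤
          ∑ i ∈ Ico k (2 * E + 1), (i : ℝ) * thinPoi (2 * E) c θ i ∧
        ∑ i ∈ Ico k (2 * E + 1), (i : ℝ) * thinPoi (2 * E) c θ i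
          ≤ c * θ * pPoi (k - 1) (c * θ)) := by
  obtain ⟨k, rfl⟩ : ∃ l, k = l + 1 := ⟨k - 1, by omega⟩
  have hδ : 0 < ε / (2 * (c + 1)) := by positivity
  obtain ⟨D0, hD0⟩ := eventually_atTop.1 ((tendsto_pPoi_atTop c).eventually (gt_mem_nhds hδ))
  refine ⟨max D0 (k + 2), fun E hE θ h0 h1 => ?_⟩
  have hE1 : D0 ≤ E := le_trans (le_max_left _ _) hE
  have hE2 : k + 2 ≤ E := le_trans (le_max_right _ _) hE
  set τ := pPoi E c with hτ
  have hτ1 : τ < ε / (2 * (c + 1)) := hD0 E hE1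
  have hτ0 : 0 ≤ τ := pPoi_nonneg E hc
  have hτ2 : τ * (2 * (c + 1)) < ε := (lt_div_iff₀ (by positivity)).1 hτ1
  have hz : 0 ≤ c * θ := mul_nonneg hc h0
  have hzc : c * θ ≤ c := by nlinarith
  have hEz : pPoi E (c * θ) ≤ τ := pPoi_mono _ hz hzc
  have hτle : τ ≤ 1 := pPoi_le_one _ hc
  have hEz1 : pPoi (E + 1) (c * θ) ≤ τ := le_trans (pPoi_antitone_left hz (by omega)) hEz
  have hsub : Ico (k + 1) (E + 1) ⊆ Ico (k + 1) (2 * E + 1) := Ico_subset_Ico_right (by omega)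
  refine ⟨⟨?_, ?_⟩, ?_, ?_⟩
  · calc pPoi (k + 1) (c * θ) - ε
        ≤ (pPoi (k + 1) (c * θ) - pPoi (E + 1) (c * θ)) * (1 - τ) := by
          have := pPoi_le_one (k + 1) hz
          have := pPoi_nonneg (k + 1) hz
          have := pPoi_nonneg (E + 1) hz
          nlinarith
      _ = ∑ i ∈ Ico (k + 1) (E + 1), poi (c * θ) i * (1 - τ) := by
          rw [← sum_mul, sum_Ico_poi (by omega)]
      _ ≤ ∑ i ∈ Ico (k + 1) (E + 1), thinPoi (2 * E) c θ i :=
          sum_le_sum fun i hi => le_thinPoi (by simp at hi; omega) hc h0 h1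
      _ ≤ _ := sum_le_sum_of_subset_of_nonneg hsub fun i _ _ => thinPoi_nonneg _ _ hc h0 h1
  · calc _ ≤ ∑ i ∈ Ico (k + 1) (2 * E + 1), poi (c * θ) i :=
          sum_le_sum fun i hi => thinPoi_le (by simp at hi; omega) hc h0 h1
      _ = pPoi (k + 1) (c * θ) - pPoi (2 * E + 1) (c * θ) := sum_Ico_poi (by omega) _
      _ ≤ _ := by linarith [pPoi_nonneg (2 * E + 1) hz]
  · simp only [Nat.add_sub_cancel]
    calc c * θ * pPoi k (c * θ) - ε
        ≤ (c * θ * (pPoi k (c * θ) - pPoi E (c * θ))) * (1 - τ) := by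
          have a1 := pPoi_le_one k hz
          have a2 := pPoi_nonneg k hz
          have a3 := pPoi_nonneg E hz
          have a4 : pPoi k (c * θ) - 2 * τ ≤ (pPoi k (c * θ) - pPoi E (c * θ)) * (1 - τ) := by
            nlinarith
          have a5 := mul_le_mul_of_nonneg_left a4 hz
          nlinarith
      _ = ∑ i ∈ Ico (k + 1) (E + 1), (i : ℝ) * poi (c * θ) i * (1 - τ) := by
          rw [← sum_mul, sum_Ico_mul_poi (by omega)]
      _ ≤ ∑ i ∈ Ico (k + 1) (E + 1), (i : ℝ) * thinPoi (2 * E) c θ i :=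
          sum_le_sum fun i hi => by
            rw [mul_assoc]
            exact mul_le_mul_of_nonneg_left (le_thinPoi (by simp at hi; omega) hc h0 h1)
              (by positivity)
      _ ≤ _ := sum_le_sum_of_subset_of_nonneg hsub fun i _ _ =>
          mul_nonneg (by positivity) (thinPoi_nonneg _ _ hc h0 h1)
  · simp only [Nat.add_sub_cancel]
    calc _ ≤ ∑ i ∈ Ico (k + 1) (2 * E + 1), (i : ℝ) * poi (c * θ) i :=
          sum_le_sum fun i hi => mul_le_mul_of_nonneg_left
            (thinPoi_le (by simp at hi; omega) hc h0 h1) (by positivity)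
      _ = c * θ * (pPoi k (c * θ) - pPoi (2 * E) (c * θ)) := sum_Ico_mul_poi (by omega) _
      _ ≤ _ := mul_le_mul_of_nonneg_left (by linarith [pPoi_nonneg (2 * E) hz]) hz

/-- The number of `i ∈ I` with `f i = v`. -/
def fiberCount {ι V : Type*} [DecidableEq V] (f : ι → V) (I : Finset ι) (v : V) : ℕ :=
  (I.filter fun i => f i = v).card

section Counting

variable {ι V : Type*} [Fintype ι] [DecidableEq ι] [Fintype V] [DecidableEq V]

lemma sum_fiberCount (f : ι → V) (I : Finset ι) : ∑ v, fiberCount f I v = I.card :=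
  (card_eq_sum_card_fiberwise fun _ _ => mem_univ _).symm

/-- The number of functions with prescribed fibre sizes `d`, times `∏ d v !`, is at most `|ι|!`. -/
lemma card_fiberCount_eq_mul_prod_factorial_le (d : V → ℕ) :
    (univ.filter fun t : ι → V => fiberCount t univ = d).card * ∏ v, (d v).factorial
      ≤ (Fintype.card ι).factorial := by
  rcases (univ.filter fun t : ι → V => fiberCount t univ = d).eq_empty_or_nonempty with h | ⟨t₀, h₀⟩
  · simp [h]
  have hd₀ : fiberCount t₀ univ = d := (mem_filter.1 h₀).2
  have hcard : ∀ t : ι → V, fiberCount t univ = d → ∀ v, Fintype.card {a // t a = v} = d v := by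
    intro t ht v
    rw [Fintype.card_subtype, ← ht]; rfl
  have hstab : Fintype.card {g : Equiv.Perm ι // t₀ ∘ g = t₀} = ∏ v, (d v).factorial := by
    rw [DomMulAct.stabilizer_card]
    exact prod_congr rfl fun v _ => by rw [hcard t₀ hd₀ v]
  rw [← Fintype.card_perm, ← hstab, ← card_univ (α := Equiv.Perm ι),
    card_eq_sum_card_fiberwise (f := fun σ : Equiv.Perm ι => t₀ ∘ σ)
      (t := univ.filter fun t : ι → V => fiberCount t univ = d), ← smul_eq_mul, ← sum_const]
  · refine sum_le_sum fun t ht => ?_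
    have hdt : fiberCount t univ = d := (mem_filter.1 ht).2
    have e : ∀ v, {a // t a = v} ≃ {a // t₀ a = v} := fun v =>
      Fintype.equivOfCardEq (by rw [hcard t hdt, hcard t₀ hd₀])
    let σ : Equiv.Perm ι := Equiv.ofFiberEquiv e
    have hσ : t₀ ∘ σ = t := funext fun a => Equiv.ofFiberEquiv_map e a
    rw [← card_univ]
    refine card_le_card_of_injOn (fun g => g.1 * σ) ?_ ?_
    · intro g _
      have : t₀ ∘ (g.1 * σ) = t := by
        rw [Equiv.Perm.coe_mul, ← Function.comp_assoc, g.2, hσ]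
      simpa using this
    · intro g _ g' _ hgg
      exact Subtype.ext (mul_right_cancel hgg)
  · intro σ _
    simp only [coe_filter, mem_univ, true_and, Set.mem_ofPred_eq]
    rw [← hd₀]
    funext v
    unfold fiberCount
    exact card_bij (fun a _ => σ a) (by simp) (fun a _ b _ h => σ.injective h)
      (fun b hb => ⟨σ.symm b, by simpa using hb, by simp⟩)

/-- Poissonization of a sum over functions depending on the fibre sizes only. -/
lemma sum_fiberCount_le {y : ℝ} (hy : 0 < y) (G : (V → ℕ) → ℝ) (hG : ∀ d, 0 ≤ G d) :
    ∑ t : ι → V, G (fiberCount t univ) ≤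
      ((Fintype.card ι).factorial / y ^ Fintype.card ι) *
        ∑ d ∈ Fintype.piFinset fun _ : V => range (Fintype.card ι + 1),
          (∏ v, y ^ d v / (d v).factorial) * G d := by
  set m := Fintype.card ι with hm
  have hmaps : ∀ t ∈ (univ : Finset (ι → V)), fiberCount t univ ∈
      Fintype.piFinset fun _ : V => range (m + 1) := by
    intro t _
    rw [Fintype.mem_piFinset]
    intro v
    rw [mem_range, Nat.lt_succ_iff, hm, ← card_univ]
    exact card_filter_le _ _
  rw [← sum_fiberwise_of_maps_to hmaps, mul_sum]
  refine sum_le_sum fun d _ => ?_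
  have h1 : ∑ t ∈ univ.filter (fun t : ι → V => fiberCount t univ = d), G (fiberCount t univ)
      = (univ.filter fun t : ι → V => fiberCount t univ = d).card * G d := by
    rw [← nsmul_eq_mul, ← sum_const]
    exact sum_congr rfl fun t ht => by rw [(mem_filter.1 ht).2]
  rw [h1, ← mul_assoc]
  refine mul_le_mul_of_nonneg_right ?_ (hG d)
  rcases (univ.filter fun t : ι → V => fiberCount t univ = d).eq_empty_or_nonempty with h | ⟨t₀, h₀⟩
  · rw [h]; simp; positivity
  have hsum : ∑ v, d v = m := by
    rw [← (mem_filter.1 h₀).2, sum_fiberCount, card_univ]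
  have hfac : (0 : ℝ) < ∏ v, ((d v).factorial : ℝ) := prod_pos fun v _ => by positivity
  rw [prod_div_distrib, prod_pow_eq_pow_sum, hsum]
  have hle := card_fiberCount_eq_mul_prod_factorial_le (ι := ι) d
  have hle' : ((univ.filter fun t : ι → V => fiberCount t univ = d).card : ℝ) *
      ∏ v, ((d v).factorial : ℝ) ≤ (m.factorial : ℝ) := by exact_mod_cast hle
  have hy' : y ^ m ≠ 0 := by positivity
  rw [div_mul_div_cancel₀ hy', le_div_iff₀ hfac]
  exact hle'

lemma sum_prod_fiberCount_le {y : ℝ} (hy : 0 < y) (φ : ℕ → ℕ → ℝ) (hφ : ∀ a b, 0 ≤ φ a b) :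
    ∑ t : ι → V, ∑ h : ι → V, ∏ v, φ (fiberCount h univ v) (fiberCount t univ v) ≤
      ((Fintype.card ι).factorial / y ^ Fintype.card ι) ^ 2 *
        (∑ a ∈ range (Fintype.card ι + 1), ∑ b ∈ range (Fintype.card ι + 1),
          φ a b * (y ^ a / a.factorial) * (y ^ b / b.factorial)) ^ Fintype.card V := by
  set m := Fintype.card ι with hm
  set K : ℝ := m.factorial / y ^ m with hK
  have hK0 : 0 ≤ K := by positivity
  set P : Finset (V → ℕ) := Fintype.piFinset fun _ : V => range (m + 1) with hP
  have h1 : ∀ t : ι → V, ∑ h : ι → V, ∏ v, φ (fiberCount h univ v) (fiberCount t univ v) ≤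
      K * ∑ a ∈ P, (∏ v, y ^ a v / (a v).factorial) * ∏ v, φ (a v) (fiberCount t univ v) := fun t =>
    sum_fiberCount_le hy (fun a => ∏ v, φ (a v) (fiberCount t univ v))
      fun a => prod_nonneg fun v _ => hφ _ _
  have h2 := sum_fiberCount_le (ι := ι) hy
    (fun b : V → ℕ => ∑ a ∈ P, (∏ v, y ^ a v / (a v).factorial) * ∏ v, φ (a v) (b v))
    fun b => sum_nonneg fun a _ => mul_nonneg (prod_nonneg fun v _ => by positivity)
      (prod_nonneg fun v _ => hφ _ _)
  calc _ ≤ ∑ t : ι → V, K * ∑ a ∈ P, (∏ v, y ^ a v / (a v).factorial) *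
          ∏ v, φ (a v) (fiberCount t univ v) := sum_le_sum fun t _ => h1 t
    _ ≤ K * (K * ∑ b ∈ P, (∏ v, y ^ b v / (b v).factorial) *
          ∑ a ∈ P, (∏ v, y ^ a v / (a v).factorial) * ∏ v, φ (a v) (b v)) := by
        rw [← mul_sum]; exact mul_le_mul_of_nonneg_left h2 hK0
    _ = K ^ 2 * ∑ b ∈ P, ∑ a ∈ P, ∏ v,
          (φ (a v) (b v) * (y ^ a v / (a v).factorial) * (y ^ b v / (b v).factorial)) := by
        rw [← mul_assoc, ← sq]
        congr 1
        refine sum_congr rfl fun b _ => ?_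
        rw [mul_sum]
        refine sum_congr rfl fun a _ => ?_
        simp only [prod_mul_distrib]; ring
    _ = K ^ 2 * ∑ x ∈ Fintype.piFinset fun _ : V => range (m + 1) ×ˢ range (m + 1), ∏ v,
          (φ (x v).1 (x v).2 * (y ^ (x v).1 / (x v).1.factorial) *
            (y ^ (x v).2 / (x v).2.factorial)) := by
        congr 1
        rw [sum_comm, ← sum_product']
        refine sum_bij' (fun p _ v => (p.1 v, p.2 v)) (fun x _ => (fun v => (x v).1, fun v => (x v).2))
          ?_ ?_ ?_ ?_ ?_
        · intro p hp
          simp only [hP, mem_product, Fintype.mem_piFinset] at hp ⊢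
          exact fun v => ⟨hp.1 v, hp.2 v⟩
        · intro p hp
          simp only [hP, mem_product, Fintype.mem_piFinset] at hp ⊢
          exact ⟨fun v => (hp v).1, fun v => (hp v).2⟩
        · intros; rfl
        · intros; rfl
        · intros; rfl
    _ = _ := by
        rw [← sum_product', ← card_univ (α := V), ← prod_const, prod_univ_sum]

end Counting

lemma factorial_le_mul_pow_div_exp {m : ℕ} (hm : 1 ≤ m) :
    (m.factorial : ℝ) ≤ Real.exp 1 * m * (m / Real.exp 1) ^ m := by
  induction m, hm using Nat.le_induction with
  | base => simp
  | succ m hm ih =>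
    have hm' : (0 : ℝ) < m := by exact_mod_cast hm
    have he := Real.exp_pos 1
    have h1 : (m / (m + 1) : ℝ) ^ (m + 1) ≤ (Real.exp 1)⁻¹ := by
      have h2 : (m / (m + 1) : ℝ) ≤ Real.exp (-(1 / (m + 1))) := by
        have := Real.add_one_le_exp (-(1 / (m + 1)) : ℝ)
        refine le_trans (le_of_eq ?_) this
        field_simp; ring
      calc (m / (m + 1) : ℝ) ^ (m + 1) ≤ Real.exp (-(1 / (m + 1))) ^ (m + 1) := by gcongr
        _ = (Real.exp 1)⁻¹ := by
          rw [← Real.exp_nat_mul, ← Real.exp_neg]; congr 1; push_cast; field_simp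
    rw [div_pow, div_le_iff₀ (by positivity)] at h1
    have h3 : Real.exp 1 * (m : ℝ) ^ (m + 1) ≤ ((m : ℝ) + 1) ^ (m + 1) := by
      calc _ ≤ Real.exp 1 * ((Real.exp 1)⁻¹ * ((m : ℝ) + 1) ^ (m + 1)) := by gcongr
        _ = _ := by field_simp
    rw [Nat.factorial_succ]; push_cast
    calc ((m : ℝ) + 1) * m.factorial ≤ (m + 1) * (Real.exp 1 * m * (m / Real.exp 1) ^ m) := by
          gcongr
      _ = (m + 1) * (Real.exp 1 * (m : ℝ) ^ (m + 1)) / Real.exp 1 ^ m := by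
          rw [div_pow]; field_simp; ring
      _ ≤ (m + 1) * ((m : ℝ) + 1) ^ (m + 1) / Real.exp 1 ^ m := by gcongr
      _ = _ := by rw [div_pow]; field_simp; ring

lemma factorial_div_pow_mul_exp_le {c : ℝ} (hc : 0 < c) {n m : ℕ} (hm : 1 ≤ m)
    (hmc : (m : ℝ) ≤ c * n) (hcm : c * n ≤ m + 1) :
    (m.factorial : ℝ) / c ^ m * Real.exp (c * n) ≤ Real.exp 2 * m * n ^ m := by
  have he := Real.exp_pos 1
  have h1 : Real.exp (c * n) ≤ Real.exp 1 * Real.exp 1 ^ m := by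
    rw [← Real.exp_nat_mul, ← Real.exp_add]
    exact Real.exp_le_exp.2 (by linarith)
  have h2 : ((m : ℝ) / c) ^ m ≤ (n : ℝ) ^ m := by
    gcongr; rw [div_le_iff₀ hc]; linarith
  calc (m.factorial : ℝ) / c ^ m * Real.exp (c * n)
      ≤ (Real.exp 1 * m * (m / Real.exp 1) ^ m) / c ^ m * (Real.exp 1 * Real.exp 1 ^ m) := by
        gcongr; exact factorial_le_mul_pow_div_exp hm
    _ = Real.exp 2 * m * ((m : ℝ) / c) ^ m := by
        rw [show (2 : ℝ) = 1 + 1 by norm_num, Real.exp_add, div_pow, div_pow]; field_simp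
    _ ≤ _ := by gcongr

/-- Exponential-moment comparison of uniform allocations with independent Poisson counts. -/
lemma sum_prod_fiberCount_le_poi {ι V : Type*} [Fintype ι] [DecidableEq ι] [Fintype V]
    [DecidableEq V] {c : ℝ} (hc : 0 < c) (hm : 1 ≤ Fintype.card ι)
    (hmc : (Fintype.card ι : ℝ) ≤ c * Fintype.card V)
    (hcm : c * Fintype.card V ≤ Fintype.card ι + 1) (φ : ℕ → ℕ → ℝ) (hφ : ∀ a b, 0 ≤ φ a b) :
    ∑ t : ι → V, ∑ h : ι → V, ∏ v, φ (fiberCount h univ v) (fiberCount t univ v) ≤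
      (Real.exp 2 * Fintype.card ι * Fintype.card V ^ Fintype.card ι) ^ 2 *
        (∑ a ∈ range (Fintype.card ι + 1), ∑ b ∈ range (Fintype.card ι + 1),
          φ a b * poi c a * poi c b) ^ Fintype.card V := by
  refine (sum_prod_fiberCount_le hc φ hφ).trans ?_
  set m := Fintype.card ι
  set n := Fintype.card V
  have h0 : ∑ a ∈ range (m + 1), ∑ b ∈ range (m + 1),
      φ a b * (c ^ a / a.factorial) * (c ^ b / b.factorial)
      = Real.exp c ^ 2 * ∑ a ∈ range (m + 1), ∑ b ∈ range (m + 1), φ a b * poi c a * poi c b := by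
    simp only [mul_sum]
    refine sum_congr rfl fun a _ => sum_congr rfl fun b _ => ?_
    have : Real.exp c * Real.exp (-c) = 1 := by rw [← Real.exp_add]; simp
    unfold poi
    linear_combination (-(φ a b * (c ^ a / a.factorial) * (c ^ b / b.factorial))) *
      (Real.exp c * Real.exp (-c) + 1) * this
  rw [h0, mul_pow, ← pow_mul, ← mul_assoc]
  have h1 := factorial_div_pow_mul_exp_le hc hm hmc hcm
  refine mul_le_mul_of_nonneg_right ?_ ?_
  · calc _ = ((m.factorial : ℝ) / c ^ m * Real.exp (c * n)) ^ 2 := by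
          rw [mul_pow, mul_comm c, Real.exp_nat_mul, ← pow_mul, mul_comm 2]
      _ ≤ _ := by gcongr
  · exact pow_nonneg (sum_nonneg fun a _ => sum_nonneg fun b _ =>
      mul_nonneg (mul_nonneg (hφ _ _) (poi_nonneg hc.le _)) (poi_nonneg hc.le _)) _

section SeqCore

variable {ι V : Type*} [Fintype V] [DecidableEq V]

/-- Every vertex of `S` is the head of at least `k1` and the tail of at least `k2` of the edges
`(t i, h i)`, `i ∈ I`, having both ends in `S`. -/
def SeqDeg (k1 k2 : ℕ) (t h : ι → V) (I : Finset ι) (S : Finset V) : Prop :=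
  ∀ v ∈ S, k1 ≤ (I.filter fun i => h i = v ∧ t i ∈ S).card ∧
    k2 ≤ (I.filter fun i => t i = v ∧ h i ∈ S).card

open Classical in
/-- The `(k1,k2)`-core of the multidigraph with edges `(t i, h i)`, `i ∈ I`. -/
noncomputable def seqCore (k1 k2 : ℕ) (t h : ι → V) (I : Finset ι) : Finset V :=
  univ.filter fun v => ∃ S, SeqDeg k1 k2 t h I S ∧ v ∈ S

/-- The number of edges of the `(k1,k2)`-core. -/
noncomputable def coreEdges (k1 k2 : ℕ) (t h : ι → V) (I : Finset ι) : ℕ :=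
  (I.filter fun i => t i ∈ seqCore k1 k2 t h I ∧ h i ∈ seqCore k1 k2 t h I).card

variable {k1 k2 : ℕ} {t h : ι → V} {I J : Finset ι} {S : Finset V}

lemma SeqDeg.mono (hS : SeqDeg k1 k2 t h I S) (hIJ : I ⊆ J) : SeqDeg k1 k2 t h J S := fun v hv =>
  ⟨(hS v hv).1.trans (card_le_card (filter_subset_filter _ hIJ)),
    (hS v hv).2.trans (card_le_card (filter_subset_filter _ hIJ))⟩

lemma SeqDeg.subset_seqCore (hS : SeqDeg k1 k2 t h I S) : S ⊆ seqCore k1 k2 t h I := fun v hv => by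
  classical
  exact mem_filter.2 ⟨mem_univ _, S, hS, hv⟩

lemma seqDeg_seqCore (k1 k2 : ℕ) (t h : ι → V) (I : Finset ι) :
    SeqDeg k1 k2 t h I (seqCore k1 k2 t h I) := by
  classical
  intro v hv
  obtain ⟨S, hS, hvS⟩ := (mem_filter.1 hv).2
  have hsub := hS.subset_seqCore
  exact ⟨(hS v hvS).1.trans (card_le_card fun i hi => by
      simp only [mem_filter] at hi ⊢; exact ⟨hi.1, hi.2.1, hsub hi.2.2⟩),
    (hS v hvS).2.trans (card_le_card fun i hi => by
      simp only [mem_filter] at hi ⊢; exact ⟨hi.1, hi.2.1, hsub hi.2.2⟩)⟩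

lemma seqCore_mono (hIJ : I ⊆ J) : seqCore k1 k2 t h I ⊆ seqCore k1 k2 t h J :=
  ((seqDeg_seqCore k1 k2 t h I).mono hIJ).subset_seqCore

lemma le_fiberCount_of_mem_seqCore {v : V} (hv : v ∈ seqCore k1 k2 t h I) :
    k1 ≤ fiberCount h I v ∧ k2 ≤ fiberCount t I v := by
  have := seqDeg_seqCore k1 k2 t h I v hv
  exact ⟨this.1.trans (card_le_card (monotone_filter_right _ fun i _ hi => hi.1)),
    this.2.trans (card_le_card (monotone_filter_right _ fun i _ hi => hi.1))⟩

/-- Deleting an edge outside the core does not change the core. -/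
lemma seqCore_erase [DecidableEq ι] {i : ι}
    (hi : ¬ (t i ∈ seqCore k1 k2 t h I ∧ h i ∈ seqCore k1 k2 t h I)) :
    seqCore k1 k2 t h (I.erase i) = seqCore k1 k2 t h I := by
  refine (seqCore_mono (erase_subset _ _)).antisymm (SeqDeg.subset_seqCore fun v hv => ?_)
  have h0 := seqDeg_seqCore k1 k2 t h I v hv
  refine ⟨h0.1.trans (card_le_card fun x hx => ?_), h0.2.trans (card_le_card fun x hx => ?_)⟩ <;>
  · simp only [mem_filter, mem_erase] at hx ⊢
    refine ⟨⟨?_, hx.1⟩, hx.2⟩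
    rintro rfl
    exact hi (by simp_all)

lemma coreEdges_erase [DecidableEq ι] {i : ι}
    (hi : ¬ (t i ∈ seqCore k1 k2 t h I ∧ h i ∈ seqCore k1 k2 t h I)) :
    coreEdges k1 k2 t h (I.erase i) = coreEdges k1 k2 t h I := by
  unfold coreEdges
  rw [seqCore_erase hi]
  congr 1
  ext x
  simp only [mem_filter, mem_erase]
  refine ⟨fun hx => ⟨hx.1.2, hx.2⟩, fun hx => ⟨⟨?_, hx.1⟩, hx.2⟩⟩
  rintro rfl
  exact hi hx.2

/-- If every edge joins vertices of sufficiently large degrees then every edge is in the core. -/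
lemma coreEdges_eq_card
    (H : ∀ i ∈ I, (k1 ≤ fiberCount h I (t i) ∧ k2 ≤ fiberCount t I (t i)) ∧
      (k1 ≤ fiberCount h I (h i) ∧ k2 ≤ fiberCount t I (h i))) :
    coreEdges k1 k2 t h I = I.card := by
  have hS : SeqDeg k1 k2 t h I
      (univ.filter fun v => k1 ≤ fiberCount h I v ∧ k2 ≤ fiberCount t I v) := by
    intro v hv
    have hv' := (mem_filter.1 hv).2
    refine ⟨hv'.1.trans (card_le_card fun i hi => ?_), hv'.2.trans (card_le_card fun i hi => ?_)⟩
    · have hi := mem_filter.1 hi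
      exact mem_filter.2 ⟨hi.1, hi.2, mem_filter.2 ⟨mem_univ _, (H i hi.1).1⟩⟩
    · have hi := mem_filter.1 hi
      exact mem_filter.2 ⟨hi.1, hi.2, mem_filter.2 ⟨mem_univ _, (H i hi.1).2⟩⟩
  unfold coreEdges
  rw [filter_true_of_mem]
  exact fun i hi => ⟨hS.subset_seqCore (mem_filter.2 ⟨mem_univ _, (H i hi).1⟩),
    hS.subset_seqCore (mem_filter.2 ⟨mem_univ _, (H i hi).2⟩)⟩

end SeqCore

section Permutations

variable {ι : Type*} [Fintype ι] [DecidableEq ι]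

open Equiv

/-- The permutations agreeing with `σ` outside `I`. -/
def permsOff (σ : Perm ι) (I : Finset ι) : Finset (Perm ι) :=
  univ.filter fun π => ∀ x, x ∉ I → π x = σ x

lemma mem_permsOff {σ π : Perm ι} {I : Finset ι} : π ∈ permsOff σ I ↔ ∀ x, x ∉ I → π x = σ x := by
  simp [permsOff]

lemma map_eq_of_mem_permsOff {σ π : Perm ι} {I : Finset ι} (hπ : π ∈ permsOff σ I) :
    I.map π.toEmbedding = I.map σ.toEmbedding := by
  have key : ∀ (σ π : Perm ι), π ∈ permsOff σ I → I.map π.toEmbedding ⊆ I.map σ.toEmbedding := by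
    intro σ π hπ y hy
    obtain ⟨x, hx, rfl⟩ := mem_map.1 hy
    refine mem_map.2 ⟨σ.symm (π x), ?_, by simp⟩
    by_contra hn
    have := mem_permsOff.1 hπ _ hn
    rw [apply_symm_apply] at this
    exact hn (by simpa [π.injective this] using hx)
  refine (key σ π hπ).antisymm (key π σ (mem_permsOff.2 fun x hx => ?_))
  exact (mem_permsOff.1 hπ x hx).symm

lemma mem_permsOff_erase {σ π : Perm ι} {I : Finset ι} {i : ι} (hi : i ∈ I)
    (hπ : π ∈ permsOff σ I) : π ∈ permsOff (swap (σ i) (π i) * σ) (I.erase i) := by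
  rw [mem_permsOff] at hπ ⊢
  intro x hx
  rw [Perm.mul_apply]
  rcases eq_or_ne x i with rfl | hxi
  · simp
  · have hxI : x ∉ I := fun h => hx (mem_erase.2 ⟨hxi, h⟩)
    rw [← hπ x hxI, swap_apply_of_ne_of_ne _ (fun h => hxi (π.injective h))]
    rw [hπ x hxI]
    exact fun h => hxi (σ.injective h)

lemma map_erase_swap {σ : Perm ι} {I : Finset ι} {i j : ι} (hi : i ∈ I)
    (hj : j ∈ I.map σ.toEmbedding) :
    (I.erase i).map (swap (σ i) j * σ).toEmbedding = (I.map σ.toEmbedding).erase j := by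
  ext y
  simp only [Finset.mem_map, mem_erase, toEmbedding_apply, Perm.mul_apply]
  obtain ⟨x0, hx0, rfl⟩ := mem_map.1 hj
  simp only [toEmbedding_apply]
  constructor
  · rintro ⟨x, ⟨hxi, hx⟩, rfl⟩
    rcases eq_or_ne x x0 with rfl | hx0'
    · rw [swap_apply_right]
      exact ⟨fun h => hxi (σ.injective h).symm, i, hi, rfl⟩
    · rw [swap_apply_of_ne_of_ne (σ.injective.ne hxi) (σ.injective.ne hx0')]
      exact ⟨σ.injective.ne hx0', x, hx, rfl⟩
  · rintro ⟨hne, x, hx, rfl⟩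
    have hxx : x ≠ x0 := fun h => hne (h ▸ rfl)
    rcases eq_or_ne x i with rfl | hxi
    · exact ⟨x0, ⟨hxx.symm, hx0⟩, swap_apply_right _ _⟩
    · exact ⟨x, ⟨hxi, hx⟩, swap_apply_of_ne_of_ne (σ.injective.ne hxi) (σ.injective.ne hxx)⟩

lemma card_permsOff_le (M : ℕ) : ∀ (σ : Perm ι) (I : Finset ι), I.card = M →
    (permsOff σ I).card ≤ M.factorial := by
  induction M with
  | zero =>
    intro σ I hI
    rw [card_eq_zero] at hI
    subst hI
    refine card_le_one.2 fun a ha b hb => ?_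
    rw [mem_permsOff] at ha hb
    exact Equiv.ext fun x => by rw [ha x (notMem_empty x), hb x (notMem_empty x)]
  | succ M ih =>
    intro σ I hI
    obtain ⟨i, hi⟩ := card_pos.1 (by omega : 0 < I.card)
    have hsub : permsOff σ I ⊆
        (I.map σ.toEmbedding).biUnion fun j => permsOff (swap (σ i) j * σ) (I.erase i) := by
      intro π hπ
      refine mem_biUnion.2 ⟨π i, ?_, mem_permsOff_erase hi hπ⟩
      rw [← map_eq_of_mem_permsOff hπ]
      exact mem_map_of_mem _ hi
    refine (card_le_card hsub).trans (card_biUnion_le.trans ?_)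
    refine (sum_le_card_nsmul _ _ M.factorial fun j _ => ih _ _ ?_).trans ?_
    · rw [card_erase_of_mem hi, hI]; rfl
    · rw [card_map, hI, smul_eq_mul, Nat.factorial_succ]

/-- A supermartingale bound for the number of bad permutations: `Φ I J x` is a potential which on
average does not increase when a pair is exposed. -/
lemma card_permsOff_filter_le {X : Type*} (Bad : Perm ι → Finset ι → Prop)
    [∀ π I, Decidable (Bad π I)]
    (Φ : Finset ι → Finset ι → X → ℝ) (hΦ : ∀ I J x, 0 ≤ Φ I J x)
    (Inv : Finset ι → Finset ι → X → Prop)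
    (step : ∀ (σ : Perm ι) (I J : Finset ι) (x : X), I.map σ.toEmbedding = J → Inv I J x →
      1 ≤ Φ I J x ∨ (∀ π ∈ permsOff σ I, ¬ Bad π I) ∨
      (∃ i ∈ I, ∃ x', (∀ π ∈ permsOff σ I, Bad π I → Bad π (I.erase i)) ∧
        (∀ j ∈ J, Inv (I.erase i) (J.erase j) x') ∧
        ∑ j ∈ J, Φ (I.erase i) (J.erase j) x' ≤ I.card * Φ I J x) ∨
      (∃ j ∈ J, ∃ x', (∀ π ∈ permsOff σ I, Bad π I → Bad π (I.erase (π.symm j))) ∧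
        (∀ i ∈ I, Inv (I.erase i) (J.erase j) x') ∧
        ∑ i ∈ I, Φ (I.erase i) (J.erase j) x' ≤ I.card * Φ I J x))
    (M : ℕ) : ∀ (σ : Perm ι) (I J : Finset ι) (x : X), I.map σ.toEmbedding = J → I.card = M →
      Inv I J x → (((permsOff σ I).filter fun π => Bad π I).card : ℝ) ≤ M.factorial * Φ I J x := by
  induction M with
  | zero =>
    intro σ I J x hJ hI hInv
    rcases step σ I J x hJ hInv with h1 | h1 | ⟨i, hi, -⟩ | ⟨j, hj, -⟩
    · have h2 := card_permsOff_le 0 σ I hI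
      have h3 := card_filter_le (permsOff σ I) fun π => Bad π I
      have h4 : (((permsOff σ I).filter fun π => Bad π I).card : ℝ) ≤ 1 := by
        exact_mod_cast h3.trans h2
      simpa using h4.trans h1
    · rw [filter_false_of_mem h1]; simpa using hΦ I J x
    · rw [card_eq_zero.1 hI] at hi; simp at hi
    · rw [← hJ, card_eq_zero.1 hI] at hj; simp at hj
  | succ M ih =>
    intro σ I J x hJ hI hInv
    have hJc : J.card = M + 1 := by rw [← hJ, card_map, hI]
    rcases step σ I J x hJ hInv with h1 | h1 | ⟨i, hi, x', hb, hInv', hs⟩ | ⟨j, hj, x', hb, hInv', hs⟩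
    · have h2 := card_permsOff_le (M + 1) σ I hI
      have h3 := card_filter_le (permsOff σ I) fun π => Bad π I
      have h4 : (((permsOff σ I).filter fun π => Bad π I).card : ℝ) ≤ (M + 1).factorial := by
        exact_mod_cast h3.trans h2
      exact h4.trans (le_mul_of_one_le_right (by positivity) h1)
    · rw [filter_false_of_mem h1]; simpa using mul_nonneg (by positivity) (hΦ I J x)
    · have hsub : ((permsOff σ I).filter fun π => Bad π I) ⊆
          J.biUnion fun j => (permsOff (swap (σ i) j * σ) (I.erase i)).filter
            fun π => Bad π (I.erase i) := by
        intro π hπ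
        obtain ⟨hπ, hbad⟩ := mem_filter.1 hπ
        refine mem_biUnion.2 ⟨π i, ?_, mem_filter.2 ⟨mem_permsOff_erase hi hπ, hb π hπ hbad⟩⟩
        rw [← hJ, ← map_eq_of_mem_permsOff hπ]
        exact mem_map_of_mem _ hi
      calc (((permsOff σ I).filter fun π => Bad π I).card : ℝ)
          ≤ ∑ j ∈ J, (((permsOff (swap (σ i) j * σ) (I.erase i)).filter
            fun π => Bad π (I.erase i)).card : ℝ) := by
            exact_mod_cast (card_le_card hsub).trans card_biUnion_le
        _ ≤ ∑ j ∈ J, M.factorial * Φ (I.erase i) (J.erase j) x' :=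
            sum_le_sum fun j hj => ih _ _ _ _ (by rw [map_erase_swap hi (hJ ▸ hj), hJ])
              (by rw [card_erase_of_mem hi, hI]; rfl) (hInv' j hj)
        _ = M.factorial * ∑ j ∈ J, Φ (I.erase i) (J.erase j) x' := by rw [mul_sum]
        _ ≤ M.factorial * (I.card * Φ I J x) := by gcongr
        _ = (M + 1).factorial * Φ I J x := by
            rw [hI, Nat.factorial_succ]; push_cast; ring
    · have hsub : ((permsOff σ I).filter fun π => Bad π I) ⊆
          I.biUnion fun i => (permsOff (swap (σ i) j * σ) (I.erase i)).filter
            fun π => Bad π (I.erase i) := by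
        intro π hπ
        obtain ⟨hπ, hbad⟩ := mem_filter.1 hπ
        have hji : π.symm j ∈ I := by
          rw [← hJ, ← map_eq_of_mem_permsOff hπ] at hj
          obtain ⟨x, hx, rfl⟩ := mem_map.1 hj
          simpa using hx
        refine mem_biUnion.2 ⟨π.symm j, hji, mem_filter.2 ⟨?_, hb π hπ hbad⟩⟩
        have := mem_permsOff_erase hji hπ
        rwa [apply_symm_apply] at this
      calc (((permsOff σ I).filter fun π => Bad π I).card : ℝ)
          ≤ ∑ i ∈ I, (((permsOff (swap (σ i) j * σ) (I.erase i)).filter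
            fun π => Bad π (I.erase i)).card : ℝ) := by
            exact_mod_cast (card_le_card hsub).trans card_biUnion_le
        _ ≤ ∑ i ∈ I, M.factorial * Φ (I.erase i) (J.erase j) x' :=
            sum_le_sum fun i hi => ih _ _ _ _ (by rw [map_erase_swap hi (hJ ▸ hj), hJ])
              (by rw [card_erase_of_mem hi, hI]; rfl) (hInv' i hi)
        _ = M.factorial * ∑ i ∈ I, Φ (I.erase i) (J.erase j) x' := by rw [mul_sum]
        _ ≤ M.factorial * (I.card * Φ I J x) := by gcongr
        _ = (M + 1).factorial * Φ I J x := by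
            rw [hI, Nat.factorial_succ]; push_cast; ring

end Permutations

lemma fiberCount_comp_perm {ι V : Type*} [DecidableEq V] (h : ι → V)
    (π : Equiv.Perm ι) (I : Finset ι) (v : V) :
    fiberCount (h ∘ π) I v = fiberCount h (I.map π.toEmbedding) v := by
  unfold fiberCount
  rw [filter_map, card_map]
  rfl

section Cosh

lemma exp_le_one_add_add_sq {x : ℝ} (hx : |x| ≤ 1) : Real.exp x ≤ 1 + x + x ^ 2 := by
  have := (abs_le.1 (Real.abs_exp_sub_one_sub_id_le hx)).2
  linarith

lemma sum_exp_le_of_abs_le {ι : Type*} (A : Finset ι) (z : ι → ℝ) {μ b l : ℝ}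
    (hb : ∀ a ∈ A, |z a - μ| ≤ b) (hμ : ∑ a ∈ A, z a = A.card * μ) (hl : |l| * b ≤ 1) :
    ∑ a ∈ A, Real.exp (l * z a) ≤ A.card * (Real.exp (l ^ 2 * b ^ 2) * Real.exp (l * μ)) := by
  have h1 : ∀ a ∈ A, Real.exp (l * z a) ≤
      Real.exp (l * μ) * (1 + l * (z a - μ) + l ^ 2 * b ^ 2) := by
    intro a ha
    have hab : |l * (z a - μ)| ≤ |l| * b := by
      rw [abs_mul]; exact mul_le_mul_of_nonneg_left (hb a ha) (abs_nonneg _)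
    have h2 : Real.exp (l * z a) = Real.exp (l * μ) * Real.exp (l * (z a - μ)) := by
      rw [← Real.exp_add]; ring_nf
    rw [h2]
    refine mul_le_mul_of_nonneg_left ((exp_le_one_add_add_sq (hab.trans hl)).trans ?_)
      (Real.exp_pos _).le
    have : (l * (z a - μ)) ^ 2 ≤ (|l| * b) ^ 2 := by
      rw [← sq_abs (l * (z a - μ))]; gcongr
    rw [mul_pow |l|, sq_abs] at this
    linarith
  refine (sum_le_sum h1).trans ?_
  rw [← mul_sum]
  have h3 : ∑ a ∈ A, (1 + l * (z a - μ) + l ^ 2 * b ^ 2) = A.card * (l ^ 2 * b ^ 2 + 1) := by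
    rw [sum_add_distrib, sum_add_distrib, ← mul_sum, sum_sub_distrib, hμ]
    simp only [sum_const, nsmul_eq_mul]; ring
  rw [h3]
  have h4 := Real.add_one_le_exp (l ^ 2 * b ^ 2)
  have h5 := Real.exp_pos (l * μ)
  calc _ = A.card * ((l ^ 2 * b ^ 2 + 1) * Real.exp (l * μ)) := by ring
    _ ≤ _ := by gcongr

lemma sum_cosh_le_of_abs_le {ι : Type*} (A : Finset ι) (z : ι → ℝ) {μ b l : ℝ}
    (hb : ∀ a ∈ A, |z a - μ| ≤ b) (hμ : ∑ a ∈ A, z a = A.card * μ) (hl0 : 0 ≤ l) (hl : l * b ≤ 1) :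
    ∑ a ∈ A, Real.cosh (l * z a) ≤ A.card * (Real.exp (l ^ 2 * b ^ 2) * Real.cosh (l * μ)) := by
  have h1 := sum_exp_le_of_abs_le A z (l := l) hb hμ (by rwa [abs_of_nonneg hl0])
  have h2 := sum_exp_le_of_abs_le A z (l := -l) hb hμ (by rwa [abs_neg, abs_of_nonneg hl0])
  simp only [Real.cosh_eq]
  rw [← sum_div, sum_add_distrib]
  simp only [neg_mul, neg_sq] at h1 h2
  linarith

lemma cosh_le_exp_mul_cosh {x y d : ℝ} (h : |y| ≤ |x| + d) (hd : 0 ≤ d) :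
    Real.cosh y ≤ Real.exp d * Real.cosh x := by
  have h1 : Real.cosh y ≤ Real.cosh (|x| + d) := by
    rw [Real.cosh_le_cosh, abs_of_nonneg (by positivity : 0 ≤ |x| + d)]; exact h
  refine h1.trans ?_
  rw [← Real.cosh_abs x, Real.cosh_eq, Real.cosh_eq, Real.exp_add]
  have h2 : Real.exp (-(|x| + d)) ≤ Real.exp d * Real.exp (-|x|) := by
    rw [← Real.exp_add]; exact Real.exp_le_exp.2 (by linarith)
  linarith

lemma one_sub_inv_pow_bounds {M : ℝ} {j : ℕ} (hM : 1 ≤ M) (hj : (j : ℝ) ≤ M) :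
    1 - j / M ≤ (1 - 1 / M) ^ j ∧ (1 - 1 / M) ^ j ≤ 1 - j / M + (j / M) ^ 2 := by
  have hM0 : 0 < M := by linarith
  have h0 : 1 / M ≤ 1 := by rw [div_le_one hM0]; exact hM
  constructor
  · have := one_add_mul_le_pow (a := -(1 / M)) (by linarith) j
    calc _ = 1 + (j : ℝ) * -(1 / M) := by ring
      _ ≤ _ := this
  · have h1 : (1 - 1 / M) ^ j ≤ Real.exp (-(1 / M)) ^ j := by
      refine pow_le_pow_left₀ (by linarith) ?_ j
      have := Real.add_one_le_exp (-(1 / M)); linarith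
    rw [← Real.exp_nat_mul] at h1
    have hx : |(j : ℝ) * -(1 / M)| ≤ 1 := by
      rw [show (j : ℝ) * -(1 / M) = -(j / M) by ring, abs_neg, abs_of_nonneg (by positivity)]
      rw [div_le_one hM0]; exact hj
    refine h1.trans ((exp_le_one_add_add_sq hx).trans (le_of_eq (by ring)))

lemma sum_cosh_step {ι : Type*} (A : Finset ι) (x : ι → ℝ) {X b l y Y : ℝ} {j D : ℕ}
    (hA : 1 ≤ A.card) (hx : ∀ a ∈ A, X - b ≤ x a ∧ x a ≤ X)
    (hs : ∑ a ∈ A, x a = (A.card - j) * X) (hjD : j ≤ D) (hD : D ≤ A.card)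
    (hl0 : 0 ≤ l) (hl : l * b ≤ 1) (hy : 0 ≤ y) (hyY : y ≤ Y) :
    ∑ a ∈ A, Real.cosh (l * (x a - y * (1 - 1 / A.card) ^ j)) ≤
      A.card * (Real.exp (l ^ 2 * b ^ 2 + l * (Y * (D / A.card) ^ 2)) *
        Real.cosh (l * (X - y))) := by
  set M : ℝ := (A.card : ℝ) with hM
  have hM1 : 1 ≤ M := by rw [hM]; exact_mod_cast hA
  have hM0 : 0 < M := by linarith
  have hjM : (j : ℝ) ≤ M := by rw [hM]; exact_mod_cast hjD.trans hD
  set P := (1 - 1 / M) ^ j with hP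
  have hmean : M * ((1 - j / M) * X) = (M - j) * X := by field_simp
  have hup : (1 - j / M) * X ≤ X := by
    have := sum_le_sum fun a ha => (hx a ha).2
    rw [hs, sum_const, nsmul_eq_mul, ← hM, ← hmean] at this
    exact le_of_mul_le_mul_left this hM0
  have hlow : X - b ≤ (1 - j / M) * X := by
    have := sum_le_sum fun a ha => (hx a ha).1
    rw [hs, sum_const, nsmul_eq_mul, ← hM, ← hmean] at this
    exact le_of_mul_le_mul_left this hM0
  have h1 := sum_cosh_le_of_abs_le A (fun a => x a - y * P) (μ := (1 - j / M) * X - y * P)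
    (b := b) (l := l) (fun a ha => by
      have := hx a ha
      rw [abs_le]; constructor <;> linarith)
    (by rw [sum_sub_distrib, hs, sum_const, nsmul_eq_mul, ← hM, ← hmean]; ring) hl0 hl
  refine h1.trans ?_
  rw [← hM]
  refine mul_le_mul_of_nonneg_left ?_ hM0.le
  rw [Real.exp_add, mul_assoc]
  refine mul_le_mul_of_nonneg_left ?_ (Real.exp_pos _).le
  obtain ⟨hb1, hb2⟩ := one_sub_inv_pow_bounds hM1 hjM
  have hjM1 : (j : ℝ) / M ≤ 1 := by rw [div_le_one hM0]; exact hjM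
  have hjM0 : (0 : ℝ) ≤ j / M := by positivity
  refine cosh_le_exp_mul_cosh ?_ (by have := hy.trans hyY; positivity)
  rw [abs_mul, abs_mul, abs_of_nonneg hl0, ← mul_add]
  refine mul_le_mul_of_nonneg_left ?_ hl0
  have heq : (1 - j / M) * X - y * P = (1 - j / M) * (X - y) + -(y * (P - (1 - j / M))) := by ring
  rw [heq]
  refine (abs_add_le _ _).trans (add_le_add ?_ ?_)
  · rw [abs_mul, abs_of_nonneg (by linarith : (0 : ℝ) ≤ 1 - j / M)]
    exact mul_le_of_le_one_left (abs_nonneg _) (by linarith)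
  · rw [abs_neg, abs_of_nonneg (mul_nonneg hy (by linarith))]
    have hDD : (j / M) ^ 2 ≤ (D / M) ^ 2 := by gcongr
    exact mul_le_mul hyY (by linarith) (by linarith) (hy.trans hyY)

end Cosh

section BinSum

variable {ι V : Type*} [DecidableEq ι] [DecidableEq V]

lemma fiberCount_erase (f : ι → V) {A : Finset ι} {a : ι} (ha : a ∈ A) (v : V) :
    fiberCount f (A.erase a) v = if f a = v then fiberCount f A v - 1 else fiberCount f A v := by
  unfold fiberCount
  rw [filter_erase]
  split_ifs with h
  · exact card_erase_of_mem (mem_filter.2 ⟨ha, h⟩)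
  · rw [erase_eq_of_notMem]; simp [h]

lemma fiberCount_mono (f : ι → V) {A B : Finset ι} (h : A ⊆ B) (v : V) :
    fiberCount f A v ≤ fiberCount f B v := card_le_card (filter_subset_filter _ h)

lemma sum_choose_fiberCount_erase (f : ι → V) (A : Finset ι) (v : V) (j : ℕ) :
    ∑ a ∈ A, ((fiberCount f (A.erase a) v).choose j : ℝ) =
      (A.card - j) * (fiberCount f A v).choose j := by
  set d := fiberCount f A v with hd
  have h1 : ∀ a ∈ A, ((fiberCount f (A.erase a) v).choose j : ℝ) =
      d.choose j + if f a = v then ((d - 1).choose j : ℝ) - d.choose j else 0 := by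
    intro a ha
    rw [fiberCount_erase f ha]
    split_ifs <;> simp [← hd]
  rw [sum_congr rfl h1, sum_add_distrib, ← sum_filter, sum_const, sum_const]
  change A.card • _ + d • _ = _
  have h2 : (d : ℝ) * (d - 1).choose j = (d - j) * d.choose j := by
    rcases d with _ | d
    · rcases j with _ | j <;> simp
    · have := Nat.choose_mul_succ_eq d j
      simp only [Nat.add_sub_cancel]
      rcases le_or_gt j (d + 1) with hj | hj
      · have h3 : ((d.choose j * (d + 1) : ℕ) : ℝ) = ((d + 1).choose j * (d + 1 - j) : ℕ) := by
          exact_mod_cast this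
        push_cast [Nat.cast_sub hj] at h3 ⊢
        linarith
      · simp [Nat.choose_eq_zero_of_lt hj, Nat.choose_eq_zero_of_lt (by omega : d < j)]
  simp only [nsmul_eq_mul]
  linarith

/-- The number of ways to choose a vertex of `W`, `j1` of its points in `A` and `j2` of its
points in `B`. -/
def binSum (W : Finset V) (f g : ι → V) (A B : Finset ι) (j1 j2 : ℕ) : ℝ :=
  ∑ v ∈ W, ((fiberCount f A v).choose j1 : ℝ) * (fiberCount g B v).choose j2

lemma binSum_comm (W : Finset V) (f g : ι → V) (A B : Finset ι) (j1 j2 : ℕ) :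
    binSum W f g A B j1 j2 = binSum W g f B A j2 j1 :=
  sum_congr rfl fun _ _ => mul_comm _ _

variable {W : Finset V} {f g : ι → V} {A B : Finset ι} {j1 j2 k1 k2 D : ℕ}

lemma binSum_erase_right {b : ι} (hb : b ∈ B)
    (hlight : fiberCount f A (g b) < j1 ∨ fiberCount g B (g b) < j2) :
    binSum W f g A (B.erase b) j1 j2 = binSum W f g A B j1 j2 := by
  refine sum_congr rfl fun v _ => ?_
  rw [fiberCount_erase g hb]
  split_ifs with h
  · subst h
    rcases hlight with h | h
    · simp [Nat.choose_eq_zero_of_lt h]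
    · rw [Nat.choose_eq_zero_of_lt h,
        Nat.choose_eq_zero_of_lt ((Nat.sub_le (fiberCount g B (g b)) 1).trans_lt h)]
  · rfl

lemma sum_binSum_erase_left :
    ∑ a ∈ A, binSum W f g (A.erase a) B j1 j2 = (A.card - j1) * binSum W f g A B j1 j2 := by
  unfold binSum
  rw [sum_comm, mul_sum]
  refine sum_congr rfl fun v _ => ?_
  rw [← sum_mul, sum_choose_fiberCount_erase, mul_assoc]

lemma binSum_erase_left_bounds {a : ι} (ha : a ∈ A)
    (hf : ∀ v ∈ W, fiberCount f A v ≤ D) (hg : ∀ v ∈ W, fiberCount g B v ≤ D) :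
    binSum W f g A B j1 j2 - 4 ^ D ≤ binSum W f g (A.erase a) B j1 j2 ∧
      binSum W f g (A.erase a) B j1 j2 ≤ binSum W f g A B j1 j2 := by
  have hpow : ∀ {d j : ℕ}, d ≤ D → (d.choose j : ℝ) ≤ 2 ^ D := fun {d j} hd => by
    exact_mod_cast (Nat.choose_le_two_pow d j).trans (Nat.pow_le_pow_right (by norm_num) hd)
  constructor
  · rw [sub_le_iff_le_add', ← sub_le_iff_le_add]
    unfold binSum
    rw [← sum_sub_distrib]
    have h1 : ∀ v ∈ W, ((fiberCount f A v).choose j1 : ℝ) * (fiberCount g B v).choose j2 -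
        ((fiberCount f (A.erase a) v).choose j1 : ℝ) * (fiberCount g B v).choose j2 ≤
        if f a = v then 4 ^ D else 0 := by
      intro v hv
      rw [fiberCount_erase f ha]
      split_ifs with h
      · have : (4 : ℝ) ^ D = 2 ^ D * 2 ^ D := by rw [← mul_pow]; norm_num
        rw [this]
        have h2 : ((fiberCount f A v).choose j1 : ℝ) * (fiberCount g B v).choose j2 ≤
            2 ^ D * 2 ^ D :=
          mul_le_mul (hpow (hf v hv)) (hpow (hg v hv)) (by positivity) (by positivity)
        have h3 : (0 : ℝ) ≤ ((fiberCount f A v - 1).choose j1 : ℝ) * (fiberCount g B v).choose j2 :=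
          by positivity
        linarith
      · simp
    refine (sum_le_sum h1).trans ?_
    rw [sum_ite_eq]
    split_ifs
    · exact le_rfl
    · positivity
  · refine sum_le_sum fun v _ => mul_le_mul_of_nonneg_right ?_ (by positivity)
    exact_mod_cast Nat.choose_le_choose j1 (fiberCount_mono f (erase_subset _ _) v)

/-- The potential controlling the deviation of the statistics `binSum` from their means. -/
noncomputable def potential (k1 k2 D : ℕ) (l κ e n : ℝ) (q : ℕ → ℝ) (W : Finset V) (f g : ι → V)
    (A B : Finset ι) (θ1 θ2 : ℝ) : ℝ :=
  ∑ j1 ∈ Icc k1 D, ∑ j2 ∈ Icc k2 D,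
    2 * Real.cosh (l * (binSum W f g A B j1 j2 - n * q j1 * q j2 * θ1 ^ j1 * θ2 ^ j2)) *
      Real.exp (κ * A.card - e)

variable {l κ e n : ℝ} {q : ℕ → ℝ} {θ1 θ2 : ℝ}

lemma potential_nonneg : 0 ≤ potential k1 k2 D l κ e n q W f g A B θ1 θ2 := by
  unfold potential
  refine sum_nonneg fun j1 _ => sum_nonneg fun j2 _ => ?_
  have := Real.cosh_pos
    (l * (binSum W f g A B j1 j2 - n * q j1 * q j2 * θ1 ^ j1 * θ2 ^ j2))
  positivity

lemma potential_comm (h : A.card = B.card) :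
    potential k1 k2 D l κ e n q W f g A B θ1 θ2 = potential k2 k1 D l κ e n q W g f B A θ2 θ1 := by
  unfold potential
  rw [sum_comm]
  refine sum_congr rfl fun j2 _ => sum_congr rfl fun j1 _ => ?_
  rw [binSum_comm, h]
  ring_nf

/-- If the potential is less than one then all statistics are close to their means. -/
lemma abs_lt_of_potential_lt_one {j1 j2 : ℕ} {ε : ℝ} (hj1 : j1 ∈ Icc k1 D) (hj2 : j2 ∈ Icc k2 D)
    (hl : 0 < l) (hκ : 0 ≤ κ)
    (h : potential k1 k2 D l κ (l * ε) n q W f g A B θ1 θ2 < 1) :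
    |binSum W f g A B j1 j2 - n * q j1 * q j2 * θ1 ^ j1 * θ2 ^ j2| < ε := by
  by_contra! hc
  refine absurd h (not_lt.2 ?_)
  set Z := binSum W f g A B j1 j2 - n * q j1 * q j2 * θ1 ^ j1 * θ2 ^ j2 with hZ
  have hnn : ∀ i1 i2 : ℕ, 0 ≤ 2 * Real.cosh (l * (binSum W f g A B i1 i2 -
      n * q i1 * q i2 * θ1 ^ i1 * θ2 ^ i2)) * Real.exp (κ * A.card - l * ε) := fun i1 i2 => by
    have := Real.cosh_pos (l * (binSum W f g A B i1 i2 - n * q i1 * q i2 * θ1 ^ i1 * θ2 ^ i2))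
    positivity
  have h1 : 2 * Real.cosh (l * Z) * Real.exp (κ * A.card - l * ε) ≤
      potential k1 k2 D l κ (l * ε) n q W f g A B θ1 θ2 := by
    unfold potential
    refine le_trans ?_ (single_le_sum (fun i1 _ => sum_nonneg fun i2 _ => hnn i1 i2) hj1)
    exact single_le_sum (f := fun i2 => 2 * Real.cosh (l * (binSum W f g A B j1 i2 -
      n * q j1 * q i2 * θ1 ^ j1 * θ2 ^ i2)) * Real.exp (κ * A.card - l * ε))
      (fun i2 _ => hnn j1 i2) hj2
  refine le_trans ?_ h1
  have h2 : Real.exp (l * ε) ≤ 2 * Real.cosh (l * Z) := by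
    rw [← Real.cosh_abs, Real.cosh_eq, abs_mul, abs_of_pos hl]
    have h3 : Real.exp (l * ε) ≤ Real.exp (l * |Z|) :=
      Real.exp_le_exp.2 (mul_le_mul_of_nonneg_left hc hl.le)
    have h4 := Real.exp_pos (-(l * |Z|))
    linarith
  calc (1 : ℝ) ≤ Real.exp (κ * A.card) := Real.one_le_exp (by positivity)
    _ = Real.exp (l * ε) * Real.exp (κ * A.card - l * ε) := by rw [← Real.exp_add]; ring_nf
    _ ≤ _ := by gcongr

lemma sum_potential_erase_le {b : ι} {Y : ℝ} (hb : b ∈ B)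
    (hlight : fiberCount f A (g b) < k1 ∨ fiberCount g B (g b) < k2)
    (hf : ∀ v ∈ W, fiberCount f A v ≤ D) (hg : ∀ v ∈ W, fiberCount g B v ≤ D)
    (hA1 : 1 ≤ A.card) (hAD : D ≤ A.card) (hn : 0 ≤ n) (hq : ∀ j, 0 ≤ q j)
    (hY : ∀ j1 j2, n * q j1 * q j2 ≤ Y) (h10 : 0 ≤ θ1) (h11 : θ1 ≤ 1) (h20 : 0 ≤ θ2) (h21 : θ2 ≤ 1)
    (hl0 : 0 ≤ l) (hl : l * 4 ^ D ≤ 1)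
    (hκ : l ^ 2 * (4 ^ D) ^ 2 + l * (Y * (D / A.card) ^ 2) ≤ κ) :
    ∑ a ∈ A, potential k1 k2 D l κ e n q W f g (A.erase a) (B.erase b)
        (θ1 * (1 - 1 / A.card)) θ2 ≤
      A.card * potential k1 k2 D l κ e n q W f g A B θ1 θ2 := by
  unfold potential
  rw [sum_comm, mul_sum]
  refine sum_le_sum fun j1 hj1 => ?_
  rw [sum_comm, mul_sum]
  refine sum_le_sum fun j2 hj2 => ?_
  rw [mem_Icc] at hj1 hj2
  set M : ℝ := (A.card : ℝ) with hM
  set y : ℝ := n * q j1 * q j2 * θ1 ^ j1 * θ2 ^ j2 with hy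
  have hy0 : 0 ≤ y := by have := hq j1; have := hq j2; positivity
  have hyY : y ≤ Y := by
    refine le_trans ?_ (hY j1 j2)
    have h1 : 0 ≤ n * q j1 * q j2 := by have := hq j1; have := hq j2; positivity
    calc y = n * q j1 * q j2 * (θ1 ^ j1 * θ2 ^ j2) := by rw [hy]; ring
      _ ≤ n * q j1 * q j2 * 1 := by
        refine mul_le_mul_of_nonneg_left ?_ h1
        exact mul_le_one₀ (pow_le_one₀ h10 h11) (by positivity) (pow_le_one₀ h20 h21)
      _ = _ := mul_one _
  have hstep := sum_cosh_step A (fun a => binSum W f g (A.erase a) B j1 j2)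
    (X := binSum W f g A B j1 j2) (b := 4 ^ D) (l := l) (y := y) (Y := Y) (j := j1) (D := D)
    hA1 (fun a ha => binSum_erase_left_bounds ha hf hg) sum_binSum_erase_left hj1.2 hAD hl0 hl
    hy0 hyY
  have hterm : ∀ a ∈ A, 2 * Real.cosh (l * (binSum W f g (A.erase a) (B.erase b) j1 j2 -
        n * q j1 * q j2 * (θ1 * (1 - 1 / M)) ^ j1 * θ2 ^ j2)) *
        Real.exp (κ * ((A.erase a).card : ℝ) - e) =
      2 * Real.exp (κ * (M - 1) - e) *
        Real.cosh (l * (binSum W f g (A.erase a) B j1 j2 - y * (1 - 1 / M) ^ j1)) := by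
    intro a ha
    rw [binSum_erase_right hb]
    · have hyy : n * q j1 * q j2 * (θ1 * (1 - 1 / M)) ^ j1 * θ2 ^ j2 = y * (1 - 1 / M) ^ j1 := by
        rw [hy, mul_pow]; ring
      rw [card_erase_of_mem ha, Nat.cast_sub hA1, ← hM, hyy, Nat.cast_one]
      ring
    · rcases hlight with h | h
      · exact Or.inl (((fiberCount_mono f (erase_subset _ _) _).trans_lt h).trans_le hj1.1)
      · exact Or.inr (h.trans_le hj2.1)
  rw [sum_congr rfl hterm, ← mul_sum]
  have hc0 := Real.cosh_pos (l * (binSum W f g A B j1 j2 - y))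
  have hM0 : 0 ≤ M := by positivity
  calc _ ≤ 2 * Real.exp (κ * (M - 1) - e) * (M * (Real.exp (l ^ 2 * (4 ^ D) ^ 2 +
        l * (Y * (D / M) ^ 2)) * Real.cosh (l * (binSum W f g A B j1 j2 - y)))) := by gcongr
    _ ≤ 2 * Real.exp (κ * (M - 1) - e) * (M * (Real.exp κ *
        Real.cosh (l * (binSum W f g A B j1 j2 - y)))) := by gcongr
    _ = M * (2 * Real.cosh (l * (binSum W f g A B j1 j2 - y)) *
        (Real.exp (κ * (M - 1) - e) * Real.exp κ)) := by ring
    _ = _ := by rw [← Real.exp_add]; ring_nf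

end BinSum

lemma sum_alternating_choose_mul {D d : ℕ} (hd : d ≤ D) (i : ℕ) (θ : ℝ) :
    ∑ j ∈ range (D + 1), (-1 : ℝ) ^ (i + j) * j.choose i * (d.choose j * θ ^ j) =
      d.choose i * θ ^ i * (1 - θ) ^ (d - i) := by
  have hshrink : ∑ j ∈ range (D + 1), (-1 : ℝ) ^ (i + j) * j.choose i * (d.choose j * θ ^ j) =
      ∑ j ∈ range (d + 1), (-1 : ℝ) ^ (i + j) * j.choose i * (d.choose j * θ ^ j) := by
    refine (sum_subset (range_subset_range.2 (by omega)) fun j _ hj => ?_).symm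
    rw [Nat.choose_eq_zero_of_lt (by simpa using hj : d < j)]; simp
  rw [hshrink]
  rcases lt_or_ge d i with h | h
  · rw [Nat.choose_eq_zero_of_lt h]
    simp only [Nat.cast_zero, zero_mul]
    refine sum_eq_zero fun j hj => ?_
    rw [Nat.choose_eq_zero_of_lt (by have := mem_range.1 hj; omega : j < i)]; simp
  · obtain ⟨r, rfl⟩ := Nat.exists_eq_add_of_le h
    rw [show i + r + 1 = i + (r + 1) by ring, sum_range_add _ i (r + 1)]
    have h0 : ∑ j ∈ range i, (-1 : ℝ) ^ (i + j) * j.choose i * ((i + r).choose j * θ ^ j) = 0 :=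
      sum_eq_zero fun j hj => by rw [Nat.choose_eq_zero_of_lt (mem_range.1 hj)]; simp
    rw [h0, zero_add, Nat.add_sub_cancel_left, sub_eq_neg_add, add_pow, mul_sum]
    refine sum_congr rfl fun s hs => ?_
    have hs' : s ≤ r := Nat.lt_succ_iff.1 (mem_range.1 hs)
    have hc := Nat.choose_mul (n := i + r) (k := i + s) (s := i) (by omega)
    rw [Nat.add_sub_cancel_left, Nat.add_sub_cancel_left] at hc
    have hc' : ((i + r).choose (i + s) : ℝ) * (i + s).choose i = (i + r).choose i * r.choose s := by
      exact_mod_cast hc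
    have hsign : (-1 : ℝ) ^ (i + (i + s)) = (-1) ^ s := by
      rw [← add_assoc, pow_add, ← two_mul, pow_mul]; simp
    rw [hsign, neg_pow θ s, one_pow, pow_add]
    calc _ = (-1 : ℝ) ^ s * (θ ^ i * θ ^ s) * ((i + r).choose (i + s) * (i + s).choose i) := by ring
      _ = _ := by rw [hc']; ring

lemma sum_alternating_choose_eq_ite {D d : ℕ} (hd : d ≤ D) (i : ℕ) :
    ∑ j ∈ range (D + 1), (-1 : ℝ) ^ (i + j) * j.choose i * d.choose j = if d = i then 1 else 0 := by
  have := sum_alternating_choose_mul hd i 1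
  simp only [one_pow, mul_one, sub_self] at this
  rw [this]
  split_ifs with h
  · subst h; simp
  · rcases lt_or_gt_of_ne h with h | h
    · rw [Nat.choose_eq_zero_of_lt h]; simp
    · rw [zero_pow (by omega)]; simp

/-- The truncated binomial moments of the Poisson distribution. -/
noncomputable def poiMoment (D : ℕ) (c : ℝ) (j : ℕ) : ℝ :=
  ∑ d ∈ range (D + 1), poi c d * d.choose j

lemma poiMoment_nonneg {c : ℝ} (hc : 0 ≤ c) (D j : ℕ) : 0 ≤ poiMoment D c j :=
  sum_nonneg fun d _ => mul_nonneg (poi_nonneg hc d) (by positivity)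

lemma thinPoi_eq_sum_poiMoment (D : ℕ) (c θ : ℝ) (i : ℕ) :
    thinPoi D c θ i =
      ∑ j ∈ range (D + 1), (-1 : ℝ) ^ (i + j) * j.choose i * (poiMoment D c j * θ ^ j) := by
  unfold thinPoi poiMoment
  simp_rw [sum_mul, mul_sum]
  rw [sum_comm]
  refine sum_congr rfl fun d hd => ?_
  rw [← sum_alternating_choose_mul (Nat.lt_succ_iff.1 (mem_range.1 hd)) i θ, mul_sum]
  exact sum_congr rfl fun j _ => by ring

section HeavySums

variable {ι V : Type*} [DecidableEq ι] [DecidableEq V] {W : Finset V} {f g : ι → V}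
  {A B : Finset ι} {k1 k2 D : ℕ}

lemma card_filter_eq_sum_binSum (hf : ∀ v ∈ W, fiberCount f A v ≤ D)
    (hg : ∀ v ∈ W, fiberCount g B v ≤ D) (i1 i2 : ℕ) :
    ((W.filter fun v => fiberCount f A v = i1 ∧ fiberCount g B v = i2).card : ℝ) =
      ∑ j1 ∈ range (D + 1), ∑ j2 ∈ range (D + 1),
        ((-1 : ℝ) ^ (i1 + j1) * j1.choose i1) * ((-1 : ℝ) ^ (i2 + j2) * j2.choose i2) *
          binSum W f g A B j1 j2 := by
  unfold binSum
  simp_rw [mul_sum]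
  have h1 : ∀ j1 ∈ range (D + 1), ∑ j2 ∈ range (D + 1), ∑ v ∈ W,
      ((-1 : ℝ) ^ (i1 + j1) * j1.choose i1) * ((-1 : ℝ) ^ (i2 + j2) * j2.choose i2) *
        (((fiberCount f A v).choose j1 : ℝ) * (fiberCount g B v).choose j2) =
      ∑ v ∈ W, ∑ j2 ∈ range (D + 1),
      ((-1 : ℝ) ^ (i1 + j1) * j1.choose i1) * ((-1 : ℝ) ^ (i2 + j2) * j2.choose i2) *
        (((fiberCount f A v).choose j1 : ℝ) * (fiberCount g B v).choose j2) :=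
    fun j1 _ => sum_comm
  rw [sum_congr rfl h1, sum_comm, card_filter, Nat.cast_sum]
  refine sum_congr rfl fun v hv => ?_
  have h2 := sum_alternating_choose_eq_ite (hf v hv) i1
  have h3 := sum_alternating_choose_eq_ite (hg v hv) i2
  have h4 : ((if fiberCount f A v = i1 ∧ fiberCount g B v = i2 then 1 else 0 : ℕ) : ℝ) =
      (if fiberCount f A v = i1 then 1 else 0) * (if fiberCount g B v = i2 then 1 else 0) := by
    split_ifs <;> simp_all
  rw [h4, ← h2, ← h3, sum_mul_sum]
  exact sum_congr rfl fun j1 _ => sum_congr rfl fun j2 _ => by ring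

lemma abs_card_filter_sub_le {c δ n θ1 θ2 : ℝ} (hδ : 0 ≤ δ)
    (hf : ∀ v ∈ W, fiberCount f A v ≤ D) (hg : ∀ v ∈ W, fiberCount g B v ≤ D)
    (hZ : ∀ j1 ∈ Icc k1 D, ∀ j2 ∈ Icc k2 D, |binSum W f g A B j1 j2 -
      n * poiMoment D c j1 * poiMoment D c j2 * θ1 ^ j1 * θ2 ^ j2| ≤ δ)
    {i1 i2 : ℕ} (hi1 : k1 ≤ i1) (hi2 : k2 ≤ i2) :
    |((W.filter fun v => fiberCount f A v = i1 ∧ fiberCount g B v = i2).card : ℝ) -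
      n * (thinPoi D c θ1 i1 * thinPoi D c θ2 i2)| ≤ ((D + 1) * 2 ^ D) ^ 2 * δ := by
  rw [card_filter_eq_sum_binSum hf hg, thinPoi_eq_sum_poiMoment, thinPoi_eq_sum_poiMoment,
    sum_mul_sum, mul_sum, ← sum_sub_distrib]
  have hterm : ∀ j1 ∈ range (D + 1), ∀ j2 ∈ range (D + 1),
      |((-1 : ℝ) ^ (i1 + j1) * j1.choose i1) * ((-1 : ℝ) ^ (i2 + j2) * j2.choose i2) *
          binSum W f g A B j1 j2 -
        n * ((-1 : ℝ) ^ (i1 + j1) * j1.choose i1 * (poiMoment D c j1 * θ1 ^ j1) *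
          ((-1 : ℝ) ^ (i2 + j2) * j2.choose i2 * (poiMoment D c j2 * θ2 ^ j2)))| ≤
        2 ^ D * 2 ^ D * δ := by
    intro j1 hj1 j2 hj2
    have hj1 := Nat.lt_succ_iff.1 (mem_range.1 hj1)
    have hj2 := Nat.lt_succ_iff.1 (mem_range.1 hj2)
    have heq : ((-1 : ℝ) ^ (i1 + j1) * j1.choose i1) * ((-1 : ℝ) ^ (i2 + j2) * j2.choose i2) *
          binSum W f g A B j1 j2 -
        n * ((-1 : ℝ) ^ (i1 + j1) * j1.choose i1 * (poiMoment D c j1 * θ1 ^ j1) *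
          ((-1 : ℝ) ^ (i2 + j2) * j2.choose i2 * (poiMoment D c j2 * θ2 ^ j2))) =
        (((-1 : ℝ) ^ (i1 + j1) * j1.choose i1) * ((-1 : ℝ) ^ (i2 + j2) * j2.choose i2)) *
        (binSum W f g A B j1 j2 -
          n * poiMoment D c j1 * poiMoment D c j2 * θ1 ^ j1 * θ2 ^ j2) := by ring
    rw [heq, abs_mul]
    have habs : |((-1 : ℝ) ^ (i1 + j1) * j1.choose i1) * ((-1 : ℝ) ^ (i2 + j2) * j2.choose i2)| =
        j1.choose i1 * j2.choose i2 := by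
      rw [abs_mul, abs_mul, abs_mul, abs_pow, abs_pow]; simp
    rw [habs]
    rcases lt_or_ge j1 i1 with h | h1
    · rw [Nat.choose_eq_zero_of_lt h]; simp; positivity
    rcases lt_or_ge j2 i2 with h | h2
    · rw [Nat.choose_eq_zero_of_lt h]; simp; positivity
    have hpow : ∀ {d j : ℕ}, d ≤ D → (d.choose j : ℝ) ≤ 2 ^ D := fun {d j} hd => by
      exact_mod_cast (Nat.choose_le_two_pow d j).trans (Nat.pow_le_pow_right (by norm_num) hd)
    refine mul_le_mul ?_ (hZ j1 (mem_Icc.2 ⟨by omega, hj1⟩) j2 (mem_Icc.2 ⟨by omega, hj2⟩))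
      (abs_nonneg _) (by positivity)
    exact mul_le_mul (hpow hj1) (hpow hj2) (by positivity) (by positivity)
  refine (abs_sum_le_sum_abs _ _).trans ((sum_le_sum fun j1 hj1 => ?_).trans
    (b := ∑ _j1 ∈ range (D + 1), (D + 1) * (2 ^ D * 2 ^ D * δ)) ?_)
  · rw [mul_sum, ← sum_sub_distrib]
    refine (abs_sum_le_sum_abs _ _).trans ((sum_le_sum fun j2 hj2 => hterm j1 hj1 j2 hj2).trans ?_)
    rw [sum_const, card_range, nsmul_eq_mul]; push_cast; exact le_rfl
  · rw [sum_const, card_range, nsmul_eq_mul]; push_cast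
    exact le_of_eq (by ring)

lemma sum_heavy_eq (hf : ∀ v ∈ W, fiberCount f A v ≤ D) (hg : ∀ v ∈ W, fiberCount g B v ≤ D) :
    ∑ v ∈ W with k1 ≤ fiberCount f A v ∧ k2 ≤ fiberCount g B v, (fiberCount f A v : ℝ) =
      ∑ i1 ∈ Ico k1 (D + 1), ∑ i2 ∈ Ico k2 (D + 1), (i1 : ℝ) *
        ((W.filter fun v => fiberCount f A v = i1 ∧ fiberCount g B v = i2).card : ℝ) := by
  rw [← sum_product' (f := fun (i1 i2 : ℕ) => (i1 : ℝ) *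
    ((W.filter fun v => fiberCount f A v = i1 ∧ fiberCount g B v = i2).card : ℝ))]
  rw [← sum_fiberwise_of_maps_to (s := W.filter fun v => k1 ≤ fiberCount f A v ∧
      k2 ≤ fiberCount g B v) (t := Ico k1 (D + 1) ×ˢ Ico k2 (D + 1))
      (g := fun v => (fiberCount f A v, fiberCount g B v))]
  · refine sum_congr rfl fun p hp => ?_
    simp only [mem_product, mem_Ico] at hp
    rw [sum_congr rfl (g := fun _ => (p.1 : ℝ))]
    · rw [sum_const, nsmul_eq_mul, mul_comm]
      congr 3
      ext v
      simp only [mem_filter, Prod.ext_iff]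
      constructor
      · rintro ⟨⟨h1, -⟩, h2⟩; exact ⟨h1, h2⟩
      · rintro ⟨h1, h2⟩; exact ⟨⟨h1, by omega⟩, h2⟩
    · intro v hv
      have := (mem_filter.1 hv).2
      rw [← this]
  · intro v hv
    obtain ⟨hv, h1, h2⟩ := mem_filter.1 hv
    have := hf v hv
    have := hg v hv
    simp only [mem_product, mem_Ico]
    omega

lemma abs_sum_heavy_sub_le {c δ n θ1 θ2 : ℝ} (hδ : 0 ≤ δ)
    (hf : ∀ v ∈ W, fiberCount f A v ≤ D) (hg : ∀ v ∈ W, fiberCount g B v ≤ D)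
    (hZ : ∀ j1 ∈ Icc k1 D, ∀ j2 ∈ Icc k2 D, |binSum W f g A B j1 j2 -
      n * poiMoment D c j1 * poiMoment D c j2 * θ1 ^ j1 * θ2 ^ j2| ≤ δ) :
    |∑ v ∈ W with k1 ≤ fiberCount f A v ∧ k2 ≤ fiberCount g B v, (fiberCount f A v : ℝ) -
      n * ((∑ i ∈ Ico k1 (D + 1), i * thinPoi D c θ1 i) *
        ∑ i ∈ Ico k2 (D + 1), thinPoi D c θ2 i)| ≤
      (D + 1) ^ 2 * (D * (((D + 1) * 2 ^ D) ^ 2 * δ)) := by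
  rw [sum_heavy_eq hf hg, sum_mul_sum, mul_sum, ← sum_sub_distrib]
  have hC : ∀ k : ℕ, ((Ico k (D + 1)).card : ℝ) ≤ D + 1 := fun k => by
    rw [Nat.card_Ico]; exact_mod_cast Nat.sub_le _ _
  set K : ℝ := D * (((D + 1) * 2 ^ D) ^ 2 * δ) with hK
  have hK0 : 0 ≤ K := by positivity
  have hterm : ∀ i1 ∈ Ico k1 (D + 1), |∑ i2 ∈ Ico k2 (D + 1), (i1 : ℝ) *
        ((W.filter fun v => fiberCount f A v = i1 ∧ fiberCount g B v = i2).card : ℝ) -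
      n * ∑ i2 ∈ Ico k2 (D + 1), i1 * thinPoi D c θ1 i1 * thinPoi D c θ2 i2| ≤ (D + 1) * K := by
    intro i1 hi1
    rw [mul_sum, ← sum_sub_distrib]
    refine (abs_sum_le_sum_abs _ _).trans ((sum_le_card_nsmul _ _ K fun i2 hi2 => ?_).trans ?_)
    · rw [mem_Ico] at hi1 hi2
      have := abs_card_filter_sub_le (c := c) (θ1 := θ1) (θ2 := θ2) hδ hf hg hZ hi1.1 hi2.1
      rw [show (i1 : ℝ) * ((W.filter fun v => fiberCount f A v = i1 ∧
          fiberCount g B v = i2).card : ℝ) - n * (i1 * thinPoi D c θ1 i1 * thinPoi D c θ2 i2) =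
          i1 * (((W.filter fun v => fiberCount f A v = i1 ∧ fiberCount g B v = i2).card : ℝ) -
          n * (thinPoi D c θ1 i1 * thinPoi D c θ2 i2)) by ring, abs_mul, Nat.abs_cast]
      have hiD : (i1 : ℝ) ≤ D := by exact_mod_cast Nat.lt_succ_iff.1 hi1.2
      exact mul_le_mul hiD this (abs_nonneg _) (by positivity)
    · rw [nsmul_eq_mul]; exact mul_le_mul_of_nonneg_right (hC k2) hK0
  refine (abs_sum_le_sum_abs _ _).trans ((sum_le_card_nsmul _ _ _ hterm).trans ?_)
  rw [nsmul_eq_mul]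
  calc _ ≤ ((D : ℝ) + 1) * ((D + 1) * K) := mul_le_mul_of_nonneg_right (hC k1) (by positivity)
    _ = _ := by ring

end HeavySums

lemma poiMoment_le {c : ℝ} (hc : 0 ≤ c) (D j : ℕ) : poiMoment D c j ≤ 2 ^ D := by
  have h1 : ∑ d ∈ range (D + 1), poi c d ≤ 1 := by
    have h := pPoi_eq (D + 1) c
    have h0 := pPoi_nonneg (D + 1) hc
    linarith
  calc poiMoment D c j ≤ ∑ d ∈ range (D + 1), poi c d * 2 ^ D := by
        refine sum_le_sum fun d hd => mul_le_mul_of_nonneg_left ?_ (poi_nonneg hc d)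
        exact_mod_cast (Nat.choose_le_two_pow d j).trans
          (Nat.pow_le_pow_right (by norm_num) (Nat.lt_succ_iff.1 (mem_range.1 hd)))
    _ = (∑ d ∈ range (D + 1), poi c d) * 2 ^ D := by rw [sum_mul]
    _ ≤ 1 * 2 ^ D := by gcongr
    _ = _ := one_mul _

/-- The truncation level `D` approximates thinned Poisson tails and tail means within `ε`. -/
def ThinApprox (D : ℕ) (c ε : ℝ) (k : ℕ) : Prop :=
  ∀ θ : ℝ, 0 ≤ θ → θ ≤ 1 →
    (pPoi k (c * θ) - ε ≤ ∑ i ∈ Ico k (D + 1), thinPoi D c θ i ∧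
      ∑ i ∈ Ico k (D + 1), thinPoi D c θ i ≤ pPoi k (c * θ)) ∧
    (c * θ * pPoi (k - 1) (c * θ) - ε ≤ ∑ i ∈ Ico k (D + 1), i * thinPoi D c θ i ∧
      ∑ i ∈ Ico k (D + 1), i * thinPoi D c θ i ≤ c * θ * pPoi (k - 1) (c * θ))

section Peeling

variable {ι V : Type*} [DecidableEq ι] [Fintype V] [DecidableEq V]

/-- The constant in the comparison of heavy sums with binomial statistics. -/
noncomputable def heavyConst (D : ℕ) : ℝ := (D + 1) ^ 2 * (D * ((D + 1) * 2 ^ D) ^ 2)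

lemma abs_heavy_sub_le {W : Finset V} {f g : ι → V} {A B : Finset ι} {k1 k2 D : ℕ}
    {c δ n θ1 θ2 ε τ : ℝ} (hc : 0 ≤ c) (hδ : 0 ≤ δ) (hn : 0 ≤ n) (hε : 0 ≤ ε)
    (hf : ∀ v ∈ W, fiberCount f A v ≤ D) (hg : ∀ v ∈ W, fiberCount g B v ≤ D)
    (hZ : ∀ j1 ∈ Icc k1 D, ∀ j2 ∈ Icc k2 D, |binSum W f g A B j1 j2 -
      n * poiMoment D c j1 * poiMoment D c j2 * θ1 ^ j1 * θ2 ^ j2| ≤ δ)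
    (h1 : ThinApprox D c ε k1) (h2 : ThinApprox D c ε k2)
    (h10 : 0 ≤ θ1) (h11 : θ1 ≤ 1) (h20 : 0 ≤ θ2) (h21 : θ2 ≤ 1)
    (hτ : (∑ v ∈ Wᶜ, fiberCount f A v : ℝ) ≤ τ) :
    |∑ v with k1 ≤ fiberCount f A v ∧ k2 ≤ fiberCount g B v, (fiberCount f A v : ℝ) -
      n * (c * θ1 * pPoi (k1 - 1) (c * θ1) * pPoi k2 (c * θ2))| ≤
      n * ((c + 1) * ε) + heavyConst D * δ + τ := by
  have hH := abs_sum_heavy_sub_le (c := c) (θ1 := θ1) (θ2 := θ2) hδ hf hg hZ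
  obtain ⟨-, ha1, ha2⟩ := h1 θ1 h10 h11
  obtain ⟨⟨hb1, hb2⟩, -⟩ := h2 θ2 h20 h21
  set a' := ∑ i ∈ Ico k1 (D + 1), (i : ℝ) * thinPoi D c θ1 i with ha'
  set b' := ∑ i ∈ Ico k2 (D + 1), thinPoi D c θ2 i with hb'
  have hb0 : 0 ≤ b' := sum_nonneg fun i _ => thinPoi_nonneg D i hc h20 h21
  have hp1 := pPoi_le_one (k1 - 1) (mul_nonneg hc h10)
  have hp2 := pPoi_le_one k2 (mul_nonneg hc h20)
  have hp10 := pPoi_nonneg (k1 - 1) (mul_nonneg hc h10)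
  have hp20 := pPoi_nonneg k2 (mul_nonneg hc h20)
  set a := c * θ1 * pPoi (k1 - 1) (c * θ1) with ha
  set b := pPoi k2 (c * θ2) with hb
  have ha0 : 0 ≤ a := by positivity
  have hac : a ≤ c := by
    have : c * θ1 ≤ c := mul_le_of_le_one_right hc h11
    calc a ≤ c * θ1 * 1 := mul_le_mul_of_nonneg_left hp1 (by positivity)
      _ ≤ c := by linarith
  have hab : |n * (a' * b') - n * (a * b)| ≤ n * ((c + 1) * ε) := by
    rw [← mul_sub, abs_mul, abs_of_nonneg hn]
    refine mul_le_mul_of_nonneg_left ?_ hn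
    have e1 : a' * b' - a * b = -(a * (b - b') + (a - a') * b') := by ring
    have e2 : a * (b - b') ≤ c * ε := mul_le_mul hac (by linarith) (by linarith) hc
    have e3 : (a - a') * b' ≤ ε * 1 := mul_le_mul (by linarith) (by linarith) hb0 hε
    have e4 : 0 ≤ a * (b - b') := mul_nonneg ha0 (by linarith)
    have e5 : 0 ≤ (a - a') * b' := mul_nonneg (by linarith) hb0
    rw [e1, abs_neg, abs_of_nonneg (by linarith)]
    linarith
  have hsplit : ∑ v with k1 ≤ fiberCount f A v ∧ k2 ≤ fiberCount g B v, (fiberCount f A v : ℝ) =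
      ∑ v ∈ W with k1 ≤ fiberCount f A v ∧ k2 ≤ fiberCount g B v, (fiberCount f A v : ℝ) +
      ∑ v ∈ Wᶜ with k1 ≤ fiberCount f A v ∧ k2 ≤ fiberCount g B v, (fiberCount f A v : ℝ) := by
    simp only [sum_filter]
    exact (sum_add_sum_compl W _).symm
  have ht0 : 0 ≤ ∑ v ∈ Wᶜ with k1 ≤ fiberCount f A v ∧ k2 ≤ fiberCount g B v,
      (fiberCount f A v : ℝ) := sum_nonneg fun _ _ => by positivity
  have ht1 : ∑ v ∈ Wᶜ with k1 ≤ fiberCount f A v ∧ k2 ≤ fiberCount g B v,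
      (fiberCount f A v : ℝ) ≤ τ :=
    (sum_le_sum_of_subset_of_nonneg (filter_subset _ _) fun _ _ _ => by positivity).trans hτ
  have hK : (D + 1 : ℝ) ^ 2 * (D * (((D + 1) * 2 ^ D) ^ 2 * δ)) = heavyConst D * δ := by
    unfold heavyConst; ring
  rw [hK] at hH
  rw [hsplit]
  rw [abs_le] at hH hab ⊢
  constructor <;> linarith [hH.1, hH.2, hab.1, hab.2]

/-- The functions whose comparison with `z1`, `z2` governs the size of the core. -/
noncomputable def coreF (k1 k2 : ℕ) (z1 z2 : ℝ) : ℝ := pPoi k1 z1 * pPoi (k2 - 1) z2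

lemma coreF_mono (k1 k2 : ℕ) {x1 x2 y1 y2 : ℝ} (h1 : 0 ≤ x1) (h2 : 0 ≤ x2) (h1' : x1 ≤ y1)
    (h2' : x2 ≤ y2) : coreF k1 k2 x1 x2 ≤ coreF k1 k2 y1 y2 :=
  mul_le_mul (pPoi_mono _ h1 h1') (pPoi_mono _ h2 h2') (pPoi_nonneg _ h2)
    (pPoi_nonneg _ (h1.trans h1'))

lemma coreF_pos (k1 k2 : ℕ) {z1 z2 : ℝ} (h1 : 0 < z1) (h2 : 0 < z2) : 0 < coreF k1 k2 z1 z2 :=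
  mul_pos (pPoi_pos _ h1) (pPoi_pos _ h2)

lemma coreF_le_one (k1 k2 : ℕ) {z1 z2 : ℝ} (h1 : 0 ≤ z1) (h2 : 0 ≤ z2) : coreF k1 k2 z1 z2 ≤ 1 :=
  mul_le_one₀ (pPoi_le_one _ h1) (pPoi_nonneg _ h2) (pPoi_le_one _ h2)

/-- The parameters at which a core with `c₊ n` edges may exist. -/
def CoreFeasible (k1 k2 : ℕ) (c z1 z2 : ℝ) : Prop :=
  0 < z1 ∧ 0 < z2 ∧ z1 ≤ c * coreF k1 k2 z1 z2 ∧ z2 ≤ c * coreF k2 k1 z2 z1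

/-- A typical number of edges of the core. -/
def CoreEdgesOk (k1 k2 : ℕ) (c c' zs1 zs2 n m : ℝ) (M : ℕ) : Prop :=
  m * (zs1 * zs2 / c ^ 2) ≤ M ∧
    ∃ z1 z2, CoreFeasible k1 k2 c' z1 z2 ∧ (M : ℝ) ≤ n * (z1 * z2 / c)

/-- One variable of the equations at a state of the peeling process is bounded below. -/
lemma lower_bound_of_heavy_le {k1 k2 : ℕ} {c e n zs1 zs2 z1 z2 M H : ℝ} (hc : 0 < c) (hn : 0 < n)
    (hzs1 : 0 < zs1) (hzs2 : 0 < zs2) (h1 : zs1 ≤ z1) (h2 : zs2 ≤ z2) (he : 0 ≤ e)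
    (hM : M ≤ n * (z1 * z2 / c)) (hHM : H ≤ M)
    (hH : n * (z1 * pPoi (k1 - 1) z1 * pPoi k2 z2) - e * n ≤ H) :
    c * coreF k2 k1 zs2 zs1 - c * e / zs1 ≤ z2 := by
  have hz1 : 0 < z1 := hzs1.trans_le h1
  have h3 : z1 * coreF k2 k1 z2 z1 - e ≤ z1 * z2 / c := by
    refine le_of_mul_le_mul_left (a := n) ?_ hn
    calc n * (z1 * coreF k2 k1 z2 z1 - e) = n * (z1 * pPoi (k1 - 1) z1 * pPoi k2 z2) - e * n := by
          unfold coreF; ring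
      _ ≤ _ := by linarith
  have hmono := coreF_mono k2 k1 hzs2.le hzs1.le h2 h1
  rw [le_div_iff₀ hc] at h3
  have h4 : c * e / z1 ≤ c * e / zs1 := by gcongr
  have h5 : c * coreF k2 k1 z2 z1 - c * e / z1 ≤ z2 := by
    refine le_of_mul_le_mul_left (a := z1) ?_ hz1
    calc z1 * (c * coreF k2 k1 z2 z1 - c * e / z1) = (z1 * coreF k2 k1 z2 z1 - e) * c := by
          field_simp
      _ ≤ _ := h3
  have h6 := mul_le_mul_of_nonneg_left hmono hc.le
  linarith

/-- At a terminal state of the peeling process the equations nearly hold. -/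
lemma upper_bound_of_le_heavy {k1 k2 : ℕ} {c c' e n m zs1 zs2 z1 z2 M : ℝ} (hc : 0 < c)
    (hn : 0 < n) (hzs1 : 0 < zs1) (hzs2 : 0 < zs2) (h1 : zs1 ≤ z1) (h2 : zs2 ≤ z2) (he : 0 ≤ e)
    (hz2 : z2 ≤ c) (hm : c * n ≤ m + 1) (hcc : c ≤ c')
    (hM : M = m * (z1 * z2 / c ^ 2))
    (hH : M ≤ n * (z1 * pPoi (k1 - 1) z1 * pPoi k2 z2) + e * n)
    (hgap : c * e / zs1 + 1 / n ≤ (c' - c) * coreF k2 k1 zs2 zs1) :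
    z2 ≤ c' * coreF k2 k1 z2 z1 := by
  have hz1 : 0 < z1 := hzs1.trans_le h1
  have hz2' : 0 < z2 := hzs2.trans_le h2
  have hmono := coreF_mono k2 k1 hzs2.le hzs1.le h2 h1
  have hc2 : 0 < z1 * z2 / c ^ 2 := by positivity
  have h3 : n * (z1 * z2 / c) - z1 * z2 / c ^ 2 ≤ M := by
    rw [hM]
    have : (c * n - 1) * (z1 * z2 / c ^ 2) ≤ m * (z1 * z2 / c ^ 2) := by
      gcongr; linarith
    calc _ = (c * n - 1) * (z1 * z2 / c ^ 2) := by field_simp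
      _ ≤ _ := this
  have h4 : n * (z1 * z2 / c) - z1 * z2 / c ^ 2 ≤ n * (z1 * coreF k2 k1 z2 z1) + e * n := by
    refine h3.trans (hH.trans (le_of_eq ?_)); unfold coreF; ring
  have h5 : z2 ≤ c * coreF k2 k1 z2 z1 + c * e / z1 + z2 / (c * n) := by
    refine le_of_mul_le_mul_left (a := n * z1 / c) ?_ (by positivity)
    calc n * z1 / c * z2 = n * (z1 * z2 / c) := by ring
      _ ≤ n * (z1 * coreF k2 k1 z2 z1) + e * n + z1 * z2 / c ^ 2 := by linarith
      _ = _ := by field_simp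
  have h6 : c * e / z1 ≤ c * e / zs1 := by gcongr
  have h7 : z2 / (c * n) ≤ 1 / n := by
    rw [div_le_div_iff₀ (by positivity) hn]; nlinarith
  have h8 := mul_le_mul_of_nonneg_left hmono (by linarith : 0 ≤ c' - c)
  linarith

end Peeling

/-- Admissible numerical parameters for the analysis of the peeling process on `n` vertices with
`m` edges. -/
structure PeelParams (k1 k2 D : ℕ) (c c' zs1 zs2 e g ε l κ μ n m : ℝ) : Prop where
  hc : 0 < c
  hcc : c ≤ c'
  hzs1 : 0 < zs1
  hzs2 : 0 < zs2
  he : 0 < e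
  hε : 0 < ε
  hl : 0 < l
  hn : 0 < n
  hmc : m ≤ c * n
  hcm : c * n ≤ m + 1
  gap1 : zs1 + g ≤ c * coreF k1 k2 zs1 zs2 - c * e / zs2
  gap2 : zs2 + g ≤ c * coreF k2 k1 zs2 zs1 - c * e / zs1
  slack1 : c * e / zs2 + 1 / n ≤ (c' - c) * coreF k1 k2 zs1 zs2
  slack2 : c * e / zs1 + 1 / n ≤ (c' - c) * coreF k2 k1 zs2 zs1
  thin1 : ThinApprox D c (e / (3 * (c + 1))) k1
  thin2 : ThinApprox D c (e / (3 * (c + 1))) k2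
  dev : heavyConst D * ε ≤ e / 3
  hμ : μ ≤ m * (zs1 * zs2 / c ^ 2)
  hμ1 : 1 ≤ μ
  hμD : D ≤ μ
  hμg : c ≤ g * μ
  hl4 : l * 4 ^ D ≤ 1
  hκ : l ^ 2 * (4 ^ D) ^ 2 + l * (n * 4 ^ D * (D / μ) ^ 2) ≤ κ

lemma PeelParams.swap {k1 k2 D : ℕ} {c c' zs1 zs2 e g ε l κ μ n m : ℝ}
    (P : PeelParams k1 k2 D c c' zs1 zs2 e g ε l κ μ n m) :
    PeelParams k2 k1 D c c' zs2 zs1 e g ε l κ μ n m where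
  __ := P
  hzs1 := P.hzs2
  hzs2 := P.hzs1
  gap1 := P.gap2
  gap2 := P.gap1
  slack1 := P.slack2
  slack2 := P.slack1
  thin1 := P.thin2
  thin2 := P.thin1
  hμ := by rw [mul_comm zs2]; exact P.hμ

/-- Vertices of small in- and out-degree. -/
def lowDegree {ι V : Type*} [Fintype ι] [Fintype V] [DecidableEq V] (D : ℕ) (f g : ι → V) :
    Finset V :=
  univ.filter fun v => fiberCount f univ v ≤ D ∧ fiberCount g univ v ≤ D

lemma lowDegree_comm {ι V : Type*} [Fintype ι] [Fintype V] [DecidableEq V] (D : ℕ) (f g : ι → V) :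
    lowDegree D f g = lowDegree D g f := by
  unfold lowDegree; simp only [and_comm]

section Step

variable {ι V : Type*} [Fintype ι] [DecidableEq ι] [Fintype V] [DecidableEq V]
  {k1 k2 D : ℕ} {c c' zs1 zs2 e g ε l κ μ n m : ℝ} {f h : ι → V} {A B : Finset ι} {θ1 θ2 : ℝ}

/-- The invariant of the peeling process. -/
def PeelInv (c zs1 zs2 m : ℝ) (A : Finset ι) (θ1 θ2 : ℝ) : Prop :=
  zs1 ≤ c * θ1 ∧ θ1 ≤ 1 ∧ zs2 ≤ c * θ2 ∧ θ2 ≤ 1 ∧ (A.card : ℝ) = m * (θ1 * θ2)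

lemma PeelInv.swap (hI : PeelInv c zs1 zs2 m A θ1 θ2) : PeelInv c zs2 zs1 m A θ2 θ1 :=
  ⟨hI.2.2.1, hI.2.2.2.1, hI.1, hI.2.1, by rw [hI.2.2.2.2, mul_comm θ1]⟩

lemma PeelInv.pos (P : PeelParams k1 k2 D c c' zs1 zs2 e g ε l κ μ n m)
    (hI : PeelInv c zs1 zs2 m A θ1 θ2) : 0 < θ1 ∧ 0 < θ2 :=
  ⟨pos_of_mul_pos_right (P.hzs1.trans_le hI.1) P.hc.le,
    pos_of_mul_pos_right (P.hzs2.trans_le hI.2.2.1) P.hc.le⟩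

lemma PeelParams.m_nonneg (P : PeelParams k1 k2 D c c' zs1 zs2 e g ε l κ μ n m) : 0 ≤ m := by
  have h1 := P.hμ1.trans P.hμ
  have h2 : 0 < zs1 * zs2 / c ^ 2 := by
    have := P.hc; have := P.hzs1; have := P.hzs2; positivity
  by_contra! hm
  nlinarith

lemma PeelInv.le_card (P : PeelParams k1 k2 D c c' zs1 zs2 e g ε l κ μ n m)
    (hI : PeelInv c zs1 zs2 m A θ1 θ2) :
    m * (zs1 * zs2 / c ^ 2) ≤ A.card := by
  have hc := P.hc
  rw [hI.2.2.2.2]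
  refine mul_le_mul_of_nonneg_left ?_ P.m_nonneg
  rw [div_le_iff₀ (by positivity)]
  calc zs1 * zs2 ≤ (c * θ1) * (c * θ2) :=
        mul_le_mul hI.1 hI.2.2.1 P.hzs2.le (P.hzs1.le.trans hI.1)
    _ = _ := by ring

lemma heavy_bounds (P : PeelParams k1 k2 D c c' zs1 zs2 e g ε l κ μ n m)
    (hI : PeelInv c zs1 zs2 m A θ1 θ2)
    (htail : (∑ v ∈ (lowDegree D f h)ᶜ, (fiberCount f univ v + fiberCount h univ v) : ℝ) ≤
      e / 3 * n)
    (hκ0 : 0 ≤ κ)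
    (hpot : potential k1 k2 D l κ (l * (ε * n)) n (poiMoment D c) (lowDegree D f h) f h A B θ1 θ2
      < 1) :
    |∑ v with k1 ≤ fiberCount f A v ∧ k2 ≤ fiberCount h B v, (fiberCount f A v : ℝ) -
      n * (c * θ1 * pPoi (k1 - 1) (c * θ1) * pPoi k2 (c * θ2))| ≤ e * n := by
  have hc := P.hc
  have hn := P.hn
  have hpos := hI.pos P
  refine (abs_heavy_sub_le (W := lowDegree D f h) (δ := ε * n) (ε := e / (3 * (c + 1)))
    (τ := e / 3 * n) hc.le (by have := P.hε; positivity) hn.le (by have := P.he; positivity)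
    (fun v hv => (fiberCount_mono f (subset_univ _) v).trans (mem_filter.1 hv).2.1)
    (fun v hv => (fiberCount_mono h (subset_univ _) v).trans (mem_filter.1 hv).2.2)
    (fun j1 hj1 j2 hj2 => (abs_lt_of_potential_lt_one hj1 hj2 P.hl hκ0 hpot).le)
    P.thin1 P.thin2 hpos.1.le hI.2.1 hpos.2.le hI.2.2.2.1 ?_).trans ?_
  · refine le_trans (sum_le_sum fun v _ => ?_) htail
    have : (fiberCount f A v : ℝ) ≤ fiberCount f univ v := by
      exact_mod_cast fiberCount_mono f (subset_univ _) v
    linarith [(Nat.cast_nonneg (fiberCount h univ v) : (0 : ℝ) ≤ _)]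
  · have h1 : n * ((c + 1) * (e / (3 * (c + 1)))) = e / 3 * n := by field_simp
    have h2 : heavyConst D * (ε * n) ≤ e / 3 * n := by
      rw [← mul_assoc]; exact mul_le_mul_of_nonneg_right P.dev hn.le
    linarith

lemma sum_heavy_le_card (f h : ι → V) (A B : Finset ι) (k1 k2 : ℕ) :
    ∑ v with k1 ≤ fiberCount f A v ∧ k2 ≤ fiberCount h B v, (fiberCount f A v : ℝ) ≤ A.card := by
  rw [← sum_fiberCount f A, Nat.cast_sum]
  exact sum_le_sum_of_subset_of_nonneg (filter_subset _ _) fun _ _ _ => by positivity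

lemma sum_heavy_eq_card (f h : ι → V) (A B : Finset ι) (k1 k2 : ℕ)
    (H : ∀ a ∈ A, k1 ≤ fiberCount f A (f a) ∧ k2 ≤ fiberCount h B (f a)) :
    ∑ v with k1 ≤ fiberCount f A v ∧ k2 ≤ fiberCount h B v, (fiberCount f A v : ℝ) = A.card := by
  rw [← sum_fiberCount f A, Nat.cast_sum]
  refine sum_subset (filter_subset _ _) fun v _ hv => ?_
  rw [Nat.cast_eq_zero]
  unfold fiberCount
  rw [card_eq_zero, filter_eq_empty_iff]
  rintro a ha rfl
  exact hv (mem_filter.2 ⟨mem_univ _, H a ha⟩)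

/-- At a good state the invariant survives the deletion of a pair. -/
lemma PeelInv.erase (P : PeelParams k1 k2 D c c' zs1 zs2 e g ε l κ μ n m)
    (hI : PeelInv c zs1 zs2 m A θ1 θ2) (hAB : A.card = B.card)
    (htail : (∑ v ∈ (lowDegree D f h)ᶜ, (fiberCount f univ v + fiberCount h univ v) : ℝ) ≤
      e / 3 * n)
    (hκ0 : 0 ≤ κ)
    (hpot : potential k1 k2 D l κ (l * (ε * n)) n (poiMoment D c) (lowDegree D f h) f h A B θ1 θ2
      < 1) {a : ι} (ha : a ∈ A) :
    PeelInv c zs1 zs2 m (A.erase a) (θ1 * (1 - 1 / A.card)) θ2 := by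
  have hc := P.hc
  have hpos := hI.pos P
  have hMμ := P.hμ.trans (hI.le_card P)
  have hM1 := P.hμ1.trans hMμ
  have hM0 : (0 : ℝ) < A.card := by linarith
  have hA1 : 1 ≤ A.card := by exact_mod_cast hM1
  have hpot' := hpot
  rw [potential_comm hAB, lowDegree_comm] at hpot'
  have htail' : (∑ v ∈ (lowDegree D h f)ᶜ, (fiberCount h univ v + fiberCount f univ v) : ℝ) ≤
      e / 3 * n := by
    rw [lowDegree_comm]; simpa only [add_comm] using htail
  have hB : PeelInv c zs2 zs1 m B θ2 θ1 := by
    have := hI.swap; unfold PeelInv at this ⊢; rwa [← hAB]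
  have hb := (abs_le.1 (heavy_bounds P.swap hB htail' hκ0 hpot')).1
  have hlow := lower_bound_of_heavy_le (k1 := k2) (k2 := k1) (c := c) (e := e) (n := n)
    (zs1 := zs2) (zs2 := zs1) (z1 := c * θ2) (z2 := c * θ1) (M := B.card)
    hc P.hn P.hzs2 P.hzs1 hI.2.2.1 hI.1 P.he.le (by
      rw [hB.2.2.2.2]
      have := P.hmc
      calc m * (θ2 * θ1) ≤ c * n * (θ2 * θ1) :=
            mul_le_mul_of_nonneg_right this (by have := hpos.1; have := hpos.2; positivity)
        _ = _ := by field_simp)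
    (sum_heavy_le_card h f B A k2 k1) (by linarith)
  have hz := P.gap1.trans hlow
  refine ⟨?_, ?_, hI.2.2.1, hI.2.2.2.1, ?_⟩
  · have h1 : c * θ1 / A.card ≤ g := by
      rw [div_le_iff₀ hM0]
      have hg : 0 ≤ g := by
        by_contra! hg
        have := P.hμg; have := P.hμ1
        nlinarith
      calc c * θ1 ≤ c := mul_le_of_le_one_right hc.le hI.2.1
        _ ≤ g * μ := P.hμg
        _ ≤ g * A.card := by gcongr
    calc zs1 ≤ c * θ1 - c * θ1 / A.card := by linarith
      _ = _ := by ring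
  · have : 1 / (A.card : ℝ) ≤ 1 := by rw [div_le_one hM0]; exact hM1
    have h0 : 0 ≤ 1 / (A.card : ℝ) := by positivity
    calc θ1 * (1 - 1 / A.card) ≤ 1 * 1 :=
          mul_le_mul hI.2.1 (by linarith) (by linarith) (by norm_num)
      _ = 1 := one_mul 1
  · rw [card_erase_of_mem ha, Nat.cast_sub hA1, Nat.cast_one]
    have := hI.2.2.2.2
    calc (A.card : ℝ) - 1 = m * (θ1 * θ2) * (1 - 1 / A.card) := by rw [← this]; field_simp
      _ = _ := by ring

lemma sum_potential_erase_le_of_inv (P : PeelParams k1 k2 D c c' zs1 zs2 e g ε l κ μ n m)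
    (hI : PeelInv c zs1 zs2 m A θ1 θ2) {b : ι} (hb : b ∈ B)
    (hlight : ¬ (k1 ≤ fiberCount f A (h b) ∧ k2 ≤ fiberCount h B (h b))) :
    ∑ a ∈ A, potential k1 k2 D l κ (l * (ε * n)) n (poiMoment D c) (lowDegree D f h) f h
        (A.erase a) (B.erase b) (θ1 * (1 - 1 / A.card)) θ2 ≤
      A.card * potential k1 k2 D l κ (l * (ε * n)) n (poiMoment D c) (lowDegree D f h) f h
        A B θ1 θ2 := by
  have hc := P.hc
  have hn := P.hn
  have hpos := hI.pos P
  have hMμ := P.hμ.trans (hI.le_card P)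
  have hM1 := P.hμ1.trans hMμ
  have hμ0 : 0 < μ := by linarith [P.hμ1]
  refine sum_potential_erase_le (Y := n * 4 ^ D) hb ?_
    (fun v hv => (fiberCount_mono f (subset_univ _) v).trans (mem_filter.1 hv).2.1)
    (fun v hv => (fiberCount_mono h (subset_univ _) v).trans (mem_filter.1 hv).2.2)
    (by exact_mod_cast hM1) (by exact_mod_cast P.hμD.trans hMμ) hn.le
    (poiMoment_nonneg hc.le D) ?_ hpos.1.le hI.2.1 hpos.2.le hI.2.2.2.1 P.hl.le P.hl4 ?_
  · by_contra! hcon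
    exact hlight hcon
  · intro j1 j2
    have h4 : (4 : ℝ) ^ D = 2 ^ D * 2 ^ D := by rw [← mul_pow]; norm_num
    rw [mul_assoc, h4]
    refine mul_le_mul_of_nonneg_left ?_ hn.le
    exact mul_le_mul (poiMoment_le hc.le D j1) (poiMoment_le hc.le D j2)
      (poiMoment_nonneg hc.le D j2) (by positivity)
  · refine le_trans ?_ P.hκ
    have := P.hl
    gcongr

lemma card_bad_perm_le (P : PeelParams k1 k2 D c c' zs1 zs2 e g ε l κ μ n m)
    (hm : m = Fintype.card ι) (t h : ι → V)
    (htail : (∑ v ∈ (lowDegree D h t)ᶜ, (fiberCount h univ v + fiberCount t univ v) : ℝ) ≤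
      e / 3 * n) (Bad : Equiv.Perm ι → Finset ι → Prop) [∀ π I, Decidable (Bad π I)]
    (hBad : ∀ π I, Bad π I ↔
      ¬ CoreEdgesOk k1 k2 c c' zs1 zs2 n m (coreEdges k1 k2 t (h ∘ π) I)) :
    ((univ.filter fun π : Equiv.Perm ι => Bad π univ).card : ℝ) ≤
      (Fintype.card ι).factorial * potential k1 k2 D l κ (l * (ε * n)) n (poiMoment D c)
        (lowDegree D h t) h t univ univ 1 1 := by
  have hc := P.hc
  have hκ0 : 0 ≤ κ := by
    refine le_trans ?_ P.hκ
    have := P.hl; have := P.hn; have := P.hμ1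
    positivity
  have htail' : (∑ v ∈ (lowDegree D t h)ᶜ, (fiberCount t univ v + fiberCount h univ v) : ℝ) ≤
      e / 3 * n := by
    rw [lowDegree_comm]; simpa only [add_comm] using htail
  have key := card_permsOff_filter_le Bad
    (fun I J (x : ℝ × ℝ) => potential k1 k2 D l κ (l * (ε * n)) n (poiMoment D c)
        (lowDegree D h t) h t J I x.1 x.2) (fun _ _ _ => potential_nonneg)
    (fun _ J x => PeelInv c zs1 zs2 m J x.1 x.2) ?_ (Fintype.card ι) 1 univ univ (1, 1)
    (by simp) (card_univ) ?_
  · have huniv : permsOff (1 : Equiv.Perm ι) univ = univ := by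
      ext π; simp [mem_permsOff]
    rw [huniv] at key
    exact key
  · rintro σ I J ⟨θ1, θ2⟩ hJ hI
    simp only at hI ⊢
    have hcard : J.card = I.card := by rw [← hJ, card_map]
    have hI' : PeelInv c zs2 zs1 m I θ2 θ1 := by
      have := hI.swap; unfold PeelInv at this ⊢; rwa [← hcard]
    by_cases hpot : 1 ≤ potential k1 k2 D l κ (l * (ε * n)) n (poiMoment D c)
        (lowDegree D h t) h t J I θ1 θ2
    · exact Or.inl hpot
    right
    rw [not_le] at hpot
    have hpot' := hpot
    rw [potential_comm hcard, lowDegree_comm] at hpot'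
    have hfib : ∀ π ∈ permsOff σ I, ∀ v, fiberCount (h ∘ π) I v = fiberCount h J v := by
      intro π hπ v
      rw [fiberCount_comp_perm, map_eq_of_mem_permsOff hπ, hJ]
    by_cases htl : ∃ i ∈ I, ¬ (k1 ≤ fiberCount h J (t i) ∧ k2 ≤ fiberCount t I (t i))
    · obtain ⟨i, hi, hlight⟩ := htl
      refine Or.inr (Or.inl ⟨i, hi, (θ1 * (1 - 1 / J.card), θ2), ?_, ?_, ?_⟩)
      · intro π hπ hb
        rw [hBad] at hb ⊢
        rwa [coreEdges_erase]
        rintro ⟨h1, -⟩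
        have := le_fiberCount_of_mem_seqCore h1
        rw [hfib π hπ] at this
        exact hlight this
      · intro j hj
        exact hI.erase P hcard htail hκ0 hpot hj
      · rw [← hcard]
        exact sum_potential_erase_le_of_inv P hI hi hlight
    by_cases hhd : ∃ j ∈ J, ¬ (k1 ≤ fiberCount h J (h j) ∧ k2 ≤ fiberCount t I (h j))
    · obtain ⟨j, hj, hlight⟩ := hhd
      refine Or.inr (Or.inr ⟨j, hj, (θ1, θ2 * (1 - 1 / I.card)), ?_, ?_, ?_⟩)
      · intro π hπ hb
        rw [hBad] at hb ⊢
        rwa [coreEdges_erase]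
        rintro ⟨-, h1⟩
        have := le_fiberCount_of_mem_seqCore h1
        rw [hfib π hπ] at this
        simp only [Function.comp, Equiv.apply_symm_apply] at this
        exact hlight this
      · intro i hi
        have h1 := (hI'.erase P.swap hcard.symm htail' hκ0 hpot' hi).swap
        unfold PeelInv at h1 ⊢
        rw [card_erase_of_mem hi] at h1
        rw [card_erase_of_mem hj, hcard]
        exact h1
      · have h1 := sum_potential_erase_le_of_inv (f := t) (h := h) P.swap hI' hj
          (by rwa [and_comm])
        rw [potential_comm hcard, lowDegree_comm D h t]
        refine le_trans (le_of_eq (sum_congr rfl fun i hi => ?_)) h1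
        rw [potential_comm]
        rw [card_erase_of_mem hi, card_erase_of_mem hj, hcard]
    left
    push Not at htl hhd
    intro π hπ hb
    rw [hBad] at hb
    refine hb ?_
    have hcore : coreEdges k1 k2 t (h ∘ π) I = I.card := by
      refine coreEdges_eq_card fun i hi => ?_
      rw [hfib π hπ, hfib π hπ]
      refine ⟨htl i hi, hhd (π i) ?_⟩
      rw [← hJ, ← map_eq_of_mem_permsOff hπ]
      exact mem_map_of_mem _ hi
    rw [hcore]
    have hpos := hI.pos P
    have hM : (I.card : ℝ) = m * (θ1 * θ2) := by rw [← hcard]; exact hI.2.2.2.2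
    refine ⟨hcard ▸ hI.le_card P, c * θ1, c * θ2,
      ⟨P.hzs1.trans_le hI.1, P.hzs2.trans_le hI.2.2.1, ?_, ?_⟩, ?_⟩
    · have hH' := (abs_le.1 (heavy_bounds P.swap hI' htail' hκ0 hpot')).2
      rw [sum_heavy_eq_card t h I J k2 k1 fun i hi => (htl i hi).symm] at hH'
      exact upper_bound_of_le_heavy (k1 := k2) (k2 := k1) (e := e) (m := m) hc P.hn P.hzs2 P.hzs1
        hI.2.2.1 hI.1 P.he.le (mul_le_of_le_one_right hc.le hI.2.1) P.hcm P.hcc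
        (M := I.card) (by rw [hM]; field_simp) (by linarith) P.slack1
    · have hH' := (abs_le.1 (heavy_bounds P hI htail hκ0 hpot)).2
      rw [sum_heavy_eq_card h t J I k1 k2 hhd] at hH'
      exact upper_bound_of_le_heavy (k1 := k1) (k2 := k2) (e := e) (m := m) hc P.hn P.hzs1 P.hzs2
        hI.1 hI.2.2.1 P.he.le (mul_le_of_le_one_right hc.le hI.2.2.2.1) P.hcm P.hcc
        (M := J.card) (by rw [hcard, hM]; field_simp) (by linarith) P.slack2
    · rw [hM]
      calc m * (θ1 * θ2) ≤ c * n * (θ1 * θ2) :=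
            mul_le_mul_of_nonneg_right P.hmc (by have := hpos.1; have := hpos.2; positivity)
        _ = _ := by field_simp
  · have hF1 := coreF_le_one k1 k2 P.hzs1.le P.hzs2.le
    have hF2 := coreF_le_one k2 k1 P.hzs2.le P.hzs1.le
    have hg0 : 0 ≤ g := by
      by_contra! hg
      have := P.hμg; have := P.hμ1
      nlinarith
    have h1 : 0 ≤ c * e / zs2 := by have := P.he; have := P.hzs2; positivity
    have h2 : 0 ≤ c * e / zs1 := by have := P.he; have := P.hzs1; positivity
    have g1 := P.gap1
    have g2 := P.gap2
    refine ⟨?_, le_rfl, ?_, le_rfl, ?_⟩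
    · simp only [mul_one]; nlinarith
    · simp only [mul_one]; nlinarith
    · simp only [mul_one]; rw [hm, card_univ]

end Step

section Initial

variable {ι V : Type*} [Fintype ι] [DecidableEq ι] [Fintype V] [DecidableEq V]

lemma sum_range_poi_le_one {c : ℝ} (hc : 0 ≤ c) (N : ℕ) : ∑ a ∈ range N, poi c a ≤ 1 := by
  have h := pPoi_eq N c
  have h0 := pPoi_nonneg N hc
  linarith

lemma sum_truncated_choose_poi {c : ℝ} {D m : ℕ} (hDm : D ≤ m) (j : ℕ) :
    ∑ a ∈ range (m + 1), (if a ≤ D then (a.choose j : ℝ) else 0) * poi c a = poiMoment D c j := by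
  unfold poiMoment
  rw [← sum_subset (range_subset_range.2 (by omega : D + 1 ≤ m + 1))]
  · refine sum_congr rfl fun a ha => ?_
    rw [if_pos (Nat.lt_succ_iff.1 (mem_range.1 ha)), mul_comm]
  · intro a _ ha
    rw [if_neg (by simpa using ha), zero_mul]

lemma sum_exp_choose_poi_le {c r : ℝ} (hc : 0 ≤ c) {D m : ℕ} (hDm : D ≤ m)
    (hr : |r| * 4 ^ D ≤ 1) (j1 j2 : ℕ) :
    ∑ a ∈ range (m + 1), ∑ b ∈ range (m + 1),
      Real.exp (r * ((if a ≤ D then (a.choose j1 : ℝ) else 0) *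
        (if b ≤ D then (b.choose j2 : ℝ) else 0) - poiMoment D c j1 * poiMoment D c j2)) *
        poi c a * poi c b ≤ Real.exp (r ^ 2 * (4 ^ D) ^ 2) := by
  set u : ℕ → ℝ := fun a => if a ≤ D then (a.choose j1 : ℝ) else 0 with hu
  set w : ℕ → ℝ := fun b => if b ≤ D then (b.choose j2 : ℝ) else 0 with hw
  have hbd : ∀ (j a : ℕ), 0 ≤ (if a ≤ D then (a.choose j : ℝ) else 0) ∧
      (if a ≤ D then (a.choose j : ℝ) else 0) ≤ 2 ^ D := by
    intro j a
    split_ifs with h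
    · exact ⟨by positivity, by
        exact_mod_cast (Nat.choose_le_two_pow a j).trans (Nat.pow_le_pow_right (by norm_num) h)⟩
    · exact ⟨le_rfl, by positivity⟩
  have h4 : (4 : ℝ) ^ D = 2 ^ D * 2 ^ D := by rw [← mul_pow]; norm_num
  set Q := poiMoment D c j1 * poiMoment D c j2 with hQ
  have hQ0 : 0 ≤ Q := mul_nonneg (poiMoment_nonneg hc _ _) (poiMoment_nonneg hc _ _)
  have hQ1 : Q ≤ 4 ^ D := by
    rw [h4]
    exact mul_le_mul (poiMoment_le hc _ _) (poiMoment_le hc _ _) (poiMoment_nonneg hc _ _)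
      (by positivity)
  set K := r ^ 2 * (4 ^ D) ^ 2 with hK
  have hK0 : 0 ≤ K := by positivity
  have hterm : ∀ a b, Real.exp (r * (u a * w b - Q)) ≤ 1 + K + r * (u a * w b - Q) := by
    intro a b
    have huw0 : 0 ≤ u a * w b := mul_nonneg (hbd j1 a).1 (hbd j2 b).1
    have huw1 : u a * w b ≤ 4 ^ D := by
      rw [h4]; exact mul_le_mul (hbd j1 a).2 (hbd j2 b).2 (hbd j2 b).1 (by positivity)
    have habs : |u a * w b - Q| ≤ 4 ^ D := by rw [abs_le]; constructor <;> linarith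
    have h1 : |r * (u a * w b - Q)| ≤ |r| * 4 ^ D := by
      rw [abs_mul]; exact mul_le_mul_of_nonneg_left habs (abs_nonneg _)
    have h2 : (r * (u a * w b - Q)) ^ 2 ≤ K := by
      rw [← sq_abs, hK, ← sq_abs r, ← mul_pow]; gcongr
    linarith [exp_le_one_add_add_sq (h1.trans hr)]
  set S := ∑ a ∈ range (m + 1), poi c a with hS
  have hS0 : 0 ≤ S := sum_nonneg fun a _ => poi_nonneg hc a
  have hS1 : S ≤ 1 := sum_range_poi_le_one hc _
  have hu' : ∑ a ∈ range (m + 1), u a * poi c a = poiMoment D c j1 := sum_truncated_choose_poi hDm j1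
  have hw' : ∑ a ∈ range (m + 1), w a * poi c a = poiMoment D c j2 := sum_truncated_choose_poi hDm j2
  calc _ ≤ ∑ a ∈ range (m + 1), ∑ b ∈ range (m + 1),
        (1 + K + r * (u a * w b - Q)) * poi c a * poi c b := by
        refine sum_le_sum fun a _ => sum_le_sum fun b _ => ?_
        have := poi_nonneg hc a
        have := poi_nonneg hc b
        gcongr
        exact hterm a b
    _ = ∑ a ∈ range (m + 1), ∑ b ∈ range (m + 1),
        ((1 + K - r * Q) * (poi c a * poi c b) + r * ((u a * poi c a) * (w b * poi c b))) :=
        sum_congr rfl fun a _ => sum_congr rfl fun b _ => by ring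
    _ = (1 + K - r * Q) * (S * S) + r * Q := by
        simp_rw [sum_add_distrib, ← mul_sum]
        rw [← sum_mul, ← sum_mul, hu', hw', ← hS]
    _ ≤ K + 1 := by
        have hSS0 : 0 ≤ S * S := by positivity
        have hSS : S * S ≤ 1 := mul_le_one₀ hS1 hS0 hS1
        have hrQ : r * Q ≤ 1 := by
          calc r * Q ≤ |r| * Q := mul_le_mul_of_nonneg_right (le_abs_self r) hQ0
            _ ≤ |r| * 4 ^ D := mul_le_mul_of_nonneg_left hQ1 (abs_nonneg _)
            _ ≤ 1 := hr
        nlinarith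
    _ ≤ _ := Real.add_one_le_exp K

/-- The normalizing factor in the Poisson comparison. -/
noncomputable def poiFactor (n m : ℕ) : ℝ := (Real.exp 2 * m * n ^ m) ^ 2

lemma sum_exp_binSum_le {c r : ℝ} (hc : 0 < c) {D : ℕ} (hm : 1 ≤ Fintype.card ι)
    (hmc : (Fintype.card ι : ℝ) ≤ c * Fintype.card V)
    (hcm : c * Fintype.card V ≤ Fintype.card ι + 1) (hDm : D ≤ Fintype.card ι)
    (hr : |r| * 4 ^ D ≤ 1) (j1 j2 : ℕ) :
    ∑ t : ι → V, ∑ h : ι → V, Real.exp (r * (binSum (lowDegree D h t) h t univ univ j1 j2 -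
      Fintype.card V * poiMoment D c j1 * poiMoment D c j2)) ≤
      poiFactor (Fintype.card V) (Fintype.card ι) *
        Real.exp (r ^ 2 * (4 ^ D) ^ 2 * Fintype.card V) := by
  have h1 := sum_prod_fiberCount_le_poi (ι := ι) (V := V) hc hm hmc hcm
    (fun a b => Real.exp (r * ((if a ≤ D then (a.choose j1 : ℝ) else 0) *
        (if b ≤ D then (b.choose j2 : ℝ) else 0) - poiMoment D c j1 * poiMoment D c j2)))
    (fun a b => (Real.exp_pos _).le)
  have h2 := sum_exp_choose_poi_le hc.le hDm hr j1 j2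
  refine (le_of_eq ?_).trans (h1.trans ?_)
  · refine sum_congr rfl fun t _ => sum_congr rfl fun h _ => ?_
    rw [← Real.exp_sum, ← mul_sum, sum_sub_distrib]
    congr 3
    · unfold binSum lowDegree
      rw [sum_filter]
      refine sum_congr rfl fun v _ => ?_
      by_cases ha : fiberCount h univ v ≤ D <;> by_cases hb : fiberCount t univ v ≤ D <;>
        simp [ha, hb]
    · rw [sum_const, card_univ, nsmul_eq_mul, mul_assoc]
  · unfold poiFactor
    refine mul_le_mul_of_nonneg_left ?_ (by positivity)
    rw [mul_comm (r ^ 2 * _), Real.exp_nat_mul]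
    refine pow_le_pow_left₀ ?_ h2 _
    refine sum_nonneg fun a _ => sum_nonneg fun b _ => ?_
    have := poi_nonneg hc.le a
    have := poi_nonneg hc.le b
    positivity

lemma exp_mul_poi (c : ℝ) (a : ℕ) :
    Real.exp a * poi c a = Real.exp ((Real.exp 1 - 1) * c) * poi (Real.exp 1 * c) a := by
  unfold poi
  rw [mul_pow, ← Real.exp_nat_mul, mul_one]
  have : Real.exp ((Real.exp 1 - 1) * c) * Real.exp (-(Real.exp 1 * c)) = Real.exp (-c) := by
    rw [← Real.exp_add]; ring_nf
  rw [← this]; ring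

lemma sum_exp_tail_poi_le {c : ℝ} (hc : 0 ≤ c) {D m : ℕ} (hDm : D ≤ m) :
    ∑ a ∈ range (m + 1), ∑ b ∈ range (m + 1),
      Real.exp (if a ≤ D ∧ b ≤ D then 0 else (a + b : ℝ)) * poi c a * poi c b ≤
      Real.exp (2 * Real.exp ((Real.exp 1 - 1) * c) ^ 2 * pPoi (D + 1) (Real.exp 1 * c)) := by
  set L := Real.exp ((Real.exp 1 - 1) * c) with hL
  have hL0 : 0 ≤ L := (Real.exp_pos _).le
  have hec : 0 ≤ Real.exp 1 * c := by positivity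
  set u : ℕ → ℝ := fun a => Real.exp a * poi c a with hu
  set w : ℕ → ℝ := fun a => if a ≤ D then 0 else Real.exp a * poi c a with hw
  have hu0 : ∀ a, 0 ≤ u a := fun a => mul_nonneg (Real.exp_pos _).le (poi_nonneg hc a)
  have hU : ∑ a ∈ range (m + 1), u a ≤ L := by
    simp only [hu, exp_mul_poi, ← mul_sum, ← hL]
    exact mul_le_of_le_one_right hL0 (sum_range_poi_le_one hec _)
  have hW : ∑ a ∈ range (m + 1), w a ≤ L * pPoi (D + 1) (Real.exp 1 * c) := by
    have h1 : ∑ a ∈ range (m + 1), w a = ∑ a ∈ Ico (D + 1) (m + 1), u a := by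
      rw [range_eq_Ico, ← sum_Ico_consecutive w (Nat.zero_le (D + 1)) (by omega)]
      rw [sum_eq_zero fun a ha => if_pos (by have := mem_Ico.1 ha; omega), zero_add]
      exact sum_congr rfl fun a ha => if_neg (by have := mem_Ico.1 ha; omega)
    rw [h1]
    simp only [hu, exp_mul_poi, ← mul_sum, ← hL]
    refine mul_le_mul_of_nonneg_left ?_ hL0
    rw [sum_Ico_poi (by omega)]
    linarith [pPoi_nonneg (m + 1) hec]
  have hw0 : ∀ a, 0 ≤ w a := fun a => by
    simp only [hw]; split_ifs; exacts [le_rfl, hu0 a]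
  have hterm : ∀ a b : ℕ, Real.exp (if a ≤ D ∧ b ≤ D then 0 else (a + b : ℝ)) * poi c a * poi c b ≤
      poi c a * poi c b + w a * u b + u a * w b := by
    intro a b
    have hpa := poi_nonneg hc a
    have hpb := poi_nonneg hc b
    have hpp := mul_nonneg hpa hpb
    split_ifs with h
    · simp only [Real.exp_zero, one_mul]
      have := mul_nonneg (hw0 a) (hu0 b)
      have := mul_nonneg (hu0 a) (hw0 b)
      linarith
    · have e1 : Real.exp (a + b) * poi c a * poi c b = u a * u b := by
        rw [Real.exp_add]; simp only [hu]; ring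
      rw [e1]
      rcases not_and_or.1 h with h | h
      · have : w a = u a := if_neg h
        rw [this]
        have := mul_nonneg (hu0 a) (hw0 b)
        linarith
      · have : w b = u b := if_neg h
        rw [this]
        have := mul_nonneg (hw0 a) (hu0 b)
        linarith
  set S := ∑ a ∈ range (m + 1), poi c a with hS
  have hS0 : 0 ≤ S := sum_nonneg fun a _ => poi_nonneg hc a
  have hS1 : S ≤ 1 := sum_range_poi_le_one hc _
  have hU0 : 0 ≤ ∑ a ∈ range (m + 1), u a := sum_nonneg fun a _ => hu0 a
  have hW0 : 0 ≤ ∑ a ∈ range (m + 1), w a := sum_nonneg fun a _ => hw0 a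
  calc _ ≤ ∑ a ∈ range (m + 1), ∑ b ∈ range (m + 1),
        (poi c a * poi c b + w a * u b + u a * w b) :=
        sum_le_sum fun a _ => sum_le_sum fun b _ => hterm a b
    _ = S * S + (∑ a ∈ range (m + 1), w a) * (∑ a ∈ range (m + 1), u a) +
        (∑ a ∈ range (m + 1), u a) * (∑ a ∈ range (m + 1), w a) := by
        simp_rw [sum_add_distrib, ← mul_sum, ← sum_mul]; rw [← hS]
    _ ≤ 1 + L * pPoi (D + 1) (Real.exp 1 * c) * L + L * (L * pPoi (D + 1) (Real.exp 1 * c)) := by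
        have h1 : S * S ≤ 1 := mul_le_one₀ hS1 hS0 hS1
        have h2 := mul_le_mul hW hU hU0 (mul_nonneg hL0 (pPoi_nonneg _ hec))
        have h3 := mul_le_mul hU hW hW0 hL0
        linarith
    _ = 2 * L ^ 2 * pPoi (D + 1) (Real.exp 1 * c) + 1 := by ring
    _ ≤ _ := Real.add_one_le_exp _

lemma sum_exp_tail_le {c : ℝ} (hc : 0 < c) {D : ℕ} (hm : 1 ≤ Fintype.card ι)
    (hmc : (Fintype.card ι : ℝ) ≤ c * Fintype.card V)
    (hcm : c * Fintype.card V ≤ Fintype.card ι + 1) (hDm : D ≤ Fintype.card ι) :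
    ∑ t : ι → V, ∑ h : ι → V, Real.exp (∑ v ∈ (lowDegree D h t)ᶜ,
        (fiberCount h univ v + fiberCount t univ v : ℝ)) ≤
      poiFactor (Fintype.card V) (Fintype.card ι) *
        Real.exp (2 * Real.exp ((Real.exp 1 - 1) * c) ^ 2 * pPoi (D + 1) (Real.exp 1 * c) *
          Fintype.card V) := by
  have h1 := sum_prod_fiberCount_le_poi (ι := ι) (V := V) hc hm hmc hcm
    (fun a b => Real.exp (if a ≤ D ∧ b ≤ D then 0 else (a + b : ℝ)))
    (fun a b => (Real.exp_pos _).le)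
  have h2 := sum_exp_tail_poi_le hc.le hDm
  refine (le_of_eq ?_).trans (h1.trans ?_)
  · refine sum_congr rfl fun t _ => sum_congr rfl fun h _ => ?_
    rw [← Real.exp_sum]
    congr 1
    unfold lowDegree
    rw [compl_filter, sum_filter]
    refine sum_congr rfl fun v _ => ?_
    rw [ite_not]
  · unfold poiFactor
    refine mul_le_mul_of_nonneg_left ?_ (by positivity)
    rw [mul_comm _ (Fintype.card V : ℝ), Real.exp_nat_mul]
    refine pow_le_pow_left₀ ?_ h2 _
    refine sum_nonneg fun a _ => sum_nonneg fun b _ => ?_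
    have := poi_nonneg hc.le a
    have := poi_nonneg hc.le b
    positivity

end Initial

section Master

variable {ι V : Type*} [Fintype ι] [DecidableEq ι] [Fintype V] [DecidableEq V]
  {k1 k2 D : ℕ} {c c' zs1 zs2 e g ε l κ μ : ℝ}

open Classical in
/-- The pairs of sequences whose multidigraph has an atypical number of core edges. -/
noncomputable def badPairs (ι V : Type*) [Fintype ι] [DecidableEq ι] [Fintype V] [DecidableEq V]
    (k1 k2 : ℕ) (c c' zs1 zs2 : ℝ) : Finset ((ι → V) × (ι → V)) :=
  univ.filter fun p => ¬ CoreEdgesOk k1 k2 c c' zs1 zs2 (Fintype.card V) (Fintype.card ι)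
    (coreEdges k1 k2 p.1 p.2 univ)

lemma sum_potential_univ_le (hc : 0 < c) (hm : 1 ≤ Fintype.card ι)
    (hmc : (Fintype.card ι : ℝ) ≤ c * Fintype.card V)
    (hcm : c * Fintype.card V ≤ Fintype.card ι + 1) (hDm : D ≤ Fintype.card ι)
    (hl : 0 < l) (hl4 : l * 4 ^ D ≤ 1) (e : ℝ) :
    ∑ t : ι → V, ∑ h : ι → V, potential k1 k2 D l κ e (Fintype.card V) (poiMoment D c)
        (lowDegree D h t) h t univ univ 1 1 ≤
      poiFactor (Fintype.card V) (Fintype.card ι) * (2 * (D + 1) ^ 2 *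
        Real.exp (l ^ 2 * (4 ^ D) ^ 2 * Fintype.card V + κ * Fintype.card ι - e)) := by
  set F := poiFactor (Fintype.card V) (Fintype.card ι) with hF
  set X := Real.exp (l ^ 2 * (4 ^ D) ^ 2 * Fintype.card V) with hX
  set Y := Real.exp (κ * Fintype.card ι - e) with hY
  have hF0 : 0 ≤ F := by rw [hF]; unfold poiFactor; positivity
  have key : ∀ j1 j2 : ℕ, ∑ t : ι → V, ∑ h : ι → V,
      2 * Real.cosh (l * (binSum (lowDegree D h t) h t univ univ j1 j2 -
        Fintype.card V * poiMoment D c j1 * poiMoment D c j2 * 1 ^ j1 * 1 ^ j2)) * Y ≤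
      2 * (F * X) * Y := by
    intro j1 j2
    have h1 := sum_exp_binSum_le (ι := ι) (V := V) (r := l) hc hm hmc hcm hDm
      (by rwa [abs_of_pos hl]) j1 j2
    have h2 := sum_exp_binSum_le (ι := ι) (V := V) (r := -l) hc hm hmc hcm hDm
      (by rwa [abs_neg, abs_of_pos hl]) j1 j2
    rw [neg_sq] at h2
    rw [two_mul (F * X)]
    refine le_trans (le_of_eq ?_) (mul_le_mul_of_nonneg_right (add_le_add h1 h2)
      (Real.exp_pos _).le)
    simp_rw [← sum_add_distrib, sum_mul]
    refine sum_congr rfl fun t _ => sum_congr rfl fun h _ => ?_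
    rw [Real.cosh_eq]
    simp only [one_pow, mul_one, neg_mul]
    ring
  have hcard : ∀ k : ℕ, ((Icc k D).card : ℝ) ≤ D + 1 := fun k => by
    rw [Nat.card_Icc]; exact_mod_cast Nat.sub_le _ _
  calc _ = ∑ j1 ∈ Icc k1 D, ∑ j2 ∈ Icc k2 D, ∑ t : ι → V, ∑ h : ι → V,
      2 * Real.cosh (l * (binSum (lowDegree D h t) h t univ univ j1 j2 -
        Fintype.card V * poiMoment D c j1 * poiMoment D c j2 * 1 ^ j1 * 1 ^ j2)) * Y := by
        unfold potential
        simp_rw [card_univ]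
        rw [sum_congr rfl fun t _ => sum_comm, sum_comm]
        refine sum_congr rfl fun j1 _ => ?_
        rw [sum_congr rfl fun t _ => sum_comm, sum_comm]
    _ ≤ ∑ j1 ∈ Icc k1 D, ∑ j2 ∈ Icc k2 D, 2 * (F * X) * Y :=
        sum_le_sum fun j1 _ => sum_le_sum fun j2 _ => key j1 j2
    _ = (Icc k1 D).card * ((Icc k2 D).card * (2 * (F * X) * Y)) := by
        simp only [sum_const, nsmul_eq_mul]
    _ ≤ (D + 1) * ((D + 1) * (2 * (F * X) * Y)) := by
        have hp : 0 ≤ 2 * (F * X) * Y := by positivity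
        gcongr
        · exact hcard _
        · exact hcard _
    _ = _ := by
        rw [add_sub_assoc, Real.exp_add]; ring

lemma card_badPairs_le {n m : ℝ} (P : PeelParams k1 k2 D c c' zs1 zs2 e g ε l κ μ n m)
    (hn : n = Fintype.card V) (hm : m = Fintype.card ι) (hm1 : 1 ≤ Fintype.card ι)
    (hDm : D ≤ Fintype.card ι) :
    ((badPairs ι V k1 k2 c c' zs1 zs2).card : ℝ) ≤
      poiFactor (Fintype.card V) (Fintype.card ι) *
        (Real.exp ((2 * Real.exp ((Real.exp 1 - 1) * c) ^ 2 * pPoi (D + 1) (Real.exp 1 * c) -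
          e / 3) * n) +
        2 * (D + 1) ^ 2 * Real.exp (l ^ 2 * (4 ^ D) ^ 2 * n + κ * m - l * (ε * n))) := by
  classical
  have hmc := P.hmc
  have hcm := P.hcm
  rw [hn, hm] at hmc hcm
  have hT := sum_exp_tail_le (ι := ι) (V := V) P.hc hm1 hmc hcm hDm
  have hP := sum_potential_univ_le (ι := ι) (V := V) (k1 := k1) (k2 := k2) (κ := κ) P.hc hm1 hmc hcm
    hDm P.hl P.hl4 (l * (ε * n))
  set tail : (ι → V) → (ι → V) → ℝ := fun t h => ∑ v ∈ (lowDegree D h t)ᶜ,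
    (fiberCount h univ v + fiberCount t univ v : ℝ) with htail
  set pot : (ι → V) → (ι → V) → ℝ := fun t h => potential k1 k2 D l κ (l * (ε * n))
    (Fintype.card V) (poiMoment D c) (lowDegree D h t) h t univ univ 1 1 with hpot
  have hfac : (0 : ℝ) < (Fintype.card ι).factorial := by exact_mod_cast Nat.factorial_pos _
  have hperm : ∀ t h : ι → V, ((univ.filter fun π : Equiv.Perm ι =>
      (t, h ∘ π) ∈ badPairs ι V k1 k2 c c' zs1 zs2).card : ℝ) ≤
      (Fintype.card ι).factorial * (Real.exp (tail t h - e / 3 * n) + pot t h) := by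
    intro t h
    have hpot0 : 0 ≤ pot t h := potential_nonneg
    by_cases hth : tail t h ≤ e / 3 * n
    · have := card_bad_perm_le P hm t h hth
        (fun π I => ¬ CoreEdgesOk k1 k2 c c' zs1 zs2 n m (coreEdges k1 k2 t (h ∘ π) I))
        (fun _ _ => Iff.rfl)
      have h2 : (Fintype.card ι).factorial * pot t h ≤
          (Fintype.card ι).factorial * (Real.exp (tail t h - e / 3 * n) + pot t h) := by
        refine mul_le_mul_of_nonneg_left ?_ hfac.le
        have := (Real.exp_pos (tail t h - e / 3 * n)).le
        linarith
      refine le_trans (le_of_eq ?_) (this.trans (le_trans (le_of_eq ?_) h2))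
      · simp [badPairs, hn, hm]
      · simp only [hpot, hn]
    · calc ((univ.filter fun π : Equiv.Perm ι =>
          (t, h ∘ π) ∈ badPairs ι V k1 k2 c c' zs1 zs2).card : ℝ)
          ≤ (univ : Finset (Equiv.Perm ι)).card := by exact_mod_cast card_filter_le _ _
        _ = (Fintype.card ι).factorial * 1 := by rw [card_univ, Fintype.card_perm, mul_one]
        _ ≤ _ := by
          refine mul_le_mul_of_nonneg_left ?_ hfac.le
          have := Real.add_one_le_exp (tail t h - e / 3 * n)
          linarith
  have havg : (Fintype.card ι).factorial * ((badPairs ι V k1 k2 c c' zs1 zs2).card : ℝ) =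
      ∑ t : ι → V, ∑ h : ι → V, ((univ.filter fun π : Equiv.Perm ι =>
        (t, h ∘ π) ∈ badPairs ι V k1 k2 c c' zs1 zs2).card : ℝ) := by
    have h1 : ∀ π : Equiv.Perm ι, ∑ t : ι → V, ∑ h : ι → V,
        (if (t, h ∘ π) ∈ badPairs ι V k1 k2 c c' zs1 zs2 then (1 : ℝ) else 0) =
        (badPairs ι V k1 k2 c c' zs1 zs2).card := by
      intro π
      have : ∀ t : ι → V, ∑ h : ι → V,
          (if (t, h ∘ π) ∈ badPairs ι V k1 k2 c c' zs1 zs2 then (1 : ℝ) else 0) =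
          ∑ h : ι → V, (if (t, h) ∈ badPairs ι V k1 k2 c c' zs1 zs2 then (1 : ℝ) else 0) :=
        fun t => Fintype.sum_equiv (Equiv.arrowCongr π.symm (Equiv.refl V)) _ _ fun h => by
          simp [Equiv.arrowCongr, Function.comp_def]
      rw [sum_congr rfl fun t _ => this t, ← Fintype.sum_prod_type', sum_boole]
      simp
    calc _ = ∑ π : Equiv.Perm ι, ((badPairs ι V k1 k2 c c' zs1 zs2).card : ℝ) := by
          rw [sum_const, card_univ, Fintype.card_perm, nsmul_eq_mul]
      _ = ∑ π : Equiv.Perm ι, ∑ t : ι → V, ∑ h : ι → V,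
        (if (t, h ∘ π) ∈ badPairs ι V k1 k2 c c' zs1 zs2 then (1 : ℝ) else 0) :=
          sum_congr rfl fun π _ => (h1 π).symm
      _ = _ := by
        rw [sum_comm]
        refine sum_congr rfl fun t _ => ?_
        rw [sum_comm]
        refine sum_congr rfl fun h _ => ?_
        rw [sum_boole]
  refine le_of_mul_le_mul_left ?_ hfac
  rw [havg]
  refine (sum_le_sum fun t _ => sum_le_sum fun h _ => hperm t h).trans ?_
  simp_rw [← mul_sum, sum_add_distrib]
  refine mul_le_mul_of_nonneg_left ?_ hfac.le
  rw [mul_add]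
  refine add_le_add ?_ ?_
  · simp_rw [Real.exp_sub, ← sum_div]
    rw [div_le_iff₀ (Real.exp_pos _)]
    refine hT.trans (le_of_eq ?_)
    rw [mul_assoc (poiFactor _ _), ← Real.exp_add, hn]
    congr 2
    ring
  · rw [hn, hm]
    rw [hn] at hP
    simp only [hpot]
    rw [hn]
    exact hP

end Master

set_option maxHeartbeats 1000000 in
/-- Above the threshold the number of core edges is typical with exponentially high probability. -/
theorem exists_card_badPairs_le (k1 k2 : ℕ) (hk1 : 1 ≤ k1) (hk2 : 1 ≤ k2) {c c' zs1 zs2 : ℝ}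
    (hc : 0 < c) (hcc : c < c') (hzs1 : 0 < zs1) (hzs2 : 0 < zs2)
    (h1 : zs1 < c * coreF k1 k2 zs1 zs2) (h2 : zs2 < c * coreF k2 k1 zs2 zs1) :
    ∃ δ : ℝ, 0 < δ ∧ ∃ n0 : ℕ, ∀ (ι V : Type) [Fintype ι] [DecidableEq ι] [Fintype V]
      [DecidableEq V], n0 ≤ Fintype.card V → Fintype.card ι = ⌊c * Fintype.card V⌋₊ →
      ((badPairs ι V k1 k2 c c' zs1 zs2).card : ℝ) ≤
        Real.exp (-δ * Fintype.card V) *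
          ((Fintype.card V : ℝ) ^ Fintype.card ι) ^ 2 := by
  have hF1 := coreF_pos k1 k2 hzs1 hzs2
  have hF2 := coreF_pos k2 k1 hzs2 hzs1
  set F1 := coreF k1 k2 zs1 zs2
  set F2 := coreF k2 k1 zs2 zs1
  have hcc0 : 0 < c' - c := sub_pos.2 hcc
  obtain ⟨g, hg, hg1, hg2⟩ : ∃ g : ℝ, 0 < g ∧ g ≤ (c * F1 - zs1) / 2 ∧ g ≤ (c * F2 - zs2) / 2 :=
    ⟨min ((c * F1 - zs1) / 2) ((c * F2 - zs2) / 2), lt_min (by linarith) (by linarith),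
      min_le_left _ _, min_le_right _ _⟩
  obtain ⟨e, he, he1, he2, he3, he4⟩ : ∃ e : ℝ, 0 < e ∧ e ≤ g * zs2 / c ∧ e ≤ g * zs1 / c ∧
      e ≤ (c' - c) * F1 / 2 * zs2 / c ∧ e ≤ (c' - c) * F2 / 2 * zs1 / c := by
    refine ⟨min (min (g * zs2 / c) (g * zs1 / c))
      (min ((c' - c) * F1 / 2 * zs2 / c) ((c' - c) * F2 / 2 * zs1 / c)), ?_, ?_, ?_, ?_, ?_⟩
    · exact lt_min (lt_min (by positivity) (by positivity)) (lt_min (by positivity) (by positivity))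
    · exact (min_le_left _ _).trans (min_le_left _ _)
    · exact (min_le_left _ _).trans (min_le_right _ _)
    · exact (min_le_right _ _).trans (min_le_left _ _)
    · exact (min_le_right _ _).trans (min_le_right _ _)
  have hconv : ∀ {x z : ℝ}, 0 < z → e ≤ x * z / c → c * e / z ≤ x := by
    intro x z hz hx
    rw [div_le_iff₀ hz]
    rw [le_div_iff₀ hc] at hx
    linarith
  have hη : 0 < e / (3 * (c + 1)) := by positivity
  obtain ⟨D1, hD1⟩ := exists_thinPoi_approx hc.le k1 hk1 hη
  obtain ⟨D2, hD2⟩ := exists_thinPoi_approx hc.le k2 hk2 hη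
  set K : ℝ := 2 * Real.exp ((Real.exp 1 - 1) * c) ^ 2 with hK
  have hK0 : 0 < K := by positivity
  obtain ⟨D3, hD3⟩ := eventually_atTop.1 ((tendsto_pPoi_atTop (Real.exp 1 * c)).eventually
    (gt_mem_nhds (show (0 : ℝ) < e / 6 / K by positivity)))
  obtain ⟨D, hthin1, hthin2, hDK⟩ : ∃ D : ℕ, ThinApprox D c (e / (3 * (c + 1))) k1 ∧
      ThinApprox D c (e / (3 * (c + 1))) k2 ∧ K * pPoi (D + 1) (Real.exp 1 * c) ≤ e / 6 := by
    refine ⟨2 * (D1 + D2 + D3), hD1 _ (by omega), hD2 _ (by omega), ?_⟩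
    have := hD3 (2 * (D1 + D2 + D3) + 1) (by omega)
    rw [lt_div_iff₀ hK0] at this
    linarith
  have hH0 : 0 ≤ heavyConst D := by unfold heavyConst; positivity
  obtain ⟨ε, hε, hεH⟩ : ∃ ε : ℝ, 0 < ε ∧ heavyConst D * ε ≤ e / 3 := by
    refine ⟨e / (3 * (heavyConst D + 1)), by positivity, ?_⟩
    rw [mul_div_assoc', div_le_div_iff₀ (by positivity) (by norm_num)]
    nlinarith
  set A : ℝ := 4 ^ D with hA
  have hA0 : 0 < A := by positivity
  obtain ⟨l, hl, hl1, hl2⟩ : ∃ l : ℝ, 0 < l ∧ l * A ≤ 1 ∧ l * (A ^ 2 * (1 + 2 * c)) ≤ ε / 2 := by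
    refine ⟨min (1 / A) (ε / 2 / (A ^ 2 * (1 + 2 * c))), lt_min (by positivity) (by positivity),
      ?_, ?_⟩
    · rw [← le_div_iff₀ hA0]; exact min_le_left _ _
    · rw [← le_div_iff₀ (by positivity)]; exact min_le_right _ _
  set a : ℝ := zs1 * zs2 / c ^ 2 with ha
  have ha0 : 0 < a := by positivity
  obtain ⟨δ, hδ, hδ1, hδ2⟩ : ∃ δ : ℝ, 0 < δ ∧ 2 * δ ≤ e / 6 ∧ 2 * δ ≤ l * ε / 2 :=
    ⟨min (e / 6) (l * ε / 2) / 2, half_pos (lt_min (by positivity) (by positivity)),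
      by rw [mul_div_cancel₀ _ two_ne_zero]; exact min_le_left _ _,
      by rw [mul_div_cancel₀ _ two_ne_zero]; exact min_le_right _ _⟩
  have hlin : ∀ x b : ℝ, 0 < x → ∀ᶠ n : ℕ in atTop, b ≤ x * n := fun x b hx =>
    (tendsto_natCast_atTop_atTop.const_mul_atTop hx).eventually_ge_atTop b
  have hexp : ∀ᶠ n : ℕ in atTop, Real.exp 4 * c ^ 2 * (1 + 2 * (D + 1) ^ 2) *
      ((n : ℝ) ^ 2 * Real.exp (-(δ * n))) ≤ 1 := by
    have h := ((Real.tendsto_pow_mul_exp_neg_atTop_nhds_zero 2).comp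
      (tendsto_natCast_atTop_atTop.const_mul_atTop hδ)).const_mul
        (Real.exp 4 * c ^ 2 * (1 + 2 * (D + 1) ^ 2) / δ ^ 2)
    rw [mul_zero] at h
    filter_upwards [h.eventually (ge_mem_nhds one_pos)] with n hn
    refine le_trans (le_of_eq ?_) hn
    simp only [Function.comp]
    field_simp
  obtain ⟨n0, hn0⟩ := eventually_atTop.1 ((hlin c 2 hc).and ((hlin (c / 2) D (by positivity)).and
    ((hlin (c / 2 * a) 1 (by positivity)).and ((hlin (c / 2 * a) D (by positivity)).and
    ((hlin (g * (c / 2 * a)) c (by positivity)).and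
    ((hlin ((c' - c) * F1 / 2) 1 (by positivity)).and
    ((hlin ((c' - c) * F2 / 2) 1 (by positivity)).and
    ((hlin (l * A ^ 2 * (c / 2 * a) ^ 2) (A * D ^ 2) (by positivity)).and hexp))))))))
  refine ⟨δ, hδ, n0, fun ι V _ _ _ _ hV hι => ?_⟩
  obtain ⟨n1, n2, n3, n4, n5, n6, n7, n8, n9⟩ := hn0 _ hV
  set n : ℝ := (Fintype.card V : ℝ) with hn
  set m : ℝ := (Fintype.card ι : ℝ) with hm
  have hnpos : 0 < n := by
    by_contra h
    linarith [mul_nonpos_of_nonneg_of_nonpos hc.le (not_lt.1 h)]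
  have hmc : m ≤ c * n := by
    rw [hm, hι]; exact Nat.floor_le (by positivity)
  have hcm : c * n ≤ m + 1 := by
    rw [hm, hι]; exact (Nat.lt_floor_add_one _).le
  have hm2 : c / 2 * n ≤ m := by linarith
  have hμ : c / 2 * a * n ≤ m * a := by
    have := mul_le_mul_of_nonneg_right hm2 ha0.le
    linarith
  have hμ1 : 1 ≤ m * a := n3.trans hμ
  have hinv : ∀ {x : ℝ}, 1 ≤ x * n → 1 / n ≤ x := fun hx => by rwa [div_le_iff₀ hnpos]
  have P : PeelParams k1 k2 D c c' zs1 zs2 e g ε l (2 * (l ^ 2 * A ^ 2)) (m * a) n m :=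
    { hc := hc, hcc := hcc.le, hzs1 := hzs1, hzs2 := hzs2, he := he, hε := hε, hl := hl, hn := hnpos
      hmc := hmc, hcm := hcm
      gap1 := by linarith [hconv hzs2 he1]
      gap2 := by linarith [hconv hzs1 he2]
      slack1 := by linarith [hconv hzs2 he3, hinv n6]
      slack2 := by linarith [hconv hzs1 he4, hinv n7]
      thin1 := hthin1, thin2 := hthin2, dev := hεH, hμ := le_rfl, hμ1 := hμ1
      hμD := n4.trans hμ
      hμg := n5.trans (by linarith [mul_le_mul_of_nonneg_left hμ hg.le])
      hl4 := hl1
      hκ := by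
        have h3 : n * A * (D / (m * a)) ^ 2 ≤ l * A ^ 2 := by
          rw [div_pow, mul_div_assoc', div_le_iff₀ (by positivity)]
          have h4 : (c / 2 * a * n) ^ 2 ≤ (m * a) ^ 2 := pow_le_pow_left₀ (by positivity) hμ 2
          calc n * A * (D : ℝ) ^ 2 = n * (A * D ^ 2) := by ring
            _ ≤ n * (l * A ^ 2 * (c / 2 * a) ^ 2 * n) := mul_le_mul_of_nonneg_left n8 hnpos.le
            _ = l * A ^ 2 * (c / 2 * a * n) ^ 2 := by ring
            _ ≤ _ := mul_le_mul_of_nonneg_left h4 (by positivity)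
        have := mul_le_mul_of_nonneg_left h3 hl.le
        linarith }
  have hm1 : 1 ≤ Fintype.card ι := by
    have : (1 : ℝ) ≤ m := by linarith
    rw [hm] at this; exact_mod_cast this
  have hDm : D ≤ Fintype.card ι := by
    have : (D : ℝ) ≤ m := n2.trans hm2
    rw [hm] at this; exact_mod_cast this
  have hbad := card_badPairs_le (ι := ι) (V := V) P hn hm hm1 hDm
  rw [← hK] at hbad
  have e1 : Real.exp ((K * pPoi (D + 1) (Real.exp 1 * c) - e / 3) * n) ≤ Real.exp (-(2 * δ * n)) := by
    refine Real.exp_le_exp.2 ?_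
    have := mul_le_mul_of_nonneg_right (show K * pPoi (D + 1) (Real.exp 1 * c) - e / 3 ≤ -(2 * δ) by
      linarith) hnpos.le
    linarith
  have e2 : Real.exp (l ^ 2 * (4 ^ D) ^ 2 * n + 2 * (l ^ 2 * A ^ 2) * m - l * (ε * n)) ≤
      Real.exp (-(2 * δ * n)) := by
    refine Real.exp_le_exp.2 ?_
    rw [← hA]
    have h5 : l ^ 2 * A ^ 2 * n + 2 * (l ^ 2 * A ^ 2) * m ≤
        l * n * (l * (A ^ 2 * (1 + 2 * c))) := by
      have := mul_le_mul_of_nonneg_left hmc (show 0 ≤ 2 * (l ^ 2 * A ^ 2) by positivity)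
      linarith
    have h6 := mul_le_mul_of_nonneg_left hl2 (show 0 ≤ l * n by positivity)
    have h7 := mul_le_mul_of_nonneg_right hδ2 hnpos.le
    linarith
  have hx : Real.exp (-(2 * δ * n)) = Real.exp (-(δ * n)) * Real.exp (-δ * n) := by
    rw [← Real.exp_add]; congr 1; ring
  have hfac : poiFactor (Fintype.card V) (Fintype.card ι) =
      Real.exp 4 * m ^ 2 * (n ^ Fintype.card ι) ^ 2 := by
    unfold poiFactor
    rw [mul_pow, mul_pow, ← Real.exp_nat_mul, show ((2 : ℕ) : ℝ) * 2 = 4 by norm_num]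
  refine hbad.trans ?_
  rw [hfac]
  calc _ ≤ Real.exp 4 * (c * n) ^ 2 * (n ^ Fintype.card ι) ^ 2 *
        (Real.exp (-(2 * δ * n)) + 2 * (D + 1) ^ 2 * Real.exp (-(2 * δ * n))) := by
        gcongr
    _ = (Real.exp 4 * c ^ 2 * (1 + 2 * (D + 1) ^ 2) * (n ^ 2 * Real.exp (-(δ * n)))) *
        (Real.exp (-δ * n) * (n ^ Fintype.card ι) ^ 2) := by
        rw [hx]; ring
    _ ≤ 1 * (Real.exp (-δ * n) * (n ^ Fintype.card ι) ^ 2) :=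
        mul_le_mul_of_nonneg_right n9 (by positivity)
    _ = _ := one_mul _

section SmallSets

/-- Some small vertex set `A` spans, together with a set `T` of fewer than `k` vertices, at least
`k |A|` edges going from `A` to `A ∪ T`. -/
def DenseSmall {ι V : Type*} [Fintype ι] [Fintype V] [DecidableEq V] (k : ℕ) (ε : ℝ)
    (t h : ι → V) : Prop :=
  ∃ A T : Finset V, 2 ≤ A.card ∧ (A.card : ℝ) ≤ ε * Fintype.card V ∧ T.card < k ∧
    k * A.card ≤ (univ.filter fun i => t i ∈ A ∧ h i ∈ A ∪ T).card

lemma choose_le_exp_mul_div_pow (n a : ℕ) (ha : 1 ≤ a) :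
    (n.choose a : ℝ) ≤ (Real.exp 1 * n / a) ^ a := by
  have ha' : (0 : ℝ) < a := by exact_mod_cast ha
  have h1 := Real.pow_div_factorial_le_exp (a : ℝ) ha'.le a
  have h2 : (n.choose a : ℝ) ≤ (n : ℝ) ^ a / a.factorial := Nat.choose_le_pow_div a n
  have hf : (0 : ℝ) < a.factorial := by exact_mod_cast Nat.factorial_pos a
  refine h2.trans ?_
  rw [div_pow, mul_pow, ← Real.exp_nat_mul, mul_one, div_le_div_iff₀ hf (by positivity)]
  rw [div_le_iff₀ hf] at h1
  have := mul_le_mul_of_nonneg_left h1 (show (0 : ℝ) ≤ (n : ℝ) ^ a by positivity)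
  linarith

variable {ι V : Type*} [Fintype ι] [DecidableEq ι] [Fintype V] [DecidableEq V]

lemma card_filter_forall_mem (J : Finset ι) (A : Finset V) :
    (univ.filter fun t : ι → V => ∀ i ∈ J, t i ∈ A).card =
      A.card ^ J.card * Fintype.card V ^ (Fintype.card ι - J.card) := by
  have : (univ.filter fun t : ι → V => ∀ i ∈ J, t i ∈ A) =
      Fintype.piFinset fun i => if i ∈ J then A else univ := by
    ext t
    simp only [mem_filter, mem_univ, true_and, Fintype.mem_piFinset]
    refine forall_congr' fun i => ?_
    by_cases hi : i ∈ J <;> simp [hi]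
  rw [this, Fintype.card_piFinset]
  simp_rw [apply_ite card]
  rw [prod_ite, prod_const, prod_const, card_univ, filter_mem_eq_inter, univ_inter]
  congr 2
  rw [filter_notMem_eq_sdiff, card_sdiff_of_subset (subset_univ _), card_univ]

lemma card_pairs_filter_forall_mem (J : Finset ι) (A B : Finset V) :
    (univ.filter fun p : (ι → V) × (ι → V) => ∀ i ∈ J, p.1 i ∈ A ∧ p.2 i ∈ B).card =
      (A.card * B.card) ^ J.card * (Fintype.card V ^ (Fintype.card ι - J.card)) ^ 2 := by
  have : (univ.filter fun p : (ι → V) × (ι → V) => ∀ i ∈ J, p.1 i ∈ A ∧ p.2 i ∈ B) =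
      (univ.filter fun t : ι → V => ∀ i ∈ J, t i ∈ A) ×ˢ
        (univ.filter fun t : ι → V => ∀ i ∈ J, t i ∈ B) := by
    ext p
    simp [forall_and]
  rw [this, card_product, card_filter_forall_mem, card_filter_forall_mem]
  ring

/-- The pairs of sequences having a dense small set of size `a`. -/
def densePairs (ι V : Type*) [Fintype ι] [DecidableEq ι] [Fintype V] [DecidableEq V] (k a : ℕ) :
    Finset ((ι → V) × (ι → V)) :=
  (powersetCard a univ).biUnion fun A => (univ : Finset (Fin (k - 1) → V)).biUnion fun s =>
    (powersetCard (k * a) (univ : Finset ι)).biUnion fun J =>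
      univ.filter fun p => ∀ i ∈ J, p.1 i ∈ A ∧ p.2 i ∈ A ∪ univ.image s

lemma card_densePairs_le {k a : ℕ} (hk : 1 ≤ k) (ha : 1 ≤ a) {c : ℝ} (hc : 0 < c)
    (hV : 1 ≤ Fintype.card V) (hm : (Fintype.card ι : ℝ) ≤ c * Fintype.card V) :
    ((densePairs ι V k a).card : ℝ) ≤ (Fintype.card V : ℝ) ^ (k - 1) *
      (Real.exp 1 * (Real.exp 1 * c) ^ k * (a / Fintype.card V) ^ (k - 1)) ^ a *
      ((Fintype.card V : ℝ) ^ Fintype.card ι) ^ 2 := by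
  set n := Fintype.card V with hn
  set m := Fintype.card ι with hmdef
  have hn0 : (0 : ℝ) < n := by exact_mod_cast hV
  have ha0 : (0 : ℝ) < a := by exact_mod_cast ha
  have hk0 : (0 : ℝ) < k := by exact_mod_cast hk
  have hcard : (densePairs ι V k a).card ≤ n.choose a * (n ^ (k - 1) * (m.choose (k * a) *
      ((a * (a + (k - 1))) ^ (k * a) * (n ^ (m - k * a)) ^ 2))) := by
    unfold densePairs
    refine (card_biUnion_le_card_mul _ _ _ fun A hA => ?_).trans
      (by rw [card_powersetCard, card_univ])
    refine (card_biUnion_le_card_mul _ _ _ fun s _ => ?_).trans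
      (by rw [card_univ, Fintype.card_fun, Fintype.card_fin])
    refine (card_biUnion_le_card_mul _ _ _ fun J hJ => ?_).trans
      (by rw [card_powersetCard, card_univ])
    rw [card_pairs_filter_forall_mem, (mem_powersetCard.1 hJ).2, (mem_powersetCard.1 hA).2]
    gcongr
    refine (card_union_le _ _).trans ?_
    rw [(mem_powersetCard.1 hA).2]
    have := card_image_le (s := (univ : Finset (Fin (k - 1)))) (f := s)
    rw [card_univ, Fintype.card_fin] at this
    omega
  rcases lt_or_ge m (k * a) with hlt | hle
  · rw [Nat.choose_eq_zero_of_lt hlt, zero_mul, mul_zero, mul_zero] at hcard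
    rw [Nat.le_zero.1 hcard]
    push_cast
    positivity
  have hcard' : ((densePairs ι V k a).card : ℝ) ≤ n.choose a * (n ^ (k - 1) * (m.choose (k * a) *
      ((a * (a + (k - 1 : ℕ))) ^ (k * a) * (n ^ (m - k * a)) ^ 2))) := by exact_mod_cast hcard
  have h1 := choose_le_exp_mul_div_pow n a ha
  have h2 : (m.choose (k * a) : ℝ) ≤ (Real.exp 1 * (c * n) / (k * a)) ^ (k * a) := by
    refine (choose_le_exp_mul_div_pow m (k * a) (Nat.mul_pos hk ha)).trans ?_
    push_cast
    gcongr
  have h3 : (a * (a + (k - 1 : ℕ)) : ℝ) ≤ k * a ^ 2 := by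
    have : a + (k - 1) ≤ k * a := by
      obtain ⟨k, rfl⟩ : ∃ l, k = l + 1 := ⟨k - 1, by omega⟩
      have : k ≤ k * a := Nat.le_mul_of_pos_right _ ha
      have : (k + 1) * a = k * a + a := by ring
      omega
    have h4 : (a + (k - 1 : ℕ) : ℝ) ≤ k * a := by exact_mod_cast this
    have := mul_le_mul_of_nonneg_left h4 ha0.le
    linarith
  have h5 : (n : ℝ) ^ (m - k * a) = (n : ℝ) ^ m / n ^ (k * a) := by
    rw [eq_div_iff (by positivity), ← pow_add, Nat.sub_add_cancel hle]
  refine hcard'.trans ?_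
  rw [h5]
  calc _ ≤ (Real.exp 1 * n / a) ^ a * (n ^ (k - 1) * ((Real.exp 1 * (c * n) / (k * a)) ^ (k * a) *
      ((k * a ^ 2 : ℝ) ^ (k * a) * ((n : ℝ) ^ m / n ^ (k * a)) ^ 2))) := by
        gcongr
    _ = n ^ (k - 1) * ((Real.exp 1 * n / a) *
        (Real.exp 1 * (c * n) / (k * a) * (k * a ^ 2) / n ^ 2) ^ k) ^ a * ((n : ℝ) ^ m) ^ 2 := by
        rw [mul_pow, ← pow_mul, div_pow _ ((n : ℝ) ^ 2), mul_pow _ ((k : ℝ) * a ^ 2), ← pow_mul,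
          div_pow ((n : ℝ) ^ m), ← pow_mul (n : ℝ) (k * a), mul_comm (k * a) 2]
        ring
    _ = _ := by
        congr 3
        obtain ⟨k, rfl⟩ : ∃ l, k = l + 1 := ⟨k - 1, by omega⟩
        rw [Nat.add_sub_cancel]
        have : Real.exp 1 * (c * n) / ((k + 1 : ℕ) * a) * ((k + 1 : ℕ) * a ^ 2) / (n : ℝ) ^ 2 =
            Real.exp 1 * c * (a / n) := by field_simp
        rw [this, mul_pow, pow_succ ((a : ℝ) / n)]
        field_simp

lemma mem_densePairs [Nonempty V] {k : ℕ} {ε : ℝ} {t h : ι → V} (hk : 1 ≤ k)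
    (hd : DenseSmall k ε t h) :
    ∃ a : ℕ, 2 ≤ a ∧ (a : ℝ) ≤ ε * Fintype.card V ∧ (t, h) ∈ densePairs ι V k a := by
  obtain ⟨A, T, hA, hAε, hT, hAT⟩ := hd
  refine ⟨A.card, hA, hAε, ?_⟩
  obtain ⟨s, hs⟩ : ∃ s : Fin (k - 1) → V, T ⊆ univ.image s := by
    have hTk : T.card ≤ k - 1 := by omega
    rcases T.eq_empty_or_nonempty with rfl | ⟨v, hv⟩
    · exact ⟨fun _ => Classical.arbitrary V, empty_subset _⟩
    · refine ⟨fun i => if hi : i.1 < T.card then (T.equivFin.symm ⟨i.1, hi⟩).1 else v, ?_⟩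
      intro w hw
      have hlt := (T.equivFin ⟨w, hw⟩).2
      refine mem_image.2 ⟨⟨(T.equivFin ⟨w, hw⟩).1, hlt.trans_le hTk⟩, mem_univ _, ?_⟩
      simp
  obtain ⟨J, hJ, hJc⟩ := exists_subset_card_eq hAT
  simp only [densePairs, mem_biUnion, mem_powersetCard, mem_univ, true_and, mem_filter]
  refine ⟨A, ⟨subset_univ _, rfl⟩, s, J, ⟨subset_univ _, hJc⟩, fun i hi => ?_⟩
  have := (mem_filter.1 (hJ hi)).2
  exact ⟨this.1, union_subset_union_right hs this.2⟩

end SmallSets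

open Classical in
/-- Small dense sets are polynomially unlikely. -/
theorem exists_card_denseSmall_le (k : ℕ) (hk : 2 ≤ k) {c : ℝ} (hc : 0 < c) :
    ∃ ε : ℝ, 0 < ε ∧ ε ≤ 1 ∧ ∃ C : ℝ, 0 < C ∧ ∀ (ι V : Type) [Fintype ι] [DecidableEq ι]
      [Fintype V] [DecidableEq V], 1 ≤ Fintype.card V → (Fintype.card ι : ℝ) ≤ c * Fintype.card V →
      ((univ.filter fun p : (ι → V) × (ι → V) => DenseSmall k ε p.1 p.2).card : ℝ) *
        (Fintype.card V : ℝ) ^ (k - 1) ≤ C * ((Fintype.card V : ℝ) ^ Fintype.card ι) ^ 2 := by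
  set K : ℝ := Real.exp 1 * (Real.exp 1 * c) ^ k with hK
  have hK0 : 0 < K := by positivity
  obtain ⟨ε, hε, hε1, hεK⟩ : ∃ ε : ℝ, 0 < ε ∧ ε ≤ 1 ∧ K * ε ≤ 1 / 2 := by
    refine ⟨min 1 (1 / 2 / K), lt_min one_pos (by positivity), min_le_left _ _, ?_⟩
    rw [mul_comm, ← le_div_iff₀ hK0]
    exact min_le_right _ _
  have hsum : Summable fun a : ℕ => (a : ℝ) ^ (2 * (k - 1)) * (1 / 2) ^ a :=
    summable_pow_mul_geometric_of_norm_lt_one _ (by norm_num)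
  set S := ∑' a : ℕ, (a : ℝ) ^ (2 * (k - 1)) * (1 / 2) ^ a with hS
  have hS0 : 0 ≤ S := tsum_nonneg fun a => by positivity
  refine ⟨ε, hε, hε1, 4 * K ^ 2 * S + 1, by positivity, fun ι V _ _ _ _ hV hm => ?_⟩
  have : Nonempty V := Fintype.card_pos_iff.1 hV
  set n : ℝ := (Fintype.card V : ℝ) with hn
  have hn0 : 0 < n := by rw [hn]; exact_mod_cast hV
  set N := (n ^ Fintype.card ι) ^ 2 with hN
  have hN0 : 0 ≤ N := by positivity
  set R := (range (Fintype.card V + 1)).filter fun a : ℕ => 2 ≤ a ∧ (a : ℝ) ≤ ε * n with hR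
  have hsub : (univ.filter fun p : (ι → V) × (ι → V) => DenseSmall k ε p.1 p.2) ⊆
      R.biUnion fun a => densePairs ι V k a := by
    intro p hp
    obtain ⟨a, ha, ha1, hap⟩ := mem_densePairs (by omega) (mem_filter.1 hp).2
    refine mem_biUnion.2 ⟨a, mem_filter.2 ⟨mem_range.2 ?_, ha, ha1⟩, hap⟩
    have : (a : ℝ) ≤ n := ha1.trans (mul_le_of_le_one_left hn0.le hε1)
    rw [hn] at this
    exact Nat.lt_succ_of_le (by exact_mod_cast this)
  have hterm : ∀ a ∈ R, ((densePairs ι V k a).card : ℝ) * n ^ (k - 1) ≤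
      4 * K ^ 2 * ((a : ℝ) ^ (2 * (k - 1)) * (1 / 2) ^ a) * N := by
    intro a ha
    obtain ⟨-, ha2, haε⟩ := mem_filter.1 ha
    have h1 := card_densePairs_le (ι := ι) (V := V) (k := k) (by omega) (show 1 ≤ a by omega) hc hV hm
    rw [← hK, ← hn, ← hN] at h1
    set x : ℝ := a / n with hx
    have hx0 : 0 ≤ x := by positivity
    have hxε : x ≤ ε := by rwa [hx, div_le_iff₀ hn0]
    have hy : K * x ^ (k - 1) ≤ 1 / 2 := by
      refine le_trans ?_ hεK
      gcongr
      calc x ^ (k - 1) ≤ x ^ 1 := pow_le_pow_of_le_one hx0 (hxε.trans hε1) (by omega)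
        _ ≤ ε := by rwa [pow_one]
    have hya : (K * x ^ (k - 1)) ^ a ≤ (K * x ^ (k - 1)) ^ 2 * (4 * (1 / 2) ^ a) := by
      obtain ⟨b, rfl⟩ := Nat.exists_eq_add_of_le ha2
      rw [pow_add, pow_add]
      have : (4 : ℝ) * ((1 / 2) ^ 2 * (1 / 2) ^ b) = (1 / 2) ^ b := by ring
      rw [this]
      gcongr
    calc _ ≤ n ^ (k - 1) * (K * x ^ (k - 1)) ^ a * N * n ^ (k - 1) := by gcongr
      _ ≤ n ^ (k - 1) * ((K * x ^ (k - 1)) ^ 2 * (4 * (1 / 2) ^ a)) * N * n ^ (k - 1) := by gcongr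
      _ = 4 * K ^ 2 * ((n * x) ^ (k - 1) * (n * x) ^ (k - 1) * (1 / 2) ^ a) * N := by
        rw [mul_pow n x]; ring
      _ = _ := by
        rw [hx, mul_div_cancel₀ _ hn0.ne', ← pow_add, two_mul]
  calc _ ≤ (∑ a ∈ R, ((densePairs ι V k a).card : ℝ)) * n ^ (k - 1) := by
        gcongr
        exact_mod_cast (card_le_card hsub).trans card_biUnion_le
    _ = ∑ a ∈ R, ((densePairs ι V k a).card : ℝ) * n ^ (k - 1) := sum_mul _ _ _
    _ ≤ ∑ a ∈ R, 4 * K ^ 2 * ((a : ℝ) ^ (2 * (k - 1)) * (1 / 2) ^ a) * N := sum_le_sum hterm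
    _ = 4 * K ^ 2 * (∑ a ∈ R, (a : ℝ) ^ (2 * (k - 1)) * (1 / 2) ^ a) * N := by
        rw [mul_sum, sum_mul]
    _ ≤ 4 * K ^ 2 * S * N := by
        gcongr
        exact hsum.sum_le_tsum _ fun a _ => by positivity
    _ ≤ _ := by nlinarith

section Reach

variable {ι V : Type*} [Fintype ι] [DecidableEq ι] [Fintype V] [DecidableEq V]

/-- A step along an edge of the multidigraph `(t i, h i)` inside `W`. -/
def SeqStep (t h : ι → V) (W : Finset V) (a b : V) : Prop :=
  a ∈ W ∧ b ∈ W ∧ ∃ i, t i = a ∧ h i = b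

open Classical in
/-- The vertices reachable from `u` inside `W`. -/
noncomputable def seqReach (t h : ι → V) (W : Finset V) (u : V) : Finset V :=
  univ.filter fun v => Relation.ReflTransGen (SeqStep t h W) u v

variable {t h : ι → V} {W S T : Finset V} {u v : V} {k k1 k2 : ℕ} {ε : ℝ}

lemma mem_seqReach : v ∈ seqReach t h W u ↔ Relation.ReflTransGen (SeqStep t h W) u v := by
  classical
  simp [seqReach]

lemma seqReach_subset (hu : u ∈ W) : seqReach t h W u ⊆ W := fun v hv => by
  induction mem_seqReach.1 hv with
  | refl => exact hu
  | tail _ h _ => exact h.2.1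

lemma mem_seqReach_of_edge (hu : u ∈ W) {i : ι} (hi : t i ∈ seqReach t h W u) (hW : h i ∈ W) :
    h i ∈ seqReach t h W u :=
  mem_seqReach.2 ((mem_seqReach.1 hi).tail ⟨seqReach_subset hu hi, hW, i, rfl, rfl⟩)

lemma reflTransGen_seqStep_swap :
    Relation.ReflTransGen (SeqStep h t W) v u ↔ Relation.ReflTransGen (SeqStep t h W) u v := by
  rw [← Relation.reflTransGen_swap]
  have : Function.swap (SeqStep h t W) = SeqStep t h W := by
    ext a b
    simp only [Function.swap, SeqStep]
    constructor
    · rintro ⟨ha, hb, i, hi, hi'⟩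
      exact ⟨hb, ha, i, hi', hi⟩
    · rintro ⟨ha, hb, i, hi, hi'⟩
      exact ⟨hb, ha, i, hi', hi⟩
  rw [this]

lemma SeqDeg.swap {I : Finset ι} (hS : SeqDeg k1 k2 t h I S) : SeqDeg k2 k1 h t I S :=
  fun v hv => (hS v hv).symm

lemma seqCore_swap (k1 k2 : ℕ) (t h : ι → V) (I : Finset ι) :
    seqCore k2 k1 h t I = seqCore k1 k2 t h I :=
  (seqDeg_seqCore k2 k1 h t I).swap.subset_seqCore.antisymm
    (seqDeg_seqCore k1 k2 t h I).swap.subset_seqCore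

lemma mul_card_le_card_edges (hS : SeqDeg k1 k2 t h univ S) {A : Finset V} (hA : A ⊆ S) :
    k2 * A.card ≤ (univ.filter fun i => t i ∈ A ∧ h i ∈ S).card := by
  have : (univ.filter fun i => t i ∈ A ∧ h i ∈ S).card =
      ∑ a ∈ A, ((univ.filter fun i => t i ∈ A ∧ h i ∈ S).filter fun i => t i = a).card :=
    card_eq_sum_card_fiberwise fun i hi => (mem_filter.1 hi).2.1
  rw [this, mul_comm, ← smul_eq_mul, ← sum_const]
  refine sum_le_sum fun a ha => (hS a (hA ha)).2.trans (card_le_card fun i hi => ?_)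
  obtain ⟨-, h1, h2⟩ := mem_filter.1 hi
  exact mem_filter.2 ⟨mem_filter.2 ⟨mem_univ _, h1 ▸ ha, h2⟩, h1⟩

lemma mul_card_seqReach_le (hS : SeqDeg k1 k2 t h univ S) (hu : u ∈ S \ T) :
    k2 * (seqReach t h (S \ T) u).card ≤ (univ.filter fun i =>
      t i ∈ seqReach t h (S \ T) u ∧ h i ∈ seqReach t h (S \ T) u ∪ T).card := by
  refine (mul_card_le_card_edges hS ((seqReach_subset hu).trans sdiff_subset)).trans
    (card_le_card fun i hi => ?_)
  obtain ⟨-, h1, h2⟩ := mem_filter.1 hi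
  refine mem_filter.2 ⟨mem_univ _, h1, ?_⟩
  by_cases hT : h i ∈ T
  · exact mem_union_right _ hT
  · exact mem_union_left _ (mem_seqReach_of_edge hu h1 (mem_sdiff.2 ⟨h2, hT⟩))

/-- In a simple digraph the out-neighbourhood of `u` in `S` has at least `k2` elements. -/
lemma le_card_image_head (hinj : Function.Injective fun i => (t i, h i))
    (hS : SeqDeg k1 k2 t h univ S) (hu : u ∈ S) :
    k2 ≤ ((univ.filter fun i => t i = u ∧ h i ∈ S).image h).card := by
  rw [card_image_of_injOn]
  · exact (hS u hu).2
  · intro i hi j hj hij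
    have hi' := (mem_filter.1 (mem_coe.1 hi)).2.1
    have hj' := (mem_filter.1 (mem_coe.1 hj)).2.1
    exact hinj (Prod.ext (hi'.trans hj'.symm) hij)

lemma lt_card_of_seqDeg (hinj : Function.Injective fun i => (t i, h i)) (hloop : ∀ i, t i ≠ h i)
    (hS : SeqDeg k1 k2 t h univ S) (hu : u ∈ S) : k2 < S.card := by
  refine (le_card_image_head hinj hS hu).trans_lt (card_lt_card ⟨?_, fun hsub => ?_⟩)
  · exact image_subset_iff.2 fun i hi => (mem_filter.1 hi).2.2
  · obtain ⟨i, hi, hiu⟩ := mem_image.1 (hsub hu)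
    exact hloop i ((mem_filter.1 hi).2.1.trans hiu.symm)

lemma two_le_card_seqReach (hinj : Function.Injective fun i => (t i, h i))
    (hloop : ∀ i, t i ≠ h i) (hS : SeqDeg k1 k2 t h univ S) (hT : T.card < k2) (hu : u ∈ S \ T) :
    2 ≤ (seqReach t h (S \ T) u).card := by
  have huS := (mem_sdiff.1 hu).1
  obtain ⟨x, hx, hxT⟩ : ∃ x ∈ (univ.filter fun i => t i = u ∧ h i ∈ S).image h, x ∉ T :=
    exists_mem_notMem_of_card_lt_card (hT.trans_le (le_card_image_head hinj hS huS))
  obtain ⟨i, hi, rfl⟩ := mem_image.1 hx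
  obtain ⟨-, hiu, hiS⟩ := mem_filter.1 hi
  have hu' : u ∈ seqReach t h (S \ T) u := mem_seqReach.2 .refl
  refine one_lt_card.2 ⟨u, hu', h i, ?_, fun heq => hloop i (hiu.trans heq)⟩
  exact mem_seqReach_of_edge hu (hiu ▸ hu') (mem_sdiff.2 ⟨hiS, hxT⟩)

lemma lt_card_seqReach (hinj : Function.Injective fun i => (t i, h i)) (hloop : ∀ i, t i ≠ h i)
    (hS : SeqDeg k1 k2 t h univ S) (hk : k ≤ k2) (hT : T.card < k) (hu : u ∈ S \ T)
    (hd : ¬ DenseSmall k ε t h) : ε * Fintype.card V < (seqReach t h (S \ T) u).card := by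
  by_contra hle
  exact hd ⟨_, T, two_le_card_seqReach hinj hloop hS (hT.trans_le hk) hu, not_lt.1 hle, hT,
    (Nat.mul_le_mul_right _ hk).trans (mul_card_seqReach_le hS hu)⟩

end Reach

section Sprinkling

variable {ι₁ ι₂ V : Type*} [Fintype ι₁] [DecidableEq ι₁] [Fintype ι₂] [DecidableEq ι₂] [Fintype V]
  [DecidableEq V] {t h : ι₁ ⊕ ι₂ → V} {S T : Finset V} {u v : V} {k k1 k2 : ℕ} {ε : ℝ}

lemma SeqDeg.of_inl (hS : SeqDeg k1 k2 (t ∘ Sum.inl) (h ∘ Sum.inl) univ S) :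
    SeqDeg k1 k2 t h univ S := by
  refine fun v hv => ⟨(hS v hv).1.trans ?_, (hS v hv).2.trans ?_⟩
  all_goals
    refine card_le_card_of_injOn Sum.inl (fun i hi => ?_) Sum.inl_injective.injOn
    have := (mem_filter.1 (mem_coe.1 hi)).2
    exact mem_coe.2 (mem_filter.2 ⟨mem_univ _, this⟩)

lemma seqCore_inl_subset (k1 k2 : ℕ) (t h : ι₁ ⊕ ι₂ → V) :
    seqCore k1 k2 (t ∘ Sum.inl) (h ∘ Sum.inl) univ ⊆ seqCore k1 k2 t h univ :=
  (seqDeg_seqCore _ _ _ _ _).of_inl.subset_seqCore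

lemma DenseSmall.of_inl (hd : DenseSmall k ε (t ∘ Sum.inl) (h ∘ Sum.inl)) : DenseSmall k ε t h := by
  obtain ⟨A, T, h1, h2, h3, h4⟩ := hd
  refine ⟨A, T, h1, h2, h3, h4.trans ?_⟩
  refine card_le_card_of_injOn Sum.inl (fun i hi => ?_) Sum.inl_injective.injOn
  exact mem_coe.2 (mem_filter.2 ⟨mem_univ _, (mem_filter.1 (mem_coe.1 hi)).2⟩)

lemma coreEdges_swap {ι : Type*} [Fintype ι] [DecidableEq ι] (k1 k2 : ℕ) (t h : ι → V)
    (I : Finset ι) : coreEdges k2 k1 h t I = coreEdges k1 k2 t h I := by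
  unfold coreEdges
  rw [seqCore_swap]
  simp_rw [and_comm]

/-- A large reachable set of the core meets the core before sprinkling. -/
lemma exists_mem_seqReach_core (hinj : Function.Injective fun i => (t i, h i))
    (hloop : ∀ i, t i ≠ h i) (hk : k ≤ k2) (hT : T.card < k)
    (hu : u ∈ seqCore k1 k2 t h univ \ T) (hd : ¬ DenseSmall k ε t h)
    (hM : (coreEdges k1 k2 t h univ : ℝ) ≤
      coreEdges k1 k2 (t ∘ Sum.inl) (h ∘ Sum.inl) univ + k * (ε * Fintype.card V)) :
    ∃ w ∈ seqReach t h (seqCore k1 k2 t h univ \ T) u,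
      w ∈ seqCore k1 k2 (t ∘ Sum.inl) (h ∘ Sum.inl) univ \ T := by
  set S := seqCore k1 k2 t h univ with hS
  set S' := seqCore k1 k2 (t ∘ Sum.inl) (h ∘ Sum.inl) univ with hS'
  have hSd : SeqDeg k1 k2 t h univ S := seqDeg_seqCore _ _ _ _ _
  have hbig := lt_card_seqReach hinj hloop hSd hk hT hu hd
  set A := seqReach t h (S \ T) u with hA
  have hAS : A ⊆ S \ T := seqReach_subset hu
  by_contra hcon
  push Not at hcon
  have hdisj : ∀ w ∈ A, w ∉ S' := fun w hw hw' =>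
    hcon w hw (mem_sdiff.2 ⟨hw', (mem_sdiff.1 (hAS hw)).2⟩)
  have hcount : coreEdges k1 k2 (t ∘ Sum.inl) (h ∘ Sum.inl) univ + k2 * A.card ≤
      coreEdges k1 k2 t h univ := by
    refine (Nat.add_le_add_left (mul_card_le_card_edges hSd (hAS.trans sdiff_subset)) _).trans ?_
    unfold coreEdges
    rw [← hS, ← hS', ← card_map Function.Embedding.inl, ← card_union_of_disjoint]
    · refine card_le_card (union_subset ?_ ?_)
      · intro i hi
        obtain ⟨j, hj, rfl⟩ := Finset.mem_map.1 hi
        obtain ⟨-, h1, h2⟩ := mem_filter.1 hj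
        exact mem_filter.2 ⟨mem_univ _, seqCore_inl_subset k1 k2 t h h1,
          seqCore_inl_subset k1 k2 t h h2⟩
      · intro i hi
        obtain ⟨-, h1, h2⟩ := mem_filter.1 hi
        exact mem_filter.2 ⟨mem_univ _, (mem_sdiff.1 (hAS h1)).1, h2⟩
    · rw [disjoint_left]
      intro i hi hi'
      obtain ⟨j, hj, rfl⟩ := Finset.mem_map.1 hi
      exact hdisj _ (mem_filter.1 hi').2.1 (mem_filter.1 hj).2.1
  have h1 : (coreEdges k1 k2 (t ∘ Sum.inl) (h ∘ Sum.inl) univ : ℝ) + k2 * A.card ≤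
      coreEdges k1 k2 t h univ := by exact_mod_cast hcount
  have hkk : (k : ℝ) ≤ k2 := by exact_mod_cast hk
  have hk0 : (0 : ℝ) < k := by exact_mod_cast (Nat.zero_le _).trans_lt hT
  have h2 : (k : ℝ) * (ε * Fintype.card V) < k * A.card := mul_lt_mul_of_pos_left hbig hk0
  have h3 : (k : ℝ) * A.card ≤ k2 * A.card := mul_le_mul_of_nonneg_right hkk (Nat.cast_nonneg _)
  linarith

/-- The edges indexed by `ι₂` connect all large reachable sets of the core of the digraph on `ι₁`. -/
def Sprinkled (k k1 k2 : ℕ) (ε : ℝ) (t h : ι₁ ⊕ ι₂ → V) : Prop :=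
  ∀ T : Finset V, T.card < k → ∀ w w' : V,
    ε * Fintype.card V < (seqReach (t ∘ Sum.inl) (h ∘ Sum.inl)
      (seqCore k1 k2 (t ∘ Sum.inl) (h ∘ Sum.inl) univ \ T) w).card →
    ε * Fintype.card V < (seqReach (h ∘ Sum.inl) (t ∘ Sum.inl)
      (seqCore k1 k2 (t ∘ Sum.inl) (h ∘ Sum.inl) univ \ T) w').card →
    ∃ j, t (Sum.inr j) ∈ seqReach (t ∘ Sum.inl) (h ∘ Sum.inl)
        (seqCore k1 k2 (t ∘ Sum.inl) (h ∘ Sum.inl) univ \ T) w ∧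
      h (Sum.inr j) ∈ seqReach (h ∘ Sum.inl) (t ∘ Sum.inl)
        (seqCore k1 k2 (t ∘ Sum.inl) (h ∘ Sum.inl) univ \ T) w'

theorem reflTransGen_core (hinj : Function.Injective fun i => (t i, h i))
    (hloop : ∀ i, t i ≠ h i) (hk1 : k ≤ k1) (hk2 : k ≤ k2) (hT : T.card < k)
    (hd : ¬ DenseSmall k ε t h) (hd' : ¬ DenseSmall k ε h t)
    (hM : (coreEdges k1 k2 t h univ : ℝ) ≤
      coreEdges k1 k2 (t ∘ Sum.inl) (h ∘ Sum.inl) univ + k * (ε * Fintype.card V))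
    (hsp : Sprinkled k k1 k2 ε t h)
    (hu : u ∈ seqCore k1 k2 t h univ \ T) (hv : v ∈ seqCore k1 k2 t h univ \ T) :
    Relation.ReflTransGen (SeqStep t h (seqCore k1 k2 t h univ \ T)) u v := by
  have hinj' : Function.Injective fun i => (h i, t i) := fun i j hij =>
    hinj (Prod.ext (Prod.ext_iff.1 hij).2 (Prod.ext_iff.1 hij).1)
  have hloop' : ∀ i, h i ≠ t i := fun i => (hloop i).symm
  set S := seqCore k1 k2 t h univ with hS
  set S' := seqCore k1 k2 (t ∘ Sum.inl) (h ∘ Sum.inl) univ with hS'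
  have hS'd : SeqDeg k1 k2 (t ∘ Sum.inl) (h ∘ Sum.inl) univ S' := seqDeg_seqCore _ _ _ _ _
  obtain ⟨w, hw, hwS⟩ := exists_mem_seqReach_core hinj hloop hk2 hT hu hd hM
  obtain ⟨w', hw', hwS'⟩ := exists_mem_seqReach_core (k1 := k2) (k2 := k1) (u := v) hinj' hloop' hk1
    hT (by rwa [seqCore_swap]) hd' (by rwa [coreEdges_swap k1 k2 t h,
      coreEdges_swap k1 k2 (t ∘ Sum.inl) (h ∘ Sum.inl)])
  rw [seqCore_swap, ← hS] at hw'
  rw [seqCore_swap, ← hS'] at hwS'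
  rw [← hS] at hw
  rw [← hS'] at hwS
  have hX := lt_card_seqReach (ε := ε) (t := t ∘ Sum.inl) (h := h ∘ Sum.inl)
    (hinj.comp Sum.inl_injective) (fun i => hloop _) hS'd hk2 hT hwS fun hd0 => hd hd0.of_inl
  have hY := lt_card_seqReach (ε := ε) (t := h ∘ Sum.inl) (h := t ∘ Sum.inl)
    (hinj'.comp Sum.inl_injective) (fun i => hloop' _) hS'd.swap hk1 hT hwS'
    fun hd0 => hd' hd0.of_inl
  obtain ⟨j, hj1, hj2⟩ := hsp T hT w w' hX hY
  have hsub : S' \ T ⊆ S \ T := sdiff_subset_sdiff (seqCore_inl_subset k1 k2 t h) subset_rfl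
  have hmono : ∀ {a b : V}, Relation.ReflTransGen (SeqStep (t ∘ Sum.inl) (h ∘ Sum.inl) (S' \ T)) a b →
      Relation.ReflTransGen (SeqStep t h (S \ T)) a b := fun hab =>
    Relation.ReflTransGen.mono
      (fun a b ⟨h1, h2, i, h3, h4⟩ => ⟨hsub h1, hsub h2, Sum.inl i, h3, h4⟩) _ _ hab
  have p1 := mem_seqReach.1 hw
  have p2 := hmono (mem_seqReach.1 hj1)
  have p3 := hmono (reflTransGen_seqStep_swap.1 (mem_seqReach.1 hj2))
  have p4 := reflTransGen_seqStep_swap.1 (mem_seqReach.1 hw')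
  exact ((p1.trans p2).tail ⟨hsub (seqReach_subset hwS hj1), hsub (seqReach_subset hwS' hj2),
    Sum.inr j, rfl, rfl⟩).trans (p3.trans p4)

end Sprinkling

section SprinklingCount

variable {ι₁ ι₂ V : Type*} [Fintype ι₁] [DecidableEq ι₁] [Fintype ι₂] [DecidableEq ι₂] [Fintype V]
  [DecidableEq V]

lemma card_filter_pairs_sum (P : (ι₁ ⊕ ι₂ → V) × (ι₁ ⊕ ι₂ → V) → Prop) [DecidablePred P] :
    (univ.filter P).card = ∑ q : (ι₁ → V) × (ι₁ → V),
      (univ.filter fun q' : (ι₂ → V) × (ι₂ → V) =>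
        P (Sum.elim q.1 q'.1, Sum.elim q.2 q'.2)).card := by
  let Φ : (((ι₁ → V) × (ι₁ → V)) × ((ι₂ → V) × (ι₂ → V))) ≃
      (ι₁ ⊕ ι₂ → V) × (ι₁ ⊕ ι₂ → V) :=
    (Equiv.prodProdProdComm _ _ _ _).trans (Equiv.prodCongr
      (Equiv.sumArrowEquivProdArrow ι₁ ι₂ V).symm (Equiv.sumArrowEquivProdArrow ι₁ ι₂ V).symm)
  simp_rw [card_filter]
  rw [← Fintype.sum_prod_type', ← Equiv.sum_comp Φ]
  exact sum_congr rfl fun q _ => rfl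

lemma card_avoid_product (X Y : Finset V) :
    (univ.filter fun q : (ι₂ → V) × (ι₂ → V) => ∀ j, ¬ (q.1 j ∈ X ∧ q.2 j ∈ Y)).card =
      (Fintype.card V ^ 2 - X.card * Y.card) ^ Fintype.card ι₂ := by
  have h1 : (univ.filter fun q : (ι₂ → V) × (ι₂ → V) => ∀ j, ¬ (q.1 j ∈ X ∧ q.2 j ∈ Y)).card =
      (Fintype.piFinset fun _ : ι₂ => (X ×ˢ Y)ᶜ).card := by
    refine card_equiv (Equiv.arrowProdEquivProdArrow ι₂ (fun _ => V) (fun _ => V)).symm fun q => ?_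
    simp [Equiv.arrowProdEquivProdArrow]
  rw [h1, Fintype.card_piFinset, prod_const, card_univ, card_compl, card_product,
    Fintype.card_prod, sq]

lemma card_filter_card_lt_le (hV : 1 ≤ Fintype.card V) (k : ℕ) :
    (univ.filter fun T : Finset V => T.card < k).card ≤ k * Fintype.card V ^ k := by
  have : (univ.filter fun T : Finset V => T.card < k) ⊆
      (range k).biUnion fun j => powersetCard j univ := fun T hT =>
    mem_biUnion.2 ⟨T.card, mem_range.2 (mem_filter.1 hT).2, mem_powersetCard.2 ⟨subset_univ _, rfl⟩⟩
  refine (card_le_card this).trans ((card_biUnion_le_card_mul _ _ (Fintype.card V ^ k)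
    fun j hj => ?_).trans (by rw [card_range]))
  rw [card_powersetCard, card_univ]
  exact (Nat.choose_le_pow _ _).trans (Nat.pow_le_pow_right hV (mem_range.1 hj).le)

open Classical in
lemma card_not_sprinkled_le {k k1 k2 : ℕ} {ε : ℝ} (hε : 0 < ε) (hε1 : ε ≤ 1)
    (hV : 1 ≤ Fintype.card V) :
    ((univ.filter fun p : (ι₁ ⊕ ι₂ → V) × (ι₁ ⊕ ι₂ → V) =>
      ¬ Sprinkled k k1 k2 ε p.1 p.2).card : ℝ) ≤
      k * (Fintype.card V : ℝ) ^ (k + 2) * (1 - ε ^ 2) ^ Fintype.card ι₂ *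
        ((Fintype.card V : ℝ) ^ (Fintype.card ι₁ + Fintype.card ι₂)) ^ 2 := by
  set n := Fintype.card V with hn
  set r := Fintype.card ι₂ with hr
  have hn0 : (0 : ℝ) < n := by exact_mod_cast hV
  have hε2 : 0 ≤ 1 - ε ^ 2 := by nlinarith
  have hfib : ∀ q : (ι₁ → V) × (ι₁ → V), ((univ.filter fun q' : (ι₂ → V) × (ι₂ → V) =>
      ¬ Sprinkled k k1 k2 ε (Sum.elim q.1 q'.1) (Sum.elim q.2 q'.2)).card : ℝ) ≤
      (k * n ^ k) * (n * (n * ((1 - ε ^ 2) * n ^ 2) ^ r)) := by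
    intro q
    set S := seqCore k1 k2 q.1 q.2 univ with hS
    set B : Finset V → V → V → Finset ((ι₂ → V) × (ι₂ → V)) := fun T w w' =>
      if ε * n < (seqReach q.1 q.2 (S \ T) w).card ∧ ε * n < (seqReach q.2 q.1 (S \ T) w').card then
        univ.filter fun q' => ∀ j, ¬ (q'.1 j ∈ seqReach q.1 q.2 (S \ T) w ∧
          q'.2 j ∈ seqReach q.2 q.1 (S \ T) w')
      else ∅ with hB
    have hBcard : ∀ T w w', ((B T w w').card : ℝ) ≤ ((1 - ε ^ 2) * n ^ 2) ^ r := by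
      intro T w w'
      simp only [hB]
      split_ifs with hc
      · rw [card_avoid_product, Nat.cast_pow]
        refine pow_le_pow_left₀ (Nat.cast_nonneg _) ?_ _
        have h1 : (seqReach q.1 q.2 (S \ T) w).card * (seqReach q.2 q.1 (S \ T) w').card ≤ n ^ 2 := by
          rw [sq]
          exact Nat.mul_le_mul (card_le_univ _) (card_le_univ _)
        rw [Nat.cast_sub h1]
        push_cast
        have h2 := mul_le_mul hc.1.le hc.2.le (by positivity) (Nat.cast_nonneg _)
        nlinarith
      · rw [card_empty, Nat.cast_zero]; positivity
    have hsub : (univ.filter fun q' : (ι₂ → V) × (ι₂ → V) =>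
        ¬ Sprinkled k k1 k2 ε (Sum.elim q.1 q'.1) (Sum.elim q.2 q'.2)) ⊆
        (univ.filter fun T : Finset V => T.card < k).biUnion fun T =>
          (univ : Finset V).biUnion fun w => (univ : Finset V).biUnion fun w' => B T w w' := by
      intro q' hq'
      have h1 := (mem_filter.1 hq').2
      unfold Sprinkled at h1
      simp only [Sum.elim_comp_inl, Sum.elim_inr, ← hS, ← hn] at h1
      push Not at h1
      obtain ⟨T, hT, w, w', hw, hw', hj⟩ := h1
      simp only [mem_biUnion, mem_univ, true_and, mem_filter]
      refine ⟨T, hT, w, w', ?_⟩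
      simp only [hB]
      rw [if_pos ⟨hw, hw'⟩]
      exact mem_filter.2 ⟨mem_univ _, fun j hjj => hj j hjj.1 hjj.2⟩
    calc _ ≤ ∑ T ∈ univ.filter fun T : Finset V => T.card < k, ∑ w : V, ∑ w' : V,
          ((B T w w').card : ℝ) := by
          refine (Nat.cast_le.2 (card_le_card hsub)).trans ?_
          refine (Nat.cast_le.2 card_biUnion_le).trans ?_
          rw [Nat.cast_sum]
          refine sum_le_sum fun T _ => ?_
          refine (Nat.cast_le.2 card_biUnion_le).trans ?_
          rw [Nat.cast_sum]
          refine sum_le_sum fun w _ => ?_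
          exact_mod_cast card_biUnion_le
      _ ≤ ∑ T ∈ univ.filter fun T : Finset V => T.card < k, ∑ w : V, ∑ w' : V,
          ((1 - ε ^ 2) * (n : ℝ) ^ 2) ^ r :=
          sum_le_sum fun T _ => sum_le_sum fun w _ => sum_le_sum fun w' _ => hBcard T w w'
      _ = (univ.filter fun T : Finset V => T.card < k).card *
          (n * (n * ((1 - ε ^ 2) * (n : ℝ) ^ 2) ^ r)) := by
          simp only [sum_const, nsmul_eq_mul, card_univ, ← hn]
      _ ≤ _ := by
          refine mul_le_mul_of_nonneg_right ?_ (by positivity)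
          exact_mod_cast card_filter_card_lt_le hV k
  rw [card_filter_pairs_sum, Nat.cast_sum]
  refine (sum_le_sum fun q _ => hfib q).trans (le_of_eq ?_)
  rw [sum_const, nsmul_eq_mul, card_univ, Fintype.card_prod, Fintype.card_fun, ← hn, mul_pow]
  push_cast
  ring

open Classical in
lemma card_filter_inl (P : (ι₁ → V) × (ι₁ → V) → Prop) :
    ((univ.filter fun p : (ι₁ ⊕ ι₂ → V) × (ι₁ ⊕ ι₂ → V) =>
      P (p.1 ∘ Sum.inl, p.2 ∘ Sum.inl)).card : ℝ) =
      (univ.filter P).card * ((Fintype.card V : ℝ) ^ Fintype.card ι₂) ^ 2 := by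
  rw [card_filter_pairs_sum, card_filter, Nat.cast_sum, Nat.cast_sum, sum_mul]
  refine sum_congr rfl fun q _ => ?_
  simp only [Sum.elim_comp_inl, Prod.mk.eta]
  by_cases hq : P q
  · simp [hq, Fintype.card_prod, sq]
  · simp [hq]

end SprinklingCount

section Transfer

variable {n : ℕ} {ι : Type*} [Fintype ι] [DecidableEq ι]

/-- The edge set of a sequence of edges. -/
def seqEdges (t h : ι → Fin n) : Finset (Fin n × Fin n) := univ.image fun i => (t i, h i)

variable {t h : ι → Fin n}

lemma mem_seqEdges {a b : Fin n} : (a, b) ∈ seqEdges t h ↔ ∃ i, t i = a ∧ h i = b := by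
  simp [seqEdges]

lemma degProp_seqEdges (hinj : Function.Injective fun i => (t i, h i)) {k1 k2 : ℕ}
    {S : Finset (Fin n)} : DegProp k1 k2 (seqEdges t h) S ↔ SeqDeg k1 k2 t h univ S := by
  unfold DegProp SeqDeg
  refine forall₂_congr fun v _ => ?_
  have h1 : (S.filter fun u => (u, v) ∈ seqEdges t h).card =
      (univ.filter fun i => h i = v ∧ t i ∈ S).card := by
    rw [← card_image_of_injOn (s := univ.filter fun i => h i = v ∧ t i ∈ S) (f := t)]
    · congr 1
      ext u
      simp only [mem_filter, mem_seqEdges, mem_image, mem_univ, true_and]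
      constructor
      · rintro ⟨hu, i, rfl, rfl⟩
        exact ⟨i, ⟨rfl, hu⟩, rfl⟩
      · rintro ⟨i, ⟨rfl, hu⟩, rfl⟩
        exact ⟨hu, i, rfl, rfl⟩
    · intro i hi j hj hij
      exact hinj (Prod.ext hij (((mem_filter.1 (mem_coe.1 hi)).2.1).trans
        (mem_filter.1 (mem_coe.1 hj)).2.1.symm))
  have h2 : (S.filter fun u => (v, u) ∈ seqEdges t h).card =
      (univ.filter fun i => t i = v ∧ h i ∈ S).card := by
    rw [← card_image_of_injOn (s := univ.filter fun i => t i = v ∧ h i ∈ S) (f := h)]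
    · congr 1
      ext u
      simp only [mem_filter, mem_seqEdges, mem_image, mem_univ, true_and]
      constructor
      · rintro ⟨hu, i, rfl, rfl⟩
        exact ⟨i, ⟨rfl, hu⟩, rfl⟩
      · rintro ⟨i, ⟨rfl, hu⟩, rfl⟩
        exact ⟨hu, i, rfl, rfl⟩
    · intro i hi j hj hij
      exact hinj (Prod.ext (((mem_filter.1 (mem_coe.1 hi)).2.1).trans
        (mem_filter.1 (mem_coe.1 hj)).2.1.symm) hij)
  rw [h1, h2]

lemma coreSet_seqEdges (hinj : Function.Injective fun i => (t i, h i)) (k1 k2 : ℕ) :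
    coreSet k1 k2 (seqEdges t h) = seqCore k1 k2 t h univ := by
  ext v
  simp only [coreSet, seqCore, mem_filter, mem_univ, true_and, degProp_seqEdges hinj]

/-- Every edge set with `m` elements arises from `m!` sequences. -/
lemma card_mul_factorial_le (P : Finset (Fin n × Fin n) → Prop) (Q : (ι → Fin n) × (ι → Fin n) → Prop)
    [DecidablePred Q] (hP : ∀ E, P E → E.card = Fintype.card ι)
    (hPQ : ∀ t h : ι → Fin n, Function.Injective (fun i => (t i, h i)) → P (seqEdges t h) → Q (t, h)) :
    Nat.card {E // P E} * (Fintype.card ι).factorial ≤ (univ.filter Q).card := by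
  classical
  have h1 : Nat.card (Σ E : {E // P E}, (ι ≃ {e // e ∈ E.1})) =
      Nat.card {E // P E} * (Fintype.card ι).factorial := by
    rw [Nat.card_sigma, Nat.card_eq_fintype_card, ← card_univ, ← smul_eq_mul, ← sum_const]
    refine sum_congr rfl fun E _ => ?_
    have hE : Fintype.card ι = Fintype.card {e // e ∈ E.1} := by
      rw [Fintype.card_coe, hP _ E.2]
    rw [Nat.card_eq_fintype_card, Fintype.card_equiv (Fintype.equivOfCardEq hE)]
  have h2 : (univ.filter Q).card = Nat.card {p // Q p} := by
    rw [Nat.card_eq_fintype_card, Fintype.card_subtype]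
  rw [← h1, h2]
  have hedge : ∀ x : Σ E : {E // P E}, (ι ≃ {e // e ∈ E.1}),
      seqEdges (fun i => (x.2 i).1.1) (fun i => (x.2 i).1.2) = x.1.1 := by
    rintro ⟨E, σ⟩
    ext ⟨a, b⟩
    rw [mem_seqEdges]
    constructor
    · rintro ⟨i, rfl, rfl⟩
      exact (σ i).2
    · intro hab
      exact ⟨σ.symm ⟨(a, b), hab⟩, by simp, by simp⟩
  have hinj : ∀ x : Σ E : {E // P E}, (ι ≃ {e // e ∈ E.1}),
      Function.Injective fun i => ((x.2 i).1.1, (x.2 i).1.2) := fun x =>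
    Subtype.val_injective.comp x.2.injective
  refine Nat.card_le_card_of_injective
    (fun x => ⟨(fun i => (x.2 i).1.1, fun i => (x.2 i).1.2),
      hPQ _ _ (hinj x) (by rw [hedge x]; exact x.1.2)⟩) ?_
  intro x y hxy
  have hxy' := Subtype.ext_iff.1 hxy
  simp only [Prod.mk.injEq] at hxy'
  have hE : x.1 = y.1 := Subtype.ext (by rw [← hedge x, ← hedge y, hxy'.1, hxy'.2])
  obtain ⟨E, σ⟩ := x
  obtain ⟨E', σ'⟩ := y
  obtain rfl : E = E' := hE
  congr 1
  refine Equiv.ext fun i => Subtype.ext (Prod.ext (congr_fun hxy'.1 i) (congr_fun hxy'.2 i))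

lemma card_simpleDigraph (n m : ℕ) :
    Nat.card {E : Finset (Fin n × Fin n) // IsSimpleDigraph E ∧ E.card = m} =
      (n * n - n).choose m := by
  classical
  have : Nat.card {E : Finset (Fin n × Fin n) // IsSimpleDigraph E ∧ E.card = m} =
      (powersetCard m (univ : Finset (Fin n)).offDiag).card := by
    rw [Nat.card_eq_fintype_card, Fintype.card_subtype]
    congr 1
    ext E
    simp [mem_powersetCard, IsSimpleDigraph, subset_iff]
  rw [this, card_powersetCard, offDiag_card, card_univ, Fintype.card_fin]

end Transfer

section Threshold

variable {k1 k2 : ℕ}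

lemma coreF_geom_mean_le (hk1 : 1 ≤ k1) (hk2 : 2 ≤ k2) {x1 x2 y1 y2 a b : ℝ} (hx1 : 0 < x1)
    (hx2 : 0 < x2) (hy1 : 0 < y1) (hy2 : 0 < y2) (ha : 0 < a) (hb : 0 < b) (hab : a + b = 1) :
    coreF k1 k2 x1 x2 ^ a * coreF k1 k2 y1 y2 ^ b ≤
      coreF k1 k2 (x1 ^ a * y1 ^ b) (x2 ^ a * y2 ^ b) := by
  have h1 := pPoi_geom_mean_le hk1 hx1 hy1 ha.le hb.le hab
  have h2 := pPoi_geom_mean_le (show 1 ≤ k2 - 1 by omega) hx2 hy2 ha.le hb.le hab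
  unfold coreF
  rw [Real.mul_rpow (pPoi_nonneg _ hx1.le) (pPoi_nonneg _ hx2.le),
    Real.mul_rpow (pPoi_nonneg _ hy1.le) (pPoi_nonneg _ hy2.le)]
  refine le_trans (le_of_eq (by ring)) (mul_le_mul h1 h2 ?_ (pPoi_nonneg _ (by positivity)))
  exact mul_nonneg (Real.rpow_nonneg (pPoi_nonneg _ hx2.le) _)
    (Real.rpow_nonneg (pPoi_nonneg _ hy2.le) _)

/-- Feasible points are closed under weighted geometric means. -/
lemma geom_mean_le_mul_coreF (hk1 : 1 ≤ k1) (hk2 : 2 ≤ k2) {c d x1 x2 y1 y2 a b : ℝ} (hc : 0 < c)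
    (hd : 0 < d) (hx1 : 0 < x1) (hx2 : 0 < x2) (hy1 : 0 < y1) (hy2 : 0 < y2) (ha : 0 < a)
    (hb : 0 < b) (hab : a + b = 1) (hx : x1 ≤ c * coreF k1 k2 x1 x2)
    (hy : y1 ≤ d * coreF k1 k2 y1 y2) :
    x1 ^ a * y1 ^ b ≤ c ^ a * d ^ b * coreF k1 k2 (x1 ^ a * y1 ^ b) (x2 ^ a * y2 ^ b) := by
  have hF := coreF_pos k1 k2 hx1 hx2
  have hG := coreF_pos k1 k2 hy1 hy2
  calc x1 ^ a * y1 ^ b ≤ (c * coreF k1 k2 x1 x2) ^ a * (d * coreF k1 k2 y1 y2) ^ b := by gcongr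
    _ = c ^ a * d ^ b * (coreF k1 k2 x1 x2 ^ a * coreF k1 k2 y1 y2 ^ b) := by
      rw [Real.mul_rpow hc.le hF.le, Real.mul_rpow hd.le hG.le]; ring
    _ ≤ _ := by
      gcongr
      exact coreF_geom_mean_le hk1 hk2 hx1 hx2 hy1 hy2 ha hb hab

lemma exists_feasible_of_cstar_lt {c : ℝ} (hc : cstar k1 k2 < c) :
    ∃ c0 z1 z2 : ℝ, 0 < c0 ∧ c0 < c ∧ CoreFeasible k1 k2 c0 z1 z2 := by
  unfold cstar at hc
  obtain ⟨c0, ⟨z1, hz1, z2, hz2, hc0⟩, hlt⟩ :=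
    exists_lt_of_csInf_lt (by exact ⟨_, 1, one_pos, 1, one_pos, rfl⟩) hc
  have hF := coreF_pos k1 k2 hz1 hz2
  have hG := coreF_pos k2 k1 hz2 hz1
  have h1 : z1 / coreF k1 k2 z1 z2 ≤ c0 := by rw [hc0]; exact le_max_left _ _
  have h2 : z2 / coreF k2 k1 z2 z1 ≤ c0 := by
    rw [hc0, coreF, mul_comm]; exact le_max_right _ _
  exact ⟨c0, z1, z2, (div_pos hz1 hF).trans_le h1, hlt, hz1, hz2, (div_le_iff₀ hF).1 h1,
    (div_le_iff₀ hG).1 h2⟩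

lemma CoreFeasible.mono {c c' z1 z2 : ℝ} (h : CoreFeasible k1 k2 c z1 z2) (hcc : c ≤ c') :
    CoreFeasible k1 k2 c' z1 z2 :=
  ⟨h.1, h.2.1, h.2.2.1.trans (mul_le_mul_of_nonneg_right hcc (coreF_pos _ _ h.1 h.2.1).le),
    h.2.2.2.trans (mul_le_mul_of_nonneg_right hcc (coreF_pos _ _ h.2.1 h.1).le)⟩

lemma CoreFeasible.mul_le {c z1 z2 : ℝ} (hc : 0 ≤ c) (h : CoreFeasible k1 k2 c z1 z2) :
    z1 * z2 ≤ c * c := by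
  obtain ⟨h1, h2, h3, h4⟩ := h
  refine mul_le_mul (h3.trans ?_) (h4.trans ?_) h2.le hc
  · exact mul_le_of_le_one_right hc (coreF_le_one _ _ h1.le h2.le)
  · exact mul_le_of_le_one_right hc (coreF_le_one _ _ h2.le h1.le)

/-- Above the threshold there are strictly feasible points at a smaller density which nearly maximise
the number of core edges at a larger density. -/
theorem exists_threshold_params (hk1 : 2 ≤ k1) (hk2 : 2 ≤ k2) {c : ℝ} (hc : cstar k1 k2 < c)
    {η : ℝ} (hη : 0 < η) :
    ∃ c₁ c₂ w1 w2 : ℝ, 0 < c₁ ∧ c₁ < c ∧ c < c₂ ∧ 0 < w1 ∧ 0 < w2 ∧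
      w1 < c₁ * coreF k1 k2 w1 w2 ∧ w2 < c₁ * coreF k2 k1 w2 w1 ∧
      ∀ z1 z2, CoreFeasible k1 k2 c₂ z1 z2 → z1 * z2 ≤ w1 * w2 + η := by
  obtain ⟨c0, y1, y2, hc0, hc0c, hy⟩ := exists_feasible_of_cstar_lt hc
  have hcpos : 0 < c := hc0.trans hc0c
  have hy1 := hy.1
  have hy2 := hy.2.1
  set q : ℝ := y1 * y2 / (4 * c ^ 2) with hq
  have hq0 : 0 < q := by positivity
  obtain ⟨b, hb0, hb1, hbq⟩ : ∃ b : ℝ, 0 < b ∧ b < 1 ∧ 1 - η / 2 / (4 * c ^ 2) < q ^ b := by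
    have hcont : Tendsto (fun b : ℝ => q ^ b) (𝓝[>] 0) (𝓝 (q ^ (0 : ℝ))) :=
      ((Real.continuous_const_rpow hq0.ne').tendsto 0).mono_left nhdsWithin_le_nhds
    rw [Real.rpow_zero] at hcont
    have hlt : 1 - η / 2 / (4 * c ^ 2) < 1 := by
      have : 0 < η / 2 / (4 * c ^ 2) := by positivity
      linarith
    obtain ⟨b, ⟨h1, h2⟩, h3⟩ := ((Ioo_mem_nhdsGT (zero_lt_one' ℝ)) |> fun h =>
      (Filter.Eventually.and h (hcont.eventually (lt_mem_nhds hlt)))).exists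
    exact ⟨b, h1, h2, h3⟩
  have ha0 : 0 < 1 - b := by linarith
  obtain ⟨c₂, hc2, hc22, hc2c⟩ : ∃ c₂, c < c₂ ∧ c₂ < 2 * c ∧ c₂ ^ (1 - b) * c0 ^ b < c := by
    have hcont : Tendsto (fun x : ℝ => x ^ (1 - b) * c0 ^ b) (𝓝[>] c) (𝓝 (c ^ (1 - b) * c0 ^ b)) :=
      (((Real.continuousAt_rpow_const c (1 - b) (Or.inl hcpos.ne')).tendsto).mono_left
        nhdsWithin_le_nhds).mul_const _
    have hlt : c ^ (1 - b) * c0 ^ b < c := by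
      calc c ^ (1 - b) * c0 ^ b < c ^ (1 - b) * c ^ b := by
            gcongr
        _ = c := by rw [← Real.rpow_add hcpos, sub_add_cancel, Real.rpow_one]
    obtain ⟨x, ⟨h1, h2⟩, h3⟩ := ((Ioo_mem_nhdsGT (show c < 2 * c by linarith)) |> fun h =>
      (Filter.Eventually.and h (hcont.eventually (gt_mem_nhds hlt)))).exists
    exact ⟨x, h1, h2, h3⟩
  have hc2pos : 0 < c₂ := hcpos.trans hc2
  set P : Set ℝ := {x | ∃ z1 z2, CoreFeasible k1 k2 c₂ z1 z2 ∧ x = z1 * z2} with hP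
  have hPne : P.Nonempty := ⟨_, y1, y2, hy.mono (hc0c.trans hc2).le, rfl⟩
  have hPb : BddAbove P := ⟨c₂ * c₂, by
    rintro _ ⟨z1, z2, hz, rfl⟩
    exact hz.mul_le hc2pos.le⟩
  obtain ⟨_, ⟨x1, x2, hx, rfl⟩, hxP⟩ := exists_lt_of_lt_csSup hPne
    (show sSup P - η / 2 < sSup P by linarith)
  have hx1 := hx.1
  have hx2 := hx.2.1
  have hxc : x1 * x2 ≤ 4 * c ^ 2 := by
    have := hx.mul_le hc2pos.le
    nlinarith
  have hF1 := geom_mean_le_mul_coreF (by omega) hk2 hc2pos hc0 hx1 hx2 hy1 hy2 ha0 hb0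
    (sub_add_cancel _ _) hx.2.2.1 hy.2.2.1
  have hF2 := geom_mean_le_mul_coreF (by omega) hk1 hc2pos hc0 hx2 hx1 hy2 hy1 ha0 hb0
    (sub_add_cancel _ _) hx.2.2.2 hy.2.2.2
  set w1 := x1 ^ (1 - b) * y1 ^ b with hw1
  set w2 := x2 ^ (1 - b) * y2 ^ b with hw2
  have hw10 : 0 < w1 := by positivity
  have hw20 : 0 < w2 := by positivity
  set c1 := c₂ ^ (1 - b) * c0 ^ b with hc1
  have hc10 : 0 < c1 := by positivity
  have hprod : x1 * x2 - η / 2 ≤ w1 * w2 := by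
    have hx12 : 0 < x1 * x2 := by positivity
    have e1 : w1 * w2 = x1 * x2 * (y1 * y2 / (x1 * x2)) ^ b := by
      rw [Real.div_rpow (by positivity) hx12.le, mul_div_assoc', mul_comm (x1 * x2), mul_div_assoc,
        ← Real.rpow_one_sub' hx12.le ha0.ne', Real.mul_rpow hx1.le hx2.le,
        Real.mul_rpow hy1.le hy2.le]
      rw [hw1, hw2]; ring
    have e2 : q ^ b ≤ (y1 * y2 / (x1 * x2)) ^ b := by
      rw [hq]; gcongr
    have e3 : x1 * x2 * (1 - η / 2 / (4 * c ^ 2)) ≤ w1 * w2 := by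
      rw [e1]
      exact mul_le_mul_of_nonneg_left (hbq.le.trans e2) hx12.le
    have e4 : x1 * x2 * (η / 2 / (4 * c ^ 2)) ≤ η / 2 := by
      rw [mul_div_assoc', div_le_iff₀ (by positivity)]
      nlinarith
    linarith
  refine ⟨(c1 + c) / 2, c₂, w1, w2, by linarith, by linarith, hc2, hw10, hw20,
    hF1.trans_lt ?_, hF2.trans_lt ?_, fun z1 z2 hz => ?_⟩
  · exact mul_lt_mul_of_pos_right (by linarith) (coreF_pos _ _ hw10 hw20)
  · exact mul_lt_mul_of_pos_right (by linarith) (coreF_pos _ _ hw20 hw10)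
  · have := le_csSup hPb ⟨z1, z2, hz, rfl⟩
    linarith

end Threshold

/-- The number of simple digraphs is comparable to the number of edge sequences over `m!`. -/
lemma exp_mul_le_choose_mul_factorial {c : ℝ} (hc : 0 < c) {n m : ℕ} (hm : (m : ℝ) ≤ c * n)
    (hn : 2 * (1 + c) ≤ n) :
    Real.exp (-(2 * (1 + c) * c)) * ((n : ℝ) ^ m) ^ 2 ≤
      (n * n - n).choose m * m.factorial := by
  have hn0 : (0 : ℝ) < n := lt_of_lt_of_le (by positivity) hn
  have h1 := Nat.pow_sub_le_descFactorial (n * n - n) m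
  rw [Nat.descFactorial_eq_factorial_mul_choose] at h1
  set x : ℝ := (1 + c) / n with hx
  have hx0 : 0 ≤ x := by positivity
  have hx2 : x ≤ 1 / 2 := by
    rw [hx, div_le_iff₀ hn0]; linarith
  have h2 : (n : ℝ) ^ 2 * (1 - x) ≤ ((n * n - n + 1 - m : ℕ) : ℝ) := by
    have h3 : n * n ≤ (n * n - n + 1 - m) + m + n := by omega
    have h4 : ((n * n : ℕ) : ℝ) ≤ ((n * n - n + 1 - m : ℕ) : ℝ) + m + n := by exact_mod_cast h3
    push_cast at h4
    have h5 : (n : ℝ) ^ 2 * x = n * (1 + c) := by rw [hx]; field_simp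
    nlinarith
  have h6 : Real.exp (-(2 * x)) ≤ 1 - x := by
    rw [Real.exp_neg, inv_le_iff_one_le_mul₀ (Real.exp_pos _)]
    have := mul_le_mul_of_nonneg_left (Real.add_one_le_exp (2 * x)) (show 0 ≤ 1 - x by linarith)
    nlinarith
  calc Real.exp (-(2 * (1 + c) * c)) * ((n : ℝ) ^ m) ^ 2
      ≤ Real.exp (-(2 * x)) ^ m * ((n : ℝ) ^ m) ^ 2 := by
        gcongr
        rw [← Real.exp_nat_mul]
        refine Real.exp_le_exp.2 ?_
        have h7 : (m : ℝ) * x ≤ c * n * x := mul_le_mul_of_nonneg_right hm hx0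
        have h8 : c * n * x = c * (1 + c) := by rw [hx]; field_simp
        linarith
    _ = (n ^ 2 * Real.exp (-(2 * x))) ^ m := by rw [mul_pow, ← pow_mul, ← pow_mul]; ring
    _ ≤ (n ^ 2 * (1 - x)) ^ m := by gcongr
    _ ≤ ((n * n - n + 1 - m : ℕ) : ℝ) ^ m :=
        pow_le_pow_left₀ (mul_nonneg (by positivity) (by linarith)) h2 _
    _ ≤ _ := by
        exact_mod_cast h1.trans_eq (mul_comm _ _)

lemma kStronglyConnectedOn_core {n k1 k2 : ℕ} {ι₁ ι₂ : Type*} [Fintype ι₁] [DecidableEq ι₁]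
    [Fintype ι₂] [DecidableEq ι₂] {t h : ι₁ ⊕ ι₂ → Fin n} {ε : ℝ}
    (hinj : Function.Injective fun i => (t i, h i)) (hloop : ∀ i, t i ≠ h i)
    (hd : ¬ DenseSmall (min k1 k2) ε t h) (hd' : ¬ DenseSmall (min k1 k2) ε h t)
    (hM : (coreEdges k1 k2 t h univ : ℝ) ≤
      coreEdges k1 k2 (t ∘ Sum.inl) (h ∘ Sum.inl) univ + (min k1 k2 : ℕ) * (ε * n))
    (hM0 : 0 < coreEdges k1 k2 (t ∘ Sum.inl) (h ∘ Sum.inl) univ)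
    (hsp : Sprinkled (min k1 k2) k1 k2 ε t h) :
    (coreSet k1 k2 (seqEdges t h)).Nonempty ∧
      KStronglyConnectedOn (min k1 k2) (seqEdges t h) (coreSet k1 k2 (seqEdges t h)) := by
  rw [coreSet_seqEdges hinj]
  obtain ⟨i, hi⟩ := card_pos.1 hM0
  have hu := seqCore_inl_subset k1 k2 t h (mem_filter.1 hi).2.1
  refine ⟨⟨_, hu⟩, (min_le_right _ _).trans_lt
    (lt_card_of_seqDeg hinj hloop (seqDeg_seqCore _ _ _ _ _) hu), fun T hT a ha b hb => ?_⟩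
  refine Relation.ReflTransGen.mono ?_ _ _ (reflTransGen_core hinj hloop (min_le_left _ _)
    (min_le_right _ _) hT hd hd' (by rwa [Fintype.card_fin]) hsp ha hb)
  exact fun x y ⟨hx, hy, hxy⟩ => ⟨hx, hy, mem_seqEdges.2 hxy⟩

open Classical in
lemma card_denseSmall_swap {ι V : Type*} [Fintype ι] [DecidableEq ι] [Fintype V] [DecidableEq V]
    (k : ℕ) (ε : ℝ) :
    (univ.filter fun p : (ι → V) × (ι → V) => DenseSmall k ε p.2 p.1).card =
      (univ.filter fun p : (ι → V) × (ι → V) => DenseSmall k ε p.1 p.2).card :=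
  card_equiv (Equiv.prodComm _ _) fun p => by simp

lemma eventually_mul_pow_mul_exp_le_one (K : ℝ) (p : ℕ) {δ : ℝ} (hδ : 0 < δ) :
    ∀ᶠ n : ℕ in atTop, K * ((n : ℝ) ^ p * Real.exp (-δ * n)) ≤ 1 := by
  have h := ((Real.tendsto_pow_mul_exp_neg_atTop_nhds_zero p).comp
    (tendsto_natCast_atTop_atTop.const_mul_atTop hδ)).const_mul (K / δ ^ p)
  rw [mul_zero] at h
  filter_upwards [h.eventually (ge_mem_nhds one_pos)] with n hn
  refine le_trans (le_of_eq ?_) hn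
  simp only [Function.comp, mul_pow, neg_mul]
  field_simp

/-- If both core sizes are typical, few core edges are gained by sprinkling. -/
lemma coreEdges_le_of_ok {k1 k2 : ℕ} {c c₁ c₂ c₃ w1 w2 η n m m₁ : ℝ} {M M' : ℕ} (hc1 : 0 < c₁)
    (hc1c : c₁ ≤ c) (hw1 : 0 < w1) (hw2 : 0 < w2) (hn : 0 < n)
    (hfeas : ∀ z1 z2, CoreFeasible k1 k2 c₂ z1 z2 → z1 * z2 ≤ w1 * w2 + c * η)
    (hm₁ : 0 < m₁) (hcm : c₁ * n ≤ m₁ + 1) (hnη : w1 * w2 / c₁ ^ 2 ≤ η * n)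
    (hok : CoreEdgesOk k1 k2 c c₂ w1 w2 n m M) (hok' : CoreEdgesOk k1 k2 c₁ c₃ w1 w2 n m₁ M') :
    (M : ℝ) ≤ M' + 2 * (η * n) ∧ 0 < M' := by
  obtain ⟨-, z1, z2, hz, hM⟩ := hok
  obtain ⟨hM', -⟩ := hok'
  have hc : 0 < c := hc1.trans_le hc1c
  constructor
  · have h1 : n * (z1 * z2 / c) ≤ n * (w1 * w2 / c₁ + η) := by
      refine mul_le_mul_of_nonneg_left ?_ hn.le
      calc z1 * z2 / c ≤ (w1 * w2 + c * η) / c := by gcongr; exact hfeas _ _ hz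
        _ = w1 * w2 / c + η := by field_simp
        _ ≤ _ := by gcongr
    have h2 : (c₁ * n - 1) * (w1 * w2 / c₁ ^ 2) ≤ m₁ * (w1 * w2 / c₁ ^ 2) := by
      gcongr; linarith
    have h3 : (c₁ * n - 1) * (w1 * w2 / c₁ ^ 2) = n * (w1 * w2 / c₁) - w1 * w2 / c₁ ^ 2 := by
      field_simp
    linarith
  · have : (0 : ℝ) < M' := lt_of_lt_of_le (by positivity) hM'
    exact_mod_cast this

lemma eventually_sprinkling_bound (k : ℕ) {ε a : ℝ} (hε : 0 < ε) (hε1 : ε ≤ 1) (ha : 0 < a) :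
    ∀ᶠ n : ℕ in atTop, ∀ r : ℕ, a * n ≤ r + 1 →
      k * (n : ℝ) ^ (k + 2) * (1 - ε ^ 2) ^ r * (n : ℝ) ^ (k - 1) ≤ 1 := by
  filter_upwards [eventually_mul_pow_mul_exp_le_one (k * Real.exp (ε ^ 2)) (k + 2 + (k - 1))
    (show 0 < ε ^ 2 * a by positivity)] with n hn r hr
  have h0 : 0 ≤ 1 - ε ^ 2 := by nlinarith
  have h1 : (1 - ε ^ 2) ^ r ≤ Real.exp (ε ^ 2) * Real.exp (-(ε ^ 2 * a) * n) := by
    calc (1 - ε ^ 2) ^ r ≤ Real.exp (-ε ^ 2) ^ r := by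
          refine pow_le_pow_left₀ h0 ?_ _
          linarith [Real.add_one_le_exp (-ε ^ 2)]
      _ ≤ _ := by
          rw [← Real.exp_nat_mul, ← Real.exp_add]
          refine Real.exp_le_exp.2 ?_
          nlinarith [mul_le_mul_of_nonneg_left hr (sq_nonneg ε)]
  calc k * (n : ℝ) ^ (k + 2) * (1 - ε ^ 2) ^ r * (n : ℝ) ^ (k - 1)
      ≤ k * (n : ℝ) ^ (k + 2) * (Real.exp (ε ^ 2) * Real.exp (-(ε ^ 2 * a) * n)) *
        (n : ℝ) ^ (k - 1) := by gcongr
    _ = k * Real.exp (ε ^ 2) * ((n : ℝ) ^ (k + 2 + (k - 1)) * Real.exp (-(ε ^ 2 * a) * n)) := by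
        rw [pow_add _ (k + 2)]; ring
    _ ≤ 1 := hn

/-- If the core is empty or badly connected, then the edge sequence has one of the listed
defects. -/
lemma defect_of_core_bad {n k1 k2 : ℕ} {ι₁ ι₂ : Type*} [Fintype ι₁] [DecidableEq ι₁]
    [Fintype ι₂] [DecidableEq ι₂] {t h : ι₁ ⊕ ι₂ → Fin n} {ε c c₁ c₂ w1 w2 : ℝ}
    (hinj : Function.Injective fun i => (t i, h i)) (hloop : ∀ i, t i ≠ h i)
    (hc1 : 0 < c₁) (hc1c : c₁ ≤ c) (hw1 : 0 < w1) (hw2 : 0 < w2) (hn : 0 < n)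
    (hfeas : ∀ z1 z2, CoreFeasible k1 k2 c₂ z1 z2 →
      z1 * z2 ≤ w1 * w2 + c * ((min k1 k2 : ℕ) * ε / 2))
    (hm₁ : 0 < Fintype.card ι₁) (hcm : c₁ * n ≤ Fintype.card ι₁ + 1)
    (hnη : w1 * w2 / c₁ ^ 2 ≤ (min k1 k2 : ℕ) * ε / 2 * n)
    (hbad : coreSet k1 k2 (seqEdges t h) = ∅ ∨
      ¬ KStronglyConnectedOn (min k1 k2) (seqEdges t h) (coreSet k1 k2 (seqEdges t h))) :
    DenseSmall (min k1 k2) ε t h ∨ DenseSmall (min k1 k2) ε h t ∨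
      (t, h) ∈ badPairs (ι₁ ⊕ ι₂) (Fin n) k1 k2 c c₂ w1 w2 ∨
      (t ∘ Sum.inl, h ∘ Sum.inl) ∈ badPairs ι₁ (Fin n) k1 k2 c₁ c w1 w2 ∨
      ¬ Sprinkled (min k1 k2) k1 k2 ε t h := by
  by_contra! hcon
  obtain ⟨hd, hd', hb, hb', hsp⟩ := hcon
  simp only [badPairs, mem_filter, mem_univ, true_and, not_not, Fintype.card_fin] at hb hb'
  obtain ⟨hM, hM0⟩ := coreEdges_le_of_ok hc1 hc1c hw1 hw2 (Nat.cast_pos.2 hn) hfeas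
    (Nat.cast_pos.2 hm₁) hcm hnη hb hb'
  have hgood := kStronglyConnectedOn_core hinj hloop hd hd' (by linarith) hM0 hsp
  exact hbad.elim hgood.1.ne_empty fun hk => hk hgood.2

/-- The bound of the main theorem for all large numbers of vertices. -/
lemma exists_eventually_card_bad_le {k1 k2 : ℕ} (hk1 : 2 ≤ k1) (hk2 : 2 ≤ k2) {c : ℝ}
    (hc : cstar k1 k2 < c) :
    ∃ K : ℝ, 0 < K ∧ ∀ᶠ n : ℕ in atTop,
      (Nat.card {E : Finset (Fin n × Fin n) //
          IsSimpleDigraph E ∧ E.card = ⌊c * n⌋₊ ∧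
          (coreSet k1 k2 E = ∅ ∨
            ¬ KStronglyConnectedOn (min k1 k2) E (coreSet k1 k2 E))} : ℝ) *
          (n : ℝ) ^ (min k1 k2 - 1) ≤
        K * (Nat.card {E : Finset (Fin n × Fin n) //
            IsSimpleDigraph E ∧ E.card = ⌊c * n⌋₊} : ℝ) := by
  classical
  have hc0 : 0 < c := by
    obtain ⟨c0, -, -, h, h', -⟩ := exists_feasible_of_cstar_lt hc
    exact h.trans h'
  set k := min k1 k2 with hk
  have hk2' : 2 ≤ k := le_min hk1 hk2
  have hkR : (0 : ℝ) < k := by exact_mod_cast (by omega : 0 < k)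
  obtain ⟨ε, hε, hε1, C, hC, hdense⟩ := exists_card_denseSmall_le k hk2' hc0
  obtain ⟨c₁, c₂, w1, w2, hc1, hc1c, hcc2, hw1, hw2, hf1, hf2, hfeas⟩ :=
    exists_threshold_params hk1 hk2 hc (show 0 < c * (k * ε / 2) by positivity)
  obtain ⟨δ, hδ, n0, hbad⟩ := exists_card_badPairs_le k1 k2 (by omega) (by omega) hc0 hcc2 hw1 hw2
    (hf1.trans (mul_lt_mul_of_pos_right hc1c (coreF_pos k1 k2 hw1 hw2)))
    (hf2.trans (mul_lt_mul_of_pos_right hc1c (coreF_pos k2 k1 hw2 hw1)))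
  obtain ⟨δ', hδ', n0', hbad'⟩ := exists_card_badPairs_le k1 k2 (by omega) (by omega) hc1 hc1c
    hw1 hw2 hf1 hf2
  refine ⟨(2 * C + 3) * Real.exp (2 * (1 + c) * c), by positivity, ?_⟩
  filter_upwards [eventually_ge_atTop n0, eventually_ge_atTop n0', eventually_ge_atTop 1,
    eventually_mul_pow_mul_exp_le_one 1 (k - 1) hδ, eventually_mul_pow_mul_exp_le_one 1 (k - 1) hδ',
    eventually_sprinkling_bound k hε hε1 (sub_pos.2 hc1c),
    tendsto_natCast_atTop_atTop.eventually_ge_atTop (2 * (1 + c)),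
    (tendsto_natCast_atTop_atTop.const_mul_atTop (show 0 < k * ε / 2 by positivity)).eventually_ge_atTop
      (w1 * w2 / c₁ ^ 2),
    (tendsto_natCast_atTop_atTop.const_mul_atTop hc1).eventually_ge_atTop 1]
    with n hn0 hn0' hn1 hexp hexp' hspr hnc hnη hnc1
  rw [one_mul] at hexp hexp'
  have hn : (0 : ℝ) < n := by exact_mod_cast hn1
  obtain ⟨r, hr⟩ := Nat.exists_eq_add_of_le (Nat.floor_le_floor
    (mul_le_mul_of_nonneg_right hc1c.le hn.le))
  set m := ⌊c * n⌋₊ with hm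
  set m₁ := ⌊c₁ * n⌋₊ with hm₁
  have hmle : (m : ℝ) ≤ c * n := Nat.floor_le (by positivity)
  have hm₁le : (m₁ : ℝ) ≤ c₁ * n := Nat.floor_le (by positivity)
  have hmlt : c * n ≤ m + 1 := (Nat.lt_floor_add_one _).le
  have hm₁lt : c₁ * n ≤ m₁ + 1 := (Nat.lt_floor_add_one _).le
  have hmr : (m : ℝ) = m₁ + r := by exact_mod_cast hr
  have hm₁0 : 0 < m₁ := Nat.floor_pos.2 hnc1
  have hcard : Fintype.card (Fin m₁ ⊕ Fin r) = m := by simp [hr]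
  set N : ℝ := ((n : ℝ) ^ m) ^ 2 with hN
  have hN0 : 0 < N := by positivity
  set B1 : Finset ((Fin m₁ ⊕ Fin r → Fin n) × (Fin m₁ ⊕ Fin r → Fin n)) :=
    univ.filter fun p => DenseSmall k ε p.1 p.2 with hB1
  set B2 : Finset ((Fin m₁ ⊕ Fin r → Fin n) × (Fin m₁ ⊕ Fin r → Fin n)) :=
    univ.filter fun p => DenseSmall k ε p.2 p.1 with hB2
  set B3 := badPairs (Fin m₁ ⊕ Fin r) (Fin n) k1 k2 c c₂ w1 w2 with hB3
  set B4 : Finset ((Fin m₁ ⊕ Fin r → Fin n) × (Fin m₁ ⊕ Fin r → Fin n)) :=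
    univ.filter fun p => (p.1 ∘ Sum.inl, p.2 ∘ Sum.inl) ∈ badPairs (Fin m₁) (Fin n) k1 k2 c₁ c w1 w2
    with hB4
  set B5 : Finset ((Fin m₁ ⊕ Fin r → Fin n) × (Fin m₁ ⊕ Fin r → Fin n)) :=
    univ.filter fun p => ¬ Sprinkled k k1 k2 ε p.1 p.2 with hB5
  have b1 : (B1.card : ℝ) * (n : ℝ) ^ (k - 1) ≤ C * N := by
    have := hdense (Fin m₁ ⊕ Fin r) (Fin n) (by simpa using hn1) (by rw [hcard]; simpa using hmle)
    rwa [hcard, Fintype.card_fin] at this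
  have b2 : (B2.card : ℝ) * (n : ℝ) ^ (k - 1) ≤ C * N := by
    rwa [hB2, card_denseSmall_swap]
  have b3 : (B3.card : ℝ) * (n : ℝ) ^ (k - 1) ≤ N := by
    have := hbad (Fin m₁ ⊕ Fin r) (Fin n) (by simpa using hn0) (by rw [hcard, Fintype.card_fin])
    rw [hcard, Fintype.card_fin] at this
    calc (B3.card : ℝ) * (n : ℝ) ^ (k - 1) ≤ Real.exp (-δ * n) * N * (n : ℝ) ^ (k - 1) := by gcongr
      _ = (n ^ (k - 1) * Real.exp (-δ * n)) * N := by ring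
      _ ≤ N := mul_le_of_le_one_left hN0.le hexp
  have b4 : (B4.card : ℝ) * (n : ℝ) ^ (k - 1) ≤ N := by
    have := hbad' (Fin m₁) (Fin n) (by simpa using hn0') (by simp [hm₁])
    rw [Fintype.card_fin, Fintype.card_fin] at this
    have hB4' : (B4.card : ℝ) =
        (badPairs (Fin m₁) (Fin n) k1 k2 c₁ c w1 w2).card * ((n : ℝ) ^ r) ^ 2 := by
      convert card_filter_inl (ι₂ := Fin r)
        (fun p => p ∈ badPairs (Fin m₁) (Fin n) k1 k2 c₁ c w1 w2) using 3
      · ext p; simp [hB4]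
      · simp
      · simp
    rw [hB4']
    calc ((badPairs (Fin m₁) (Fin n) k1 k2 c₁ c w1 w2).card : ℝ) * ((n : ℝ) ^ r) ^ 2 *
          (n : ℝ) ^ (k - 1)
        ≤ Real.exp (-δ' * n) * ((n : ℝ) ^ m₁) ^ 2 * ((n : ℝ) ^ r) ^ 2 * (n : ℝ) ^ (k - 1) := by
          gcongr
      _ = (n ^ (k - 1) * Real.exp (-δ' * n)) * N := by rw [hN, hr, pow_add]; ring
      _ ≤ N := mul_le_of_le_one_left hN0.le hexp'
  have b5 : (B5.card : ℝ) * (n : ℝ) ^ (k - 1) ≤ N := by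
    have := card_not_sprinkled_le (ι₁ := Fin m₁) (ι₂ := Fin r) (V := Fin n) (k := k) (k1 := k1)
      (k2 := k2) hε hε1 (by simpa using hn1)
    rw [Fintype.card_fin, Fintype.card_fin, Fintype.card_fin, ← hr] at this
    calc (B5.card : ℝ) * (n : ℝ) ^ (k - 1)
        ≤ k * (n : ℝ) ^ (k + 2) * (1 - ε ^ 2) ^ r * N * (n : ℝ) ^ (k - 1) := by gcongr
      _ = k * (n : ℝ) ^ (k + 2) * (1 - ε ^ 2) ^ r * (n : ℝ) ^ (k - 1) * N := by ring
      _ ≤ N := mul_le_of_le_one_left hN0.le (hspr r (by linarith))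
  set X := Nat.card {E : Finset (Fin n × Fin n) // IsSimpleDigraph E ∧ E.card = m ∧
    (coreSet k1 k2 E = ∅ ∨ ¬ KStronglyConnectedOn k E (coreSet k1 k2 E))} with hX
  have hXle : X * m.factorial ≤ (B1 ∪ (B2 ∪ (B3 ∪ (B4 ∪ B5)))).card := by
    have := card_mul_factorial_le (ι := Fin m₁ ⊕ Fin r) (n := n)
      (fun E => IsSimpleDigraph E ∧ E.card = m ∧
        (coreSet k1 k2 E = ∅ ∨ ¬ KStronglyConnectedOn k E (coreSet k1 k2 E)))
      (fun p => p ∈ B1 ∪ (B2 ∪ (B3 ∪ (B4 ∪ B5)))) (fun E hE => hE.2.1.trans hcard.symm)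
      (fun t h hinj ⟨hs, _, hE⟩ => by
        have := defect_of_core_bad hinj (fun i => hs (t i, h i) (mem_seqEdges.2 ⟨i, rfl, rfl⟩))
          hc1 hc1c.le hw1 hw2 hn1 hfeas (by simpa using hm₁0) (by simpa using hm₁lt) hnη hE
        simpa only [mem_union, hB1, hB2, hB3, hB4, hB5, mem_filter, mem_univ, true_and] using this)
    rwa [hcard, filter_mem_eq_inter, univ_inter] at this
  have hsum : (X : ℝ) * m.factorial ≤ B1.card + (B2.card + (B3.card + (B4.card + B5.card))) := by
    have h5 := card_union_le B4 B5
    have h4 := card_union_le B3 (B4 ∪ B5)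
    have h3 := card_union_le B2 (B3 ∪ (B4 ∪ B5))
    have h2 := card_union_le B1 (B2 ∪ (B3 ∪ (B4 ∪ B5)))
    exact_mod_cast (by omega : X * m.factorial ≤ B1.card + (B2.card + (B3.card + (B4.card + B5.card))))
  have htot := exp_mul_le_choose_mul_factorial hc0 hmle hnc
  rw [card_simpleDigraph]
  have hfac : (0 : ℝ) < m.factorial := by exact_mod_cast m.factorial_pos
  refine le_of_mul_le_mul_right ?_ hfac
  calc (X : ℝ) * (n : ℝ) ^ (k - 1) * m.factorial = (X * m.factorial) * (n : ℝ) ^ (k - 1) := by ring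
    _ ≤ (B1.card + (B2.card + (B3.card + (B4.card + B5.card)))) * (n : ℝ) ^ (k - 1) := by gcongr
    _ ≤ (2 * C + 3) * N := by linarith
    _ = (2 * C + 3) * Real.exp (2 * (1 + c) * c) * (Real.exp (-(2 * (1 + c) * c)) * N) := by
        rw [Real.exp_neg]; field_simp
    _ ≤ (2 * C + 3) * Real.exp (2 * (1 + c) * c) * ((n * n - n).choose m * m.factorial) := by
        gcongr
    _ = _ := by ring

theorem giant_core_k_strongly_connected
    (k1 k2 : ℕ) (hk1 : 2 ≤ k1) (hk2 : 2 ≤ k2) (c : ℝ) (hc : cstar k1 k2 < c) :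
    ∃ C : ℝ, 0 < C ∧ ∀ n : ℕ, 0 < n →
      (Nat.card {E : Finset (Fin n × Fin n) //
          IsSimpleDigraph E ∧ E.card = ⌊c * n⌋₊ ∧
          (coreSet k1 k2 E = ∅ ∨
            ¬ KStronglyConnectedOn (min k1 k2) E (coreSet k1 k2 E))} : ℝ) ≤
        C * (Nat.card {E : Finset (Fin n × Fin n) //
            IsSimpleDigraph E ∧ E.card = ⌊c * n⌋₊} : ℝ) /
          (n : ℝ) ^ (min k1 k2 - 1) := by
  obtain ⟨K, hK, hev⟩ := exists_eventually_card_bad_le hk1 hk2 hc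
  obtain ⟨n0, hn0⟩ := eventually_atTop.1 hev
  refine ⟨K + (n0 : ℝ) ^ (min k1 k2 - 1), by positivity, fun n hn => ?_⟩
  have hn' : (0 : ℝ) < n := by exact_mod_cast hn
  rw [le_div_iff₀ (by positivity), add_mul]
  rcases le_total n0 n with h | h
  · exact (hn0 n h).trans (le_add_of_nonneg_right (by positivity))
  · refine le_add_of_nonneg_of_le (by positivity) ?_
    rw [mul_comm]
    gcongr
    exact Nat.card_le_card_of_injective (Subtype.map id fun E hE => ⟨hE.1, hE.2.1⟩)
      (Subtype.map_injective _ Function.injective_id)
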